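/- Bulk universality for products of Ginibre matrices and inverse Ginibre matrices (Theorem 4.1): Fix integers M ≥ 1 and K ≥ 1, integers ν_1, …, ν_M ≥ 0, and integers ν̃_1, …, ν̃_K ≥ 0 with ν̃_K = 0. Let x0 > 0 and let φ ∈ (0, π/(M+1)) satisfy x0 = [sin((M+1)φ/(K+1) + Kπ/(K+1))]^{M+1} / ( (sin φ)^{K+1} · [sin((M−K)φ/(K+1) + Kπ/(K+1))]^{M−K} ), and set ρ(φ) = (1/(π·x0)) · [sin((M+1)φ/(K+1) + Kπ/(K+1)) / sin((M−K)φ/(K+1) + Kπ/(K+1))] · sin φ. Then, as n → ∞, e^{−π(ξ−η)·cot φ} · (n^{M−K−1}/ρ(φ)) · K_n( n^{M−K}·(x0 + ξ/(n·ρ(φ))), n^{M−K}·(x0 + η/(n·ρ(φ))) ) converges to the sine kernel K_sin(ξ, η) = sin(π(ξ−η))/(π(ξ−η)) (interpreted as 1 when ξ = η), uniformly for (ξ, η) in any compact subset of ℝ². -/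

import Mathlib

open Complex Real Set Filter MeasureTheory

/-- The point on the vertical contour `𝒞`: `s = -1/2 + iσ`. -/
noncomputable def sC (σ : ℝ) : ℂ := -(1/2) + σ * Complex.I

/-- The point on the circular contour `Σ` (center `(n-1)/2`, radius `n/2 - 1/8`). -/
noncomputable def tC (n : ℕ) (θ : ℝ) : ℂ :=
  ((n : ℂ) - 1) / 2 + ((n : ℂ) / 2 - 1/8) * Complex.exp (θ * Complex.I)

/-- The integrand of the double contour integral defining the kernel for products of
`M` Ginibre matrices and the inverses of `K` Ginibre matrices. -/
noncomputable def integrandMK (M K : ℕ) (ν νt : ℕ → ℕ) (n : ℕ) (x y : ℝ) (s t : ℂ) : ℂ :=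
  (∏ j ∈ Finset.range (M + 1),
      Complex.Gamma (s + (ν j : ℂ) + 1) / Complex.Gamma (t + (ν j : ℂ) + 1)) *
    (∏ k ∈ Finset.Icc 1 K,
      Complex.Gamma ((n : ℂ) - s + (νt k : ℂ)) / Complex.Gamma ((n : ℂ) - t + (νt k : ℂ))) *
    (Complex.Gamma (t - (n : ℂ) + 1) / Complex.Gamma (s - (n : ℂ) + 1)) *
    Complex.exp (t * Real.log x) * Complex.exp (-(s + 1) * Real.log y) / (s - t)

/-- The correlation kernel for products of `M` Ginibre matrices and
the inverses of `K` Ginibre matrices. -/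
noncomputable def KnMK (M K : ℕ) (ν νt : ℕ → ℕ) (n : ℕ) (x y : ℝ) : ℂ :=
  (1 / (2 * (Real.pi : ℂ) * Complex.I) ^ 2) *
    ∫ σ : ℝ, Complex.I *
      ∫ θ in (0 : ℝ)..(2 * Real.pi),
        (((n : ℂ) / 2 - 1/8) * Complex.I * Complex.exp (θ * Complex.I)) *
          integrandMK M K ν νt n x y (sC σ) (tC n θ)

/-- The sine kernel, interpreted as `1` on the diagonal. -/
noncomputable def Ksin (ξ η : ℝ) : ℝ :=
  if ξ = η then 1 else Real.sin (Real.pi * (ξ - η)) / (Real.pi * (ξ - η))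

/-- The limiting density `ρ(φ)` for the product of Ginibre matrices and inverses. -/
noncomputable def ρMK (M K : ℕ) (x0 φ : ℝ) : ℝ :=
  (1 / (Real.pi * x0)) *
    (Real.sin (((M : ℝ) + 1) * φ / ((K : ℝ) + 1) + (K : ℝ) * Real.pi / ((K : ℝ) + 1)) /
      Real.sin (((M : ℝ) - (K : ℝ)) * φ / ((K : ℝ) + 1) + (K : ℝ) * Real.pi / ((K : ℝ) + 1))) *
    Real.sin φ

namespace Ginibre

open scoped Topology

/-- The logarithmic defect in Stirling's formula for the modulus of the Gamma function. -/
noncomputable def stirlingDefect (s : ℂ) : ℝ :=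
  Real.log ‖Complex.Gamma s‖ - ((s - 1 / 2) * Complex.log s - s).re

theorem slitPlane_of_re_of_norm {s : ℂ} (h1 : -(1 / 2) ≤ s.re) (h2 : 2 ≤ ‖s‖) :
    s ∈ Complex.slitPlane := by
  rw [Complex.mem_slitPlane_iff]
  by_contra! h
  obtain ⟨h3, h4⟩ := h
  have : ‖s‖ = |s.re| := by
    rw [← Complex.re_add_im s, h4]; simp
  rw [this, abs_of_nonpos h3] at h2
  linarith

theorem Gamma_ne_zero_of_re_of_norm {s : ℂ} (h1 : -(1 / 2) ≤ s.re) (h2 : 2 ≤ ‖s‖) :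
    Complex.Gamma s ≠ 0 := by
  apply Complex.Gamma_ne_zero
  intro m hm
  have := slitPlane_of_re_of_norm h1 h2
  rw [hm, Complex.mem_slitPlane_iff] at this
  simp at this
  have h : (0 : ℝ) ≤ m := Nat.cast_nonneg m
  linarith

theorem log_add_one_sub_log {s : ℂ} (h1 : -(1 / 2) ≤ s.re) (h2 : 2 ≤ ‖s‖) :
    Complex.log (s + 1) = Complex.log s + Complex.log (1 + 1 / s) := by
  have hs0 : s ≠ 0 := by intro h; rw [h] at h2; simp at h2; linarith
  have hslit := slitPlane_of_re_of_norm h1 h2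
  have hn : ‖1 / s‖ ≤ 1 / 2 := by
    rw [norm_div, norm_one]; exact one_div_le_one_div_of_le (by norm_num) h2
  have hre : 0 < (1 + 1 / s).re := by
    have := (abs_le.mp ((Complex.abs_re_le_norm (1 / s)).trans hn)).1
    rw [Complex.add_re, Complex.one_re]; linarith
  have hne : (1 + 1 / s) ≠ 0 := by intro h; rw [h] at hre; simp at hre
  have himeq : (1 + 1 / s).im = - (s.im / Complex.normSq s) := by
    simp [Complex.inv_im, neg_div]
  have hnsq : 0 < Complex.normSq s := Complex.normSq_pos.mpr hs0
  have hb := Complex.abs_arg_lt_pi_div_two_iff.mpr (Or.inl hre)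
  rw [abs_lt] at hb
  have hs1 := Complex.arg_le_pi s
  have hs2 := Complex.neg_pi_lt_arg s
  have hs3 : s.arg ≠ Real.pi := (Complex.mem_slitPlane_iff_arg.mp hslit).1
  have key : s.arg + (1 + 1 / s).arg ∈ Set.Ioc (-Real.pi) Real.pi := by
    rcases le_total 0 s.im with h | h
    · have h3 : 0 ≤ s.arg := Complex.arg_nonneg_iff.mpr h
      have h4 : (1 + 1 / s).arg ≤ 0 := by
        rcases eq_or_lt_of_le h with h | h
        · have : (1 + 1 / s).im = 0 := by rw [himeq, ← h]; simp
          rw [Complex.arg_eq_zero_iff.mpr ⟨hre.le, this⟩]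
        · have : (1 + 1 / s).im < 0 := by rw [himeq]; exact neg_neg_of_pos (div_pos h hnsq)
          exact (Complex.arg_neg_iff.mpr this).le
      constructor <;> linarith [Real.pi_pos]
    · have h3 : s.arg ≤ 0 := by
        rcases eq_or_lt_of_le h with h | h
        · have hr : 0 ≤ s.re := by
            rcases Complex.mem_slitPlane_iff.mp hslit with h' | h'
            · exact h'.le
            · exact absurd h h'
          rw [Complex.arg_eq_zero_iff.mpr ⟨hr, h⟩]
        · exact (Complex.arg_neg_iff.mpr h).le
      have h4 : 0 ≤ (1 + 1 / s).arg := by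
        apply Complex.arg_nonneg_iff.mpr
        rw [himeq, neg_nonneg]; exact div_nonpos_of_nonpos_of_nonneg h hnsq.le
      constructor <;> linarith [Real.pi_pos]
  rw [← Complex.log_mul hs0 hne key]
  congr 1
  field_simp

theorem abs_stirlingDefect_add_one_sub {s : ℂ} (h1 : -(1 / 2) ≤ s.re) (h2 : 2 ≤ ‖s‖) :
    |stirlingDefect (s + 1) - stirlingDefect s| ≤ 2 / ‖s‖ ^ 2 := by
  have hs0 : s ≠ 0 := by intro h; rw [h] at h2; simp at h2; linarith
  have hG := Gamma_ne_zero_of_re_of_norm h1 h2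
  set w : ℂ := 1 / s with hw
  have hn : ‖w‖ ≤ 1 / 2 := by
    rw [hw, norm_div, norm_one]; exact one_div_le_one_div_of_le (by norm_num) h2
  have hsw : s = 1 / w := by rw [hw]; simp
  have hw0 : w ≠ 0 := by rw [hw]; simp [hs0]
  have hlog := log_add_one_sub_log h1 h2
  rw [← hw] at hlog
  have e1 : stirlingDefect (s + 1) - stirlingDefect s
      = (1 - (s + 1 / 2) * Complex.log (1 + w)).re := by
    unfold stirlingDefect
    rw [Complex.Gamma_add_one s hs0, norm_mul, Real.log_mul (norm_ne_zero_iff.mpr hs0)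
      (norm_ne_zero_iff.mpr hG), hlog, ← Complex.log_re s]
    rw [show (s + 1 - 1 / 2 : ℂ) = (s - 1 / 2) + 1 by ring]
    rw [show (s + 1 / 2 : ℂ) = (s - 1 / 2) + 1 by ring]
    generalize Complex.log (1 + w) = l
    rw [show ((s - 1 / 2 + 1) * (Complex.log s + l) - (s + 1) : ℂ) =
      Complex.log s + ((s - 1 / 2) * Complex.log s - s) - (1 - (s - 1 / 2 + 1) * l) by ring]
    rw [Complex.sub_re, Complex.add_re]
    ring
  rw [e1]
  refine (Complex.abs_re_le_norm _).trans ?_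
  have hT := Complex.norm_log_sub_logTaylor_le 2 (z := w) (by linarith)
  set R := Complex.log (1 + w) - Complex.logTaylor (2 + 1) w with hR
  have hTay : Complex.logTaylor (2 + 1) w = w - w ^ 2 / 2 := by
    rw [Complex.logTaylor_succ, Complex.logTaylor_succ, Complex.logTaylor_succ,
      Complex.logTaylor_zero]
    simp; ring
  have hRl : Complex.log (1 + w) = w - w ^ 2 / 2 + R := by rw [hR, hTay]; ring
  have hRb : ‖R‖ ≤ (2 / 3) * ‖w‖ ^ 3 := by
    refine hT.trans ?_
    have : (1 - ‖w‖)⁻¹ ≤ 2 := by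
      rw [inv_le_comm₀ (by linarith) (by norm_num)]; linarith
    have h3 : 0 ≤ ‖w‖ ^ 3 := by positivity
    norm_num
    nlinarith
  have e2 : 1 - (s + 1 / 2) * Complex.log (1 + w) = w ^ 2 / 4 - s * R - R / 2 := by
    rw [hRl, hsw]; field_simp; ring
  rw [e2]
  have hsn : ‖s‖ = 1 / ‖w‖ := by rw [hsw]; simp
  have hwp : 0 < ‖w‖ := norm_pos_iff.mpr hw0
  have b1 : ‖s * R‖ ≤ (2 / 3) * ‖w‖ ^ 2 := by
    rw [norm_mul, hsn]
    calc 1 / ‖w‖ * ‖R‖ ≤ 1 / ‖w‖ * ((2 / 3) * ‖w‖ ^ 3) := by gcongr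
      _ = _ := by field_simp
  have b2 : ‖R / 2‖ ≤ (1 / 6) * ‖w‖ ^ 2 := by
    rw [norm_div]; norm_num
    nlinarith [sq_nonneg ‖w‖]
  have b3 : ‖w ^ 2 / 4‖ = ‖w‖ ^ 2 / 4 := by rw [norm_div, norm_pow]; norm_num
  have e3 : 2 / ‖s‖ ^ 2 = 2 * ‖w‖ ^ 2 := by rw [hsn]; field_simp
  rw [e3]
  calc ‖w ^ 2 / 4 - s * R - R / 2‖ ≤ ‖w ^ 2 / 4‖ + ‖s * R‖ + ‖R / 2‖ :=
        (norm_sub_le _ _).trans (by gcongr; exact norm_sub_le _ _)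
    _ ≤ _ := by rw [b3]; nlinarith [sq_nonneg ‖w‖]

theorem norm_add_natCast_bounds {s : ℂ} (h1 : -(1 / 2) ≤ s.re) (h2 : 2 ≤ ‖s‖) (k : ℕ) :
    ‖s‖ ≤ ‖s + k‖ ∧ ((k : ℝ) + 1) / 2 ≤ ‖s + k‖ := by
  have e : ‖s + k‖ ^ 2 = ‖s‖ ^ 2 + 2 * k * s.re + (k : ℝ) ^ 2 := by
    rw [← Complex.normSq_eq_norm_sq, ← Complex.normSq_eq_norm_sq, Complex.normSq_apply,
      Complex.normSq_apply]
    simp; ring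
  have hk : (k : ℝ) ≤ (k : ℝ) ^ 2 := by
    rcases Nat.eq_zero_or_pos k with h | h
    · simp [h]
    · have : (1 : ℝ) ≤ k := by exact_mod_cast h
      nlinarith
  have hk0 : (0 : ℝ) ≤ k := Nat.cast_nonneg k
  constructor
  · apply (sq_le_sq₀ (norm_nonneg _) (norm_nonneg _)).mp
    nlinarith
  · apply (sq_le_sq₀ (by positivity) (norm_nonneg _)).mp
    rw [e]
    nlinarith [sq_nonneg ((k : ℝ) - 1)]

theorem sum_one_div_sq_le_two (N : ℕ) :
    ∑ k ∈ Finset.range N, 1 / ((k : ℝ) + 1) ^ 2 ≤ 2 := by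
  have key : ∀ n : ℕ, ∑ k ∈ Finset.range (n + 1), 1 / ((k : ℝ) + 1) ^ 2 ≤ 2 - 1 / ((n : ℝ) + 1) := by
    intro n
    induction n with
    | zero => norm_num
    | succ n ih =>
      rw [Finset.sum_range_succ]
      have h : (0 : ℝ) < n + 1 := by positivity
      have h3 : 1 / (((n : ℝ) + 1) + 1) ^ 2 ≤ 1 / ((n : ℝ) + 1) - 1 / ((n : ℝ) + 1 + 1) := by
        rw [div_sub_div _ _ (by positivity) (by positivity), div_le_div_iff₀ (by positivity)
          (by positivity)]
        nlinarith
      push_cast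
      linarith
  rcases N with _ | n
  · simp
  · have : 0 ≤ 1 / ((n : ℝ) + 1) := by positivity
    linarith [key n]

theorem abs_stirlingDefect_add_natCast_sub {s : ℂ} (h1 : -(1 / 2) ≤ s.re) (h2 : 2 ≤ ‖s‖) (N : ℕ) :
    |stirlingDefect (s + N) - stirlingDefect s| ≤ 16 := by
  have key : |stirlingDefect (s + N) - stirlingDefect s| ≤
      ∑ k ∈ Finset.range N, 8 * (1 / ((k : ℝ) + 1) ^ 2) := by
    induction N with
    | zero => simp
    | succ n ih =>
      rw [Finset.sum_range_succ]
      have hb := norm_add_natCast_bounds h1 h2 n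
      have hr : -(1 / 2) ≤ (s + n).re := by
        have : (0 : ℝ) ≤ n := Nat.cast_nonneg n
        simp; linarith
      have h := abs_stirlingDefect_add_one_sub hr (h2.trans hb.1)
      have h3 : 2 / ‖s + n‖ ^ 2 ≤ 8 * (1 / ((n : ℝ) + 1) ^ 2) := by
        calc 2 / ‖s + n‖ ^ 2 ≤ 2 / (((n : ℝ) + 1) / 2) ^ 2 := by gcongr; exact hb.2
          _ = _ := by field_simp; norm_num
      push_cast
      rw [← add_assoc]
      calc _ = |(stirlingDefect (s + n + 1) - stirlingDefect (s + n)) +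
            (stirlingDefect (s + n) - stirlingDefect s)| := by congr 1; ring
        _ ≤ _ := (abs_add_le _ _).trans (by linarith)
  refine key.trans ?_
  rw [← Finset.mul_sum]
  linarith [sum_one_div_sq_le_two N]

theorem norm_Gamma_add_natCast_add_one {s : ℂ} (h1 : -(1 / 2) ≤ s.re) (h2 : 2 ≤ ‖s‖) {N : ℕ}
    (hN : N ≠ 0) :
    ‖Complex.Gamma (s + N + 1)‖ * ‖Complex.GammaSeq s N‖ =
      ‖Complex.Gamma s‖ * (N : ℝ) ^ s.re * (N.factorial : ℝ) := by
  have hne : ∀ j : ℕ, s + j ≠ 0 := by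
    intro j h
    have := (norm_add_natCast_bounds h1 h2 j).1
    rw [h, norm_zero] at this; linarith
  have hprod : ∀ m : ℕ, Complex.Gamma (s + m) = (∏ j ∈ Finset.range m, (s + j)) *
      Complex.Gamma s := by
    intro m
    induction m with
    | zero => simp
    | succ m ih =>
      rw [Finset.prod_range_succ]
      push_cast
      rw [← add_assoc, Complex.Gamma_add_one _ (hne m), ih]; ring
  have h3 := hprod (N + 1)
  push_cast at h3
  rw [← add_assoc] at h3
  rw [h3, Complex.GammaSeq]
  have hP : (∏ j ∈ Finset.range (N + 1), (s + j)) ≠ 0 :=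
    Finset.prod_ne_zero_iff.mpr fun j _ => hne j
  rw [norm_mul, norm_div, norm_mul, Complex.norm_natCast_cpow_of_pos (Nat.pos_of_ne_zero hN),
    Complex.norm_natCast]
  have := norm_ne_zero_iff.mpr hP
  field_simp

theorem tendsto_stirlingDefect {s : ℂ} (h1 : -(1 / 2) ≤ s.re) (h2 : 2 ≤ ‖s‖) :
    Tendsto (fun N : ℕ => stirlingDefect (s + N + 1)) atTop
      (𝓝 (Real.log (Real.sqrt Real.pi) + Real.log 2 / 2)) := by
  have hG := Gamma_ne_zero_of_re_of_norm h1 h2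
  have t1 : Tendsto (fun N : ℕ => Real.log ‖Complex.GammaSeq s N‖) atTop
      (𝓝 (Real.log ‖Complex.Gamma s‖)) :=
    ((Complex.GammaSeq_tendsto_Gamma s).norm).log (norm_ne_zero_iff.mpr hG)
  have t2 : Tendsto (fun N : ℕ => Real.log (Stirling.stirlingSeq N)) atTop
      (𝓝 (Real.log (Real.sqrt Real.pi))) :=
    Stirling.tendsto_stirlingSeq_sqrt_pi.log (by positivity)
  have t3 : Tendsto (fun N : ℕ => (N : ℂ) * Complex.log (1 + (s + 1) / N)) atTop
      (𝓝 (s + 1)) := by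
    apply Complex.tendsto_nat_mul_log_one_add_of_tendsto
    apply tendsto_const_nhds.congr'
    filter_upwards [eventually_ne_atTop 0] with N hN
    have : (N : ℂ) ≠ 0 := by exact_mod_cast hN
    field_simp
  have t4 : Tendsto (fun N : ℕ => ((N : ℂ))⁻¹) atTop (𝓝 0) := tendsto_inv_atTop_nhds_zero_nat
  have t5 : Tendsto (fun N : ℕ => Complex.log (1 + (s + 1) / N)) atTop (𝓝 0) := by
    have := t4.mul t3
    rw [zero_mul] at this
    apply this.congr'
    filter_upwards [eventually_ne_atTop 0] with N hN
    have : (N : ℂ) ≠ 0 := by exact_mod_cast hN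
    field_simp
  have t6 : Tendsto (fun N : ℕ => ((s + 1 / 2 + N) * Complex.log (1 + (s + 1) / N)).re) atTop
      (𝓝 (s + 1).re) := by
    have : Tendsto (fun N : ℕ => ((s + 1 / 2 + N) * Complex.log (1 + (s + 1) / N))) atTop
      (𝓝 (s + 1)) := by
      have := (t5.const_mul (s + 1 / 2)).add t3
      rw [mul_zero, zero_add] at this
      refine this.congr fun N => ?_
      ring
    exact (Complex.continuous_re.tendsto _).comp this
  have t7 := ((((tendsto_const_nhds (x := Real.log ‖Complex.Gamma s‖)).sub t1).add t2).add
    (tendsto_const_nhds (x := Real.log 2 / 2 + (s + 1).re))).sub t6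
  rw [show Real.log ‖Complex.Gamma s‖ - Real.log ‖Complex.Gamma s‖ +
    Real.log (Real.sqrt Real.pi) + (Real.log 2 / 2 + (s + 1).re) - (s + 1).re =
    Real.log (Real.sqrt Real.pi) + Real.log 2 / 2 by ring] at t7
  apply t7.congr'
  have hev : ∀ᶠ N : ℕ in atTop, Complex.GammaSeq s N ≠ 0 :=
    (Complex.GammaSeq_tendsto_Gamma s).eventually_ne hG
  filter_upwards [eventually_ne_atTop 0, hev] with N hN hgs
  have hNR : (0 : ℝ) < N := by exact_mod_cast Nat.pos_of_ne_zero hN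
  have hNC : (N : ℂ) ≠ 0 := by exact_mod_cast hN
  have e1 := congrArg Real.log (norm_Gamma_add_natCast_add_one h1 h2 hN)
  have hb := norm_add_natCast_bounds h1 h2 (N + 1)
  have hr : -(1 / 2) ≤ (s + N + 1).re := by simp; linarith
  have hn2 : 2 ≤ ‖s + N + 1‖ := by
    have := h2.trans hb.1
    push_cast at this
    rwa [← add_assoc] at this
  have hG' := Gamma_ne_zero_of_re_of_norm hr hn2
  rw [Real.log_mul (norm_ne_zero_iff.mpr hG') (norm_ne_zero_iff.mpr hgs), mul_assoc,
    Real.log_mul (norm_ne_zero_iff.mpr hG) (by positivity), Real.log_mul (by positivity)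
    (by positivity), Real.log_rpow hNR] at e1
  have e2 := Stirling.log_stirlingSeq_formula N
  rw [Real.log_div hNR.ne' (Real.exp_pos 1).ne', Real.log_exp, Real.log_mul (by norm_num) hNR.ne']
    at e2
  have e3 : Complex.log (s + N + 1) = Real.log N + Complex.log (1 + (s + 1) / N) := by
    have hne : (1 + (s + 1) / N) ≠ 0 := by
      intro h
      have : s + N + 1 = 0 := by
        have h3 : s + N + 1 = N * (1 + (s + 1) / N) := by field_simp; ring
        rw [h3, h, mul_zero]
      rw [this, norm_zero] at hn2
      linarith
    rw [← Complex.log_ofReal_mul hNR hne]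
    congr 1
    push_cast
    field_simp
    ring
  rw [stirlingDefect, e3]
  rw [show ((s + N + 1 - 1 / 2) * (Real.log N + Complex.log (1 + (s + 1) / N)) - (s + N + 1) : ℂ)
    = Real.log N * (s + 1 / 2 + N) + (s + 1 / 2 + N) * Complex.log (1 + (s + 1) / N)
      - (s + N + 1) by ring]
  generalize (s + 1 / 2 + N) * Complex.log (1 + (s + 1) / N) = q
  have e4 : (Real.log N * (s + 1 / 2 + N) + q - (s + N + 1)).re =
      Real.log N * (s.re + 1 / 2 + N) + q.re - (s.re + N + 1) := by
    rw [Complex.sub_re, Complex.add_re, Complex.re_ofReal_mul]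
    simp
  rw [e4, Complex.add_re, Complex.one_re]
  linarith

/-- Stirling's formula for the modulus of the Gamma function, up to bounded factors. -/
theorem exists_abs_stirlingDefect_le :
    ∃ C : ℝ, ∀ s : ℂ, -(1 / 2) ≤ s.re → 2 ≤ ‖s‖ → |stirlingDefect s| ≤ C := by
  refine ⟨16 + |Real.log (Real.sqrt Real.pi) + Real.log 2 / 2|, fun s h1 h2 => ?_⟩
  have t := (((tendsto_stirlingDefect h1 h2).sub_const (stirlingDefect s))).abs
  have hle := le_of_tendsto t (Eventually.of_forall fun N => by
    have := abs_stirlingDefect_add_natCast_sub h1 h2 (N + 1)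
    push_cast at this
    rwa [← add_assoc] at this)
  have := abs_sub_abs_le_abs_sub (stirlingDefect s)
    (Real.log (Real.sqrt Real.pi) + Real.log 2 / 2)
  rw [abs_sub_comm] at this
  linarith

/-- The leading term `Re (s log s - s)` of Stirling's formula. -/
noncomputable def lam (s : ℂ) : ℝ := (s * Complex.log s - s).re

theorem log_norm_Gamma_add_natCast (c : ℕ) : ∃ C : ℝ, ∀ s : ℂ, -(1 / 2) ≤ s.re → 2 ≤ ‖s‖ →
    |Real.log ‖Complex.Gamma (s + c)‖ - (((c : ℝ) - 1 / 2) * Real.log ‖s‖ + lam s)| ≤ C := by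
  induction c with
  | zero =>
    obtain ⟨C, hC⟩ := exists_abs_stirlingDefect_le
    refine ⟨C, fun s h1 h2 => ?_⟩
    have := hC s h1 h2
    unfold stirlingDefect at this
    convert this using 2
    rw [Nat.cast_zero, Nat.cast_zero, add_zero, lam,
      show ((s - 1 / 2) * Complex.log s - s) = (s * Complex.log s - s) - (1 / 2 : ℝ) * Complex.log s
        by push_cast; ring, Complex.sub_re (s * Complex.log s - s), Complex.re_ofReal_mul,
        Complex.log_re]
    ring
  | succ c ih =>
    obtain ⟨C, hC⟩ := ih
    refine ⟨C + Real.log (1 + c), fun s h1 h2 => ?_⟩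
    have hb := norm_add_natCast_bounds h1 h2 c
    have hc0 : (0 : ℝ) ≤ c := Nat.cast_nonneg c
    have hpos : 0 < ‖s + c‖ := by linarith
    have hG : Complex.Gamma (s + c) ≠ 0 :=
      Gamma_ne_zero_of_re_of_norm (by simp; linarith) (h2.trans hb.1)
    have e : Complex.Gamma (s + (c + 1 : ℕ)) = (s + c) * Complex.Gamma (s + c) := by
      push_cast
      rw [← add_assoc, Complex.Gamma_add_one _ (norm_pos_iff.mp hpos)]
    rw [e, norm_mul, Real.log_mul hpos.ne' (norm_ne_zero_iff.mpr hG)]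
    have h3 : Real.log ‖s‖ ≤ Real.log ‖s + c‖ := Real.log_le_log (by linarith) hb.1
    have h4 : Real.log ‖s + c‖ ≤ Real.log ‖s‖ + Real.log (1 + c) := by
      rw [← Real.log_mul (by linarith) (by positivity)]
      apply Real.log_le_log hpos
      calc ‖s + c‖ ≤ ‖s‖ + ‖(c : ℂ)‖ := norm_add_le _ _
        _ = ‖s‖ + c := by simp
        _ ≤ _ := by nlinarith
    have h5 := hC s h1 h2
    push_cast
    rw [abs_le] at h5 ⊢
    constructor <;> nlinarith [h5.1, h5.2]

theorem norm_Gamma_le_of_abs_le {x τ τ' : ℝ} (hx : 0 < x) (h : |τ| ≤ |τ'|) :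
    ‖Complex.Gamma (x + τ' * Complex.I)‖ ≤ ‖Complex.Gamma (x + τ * Complex.I)‖ := by
  refine le_of_tendsto_of_tendsto (Complex.GammaSeq_tendsto_Gamma _).norm
    (Complex.GammaSeq_tendsto_Gamma _).norm ?_
  filter_upwards [eventually_ne_atTop 0] with N hN
  unfold Complex.GammaSeq
  rw [norm_div, norm_div, norm_mul, norm_mul,
    Complex.norm_natCast_cpow_of_pos (Nat.pos_of_ne_zero hN),
    Complex.norm_natCast_cpow_of_pos (Nat.pos_of_ne_zero hN), norm_prod, norm_prod]
  have hnn : ∀ (t : ℝ) (j : ℕ), ‖(x + t * Complex.I + j : ℂ)‖ ^ 2 = (x + j) ^ 2 + t ^ 2 := by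
    intro t j
    rw [← Complex.normSq_eq_norm_sq, Complex.normSq_apply]
    simp; ring
  have hp : ∀ (t : ℝ) (j : ℕ), 0 < ‖(x + t * Complex.I + j : ℂ)‖ := by
    intro t j
    have hj : (0 : ℝ) ≤ j := Nat.cast_nonneg j
    rw [norm_pos_iff]
    intro h0
    have := congrArg Complex.re h0
    simp at this
    linarith
  have hre : ∀ t : ℝ, (x + t * Complex.I : ℂ).re = x := by intro t; simp
  rw [hre, hre]
  apply div_le_div_of_nonneg_left (by positivity) (Finset.prod_pos fun j _ => hp _ _)
  apply Finset.prod_le_prod (fun j _ => norm_nonneg _)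
  intro j _
  apply (sq_le_sq₀ (norm_nonneg _) (norm_nonneg _)).mp
  rw [hnn, hnn]
  have := sq_le_sq.mpr h
  linarith

/-- The nodal polynomial `∏_{i < n} (s - i)`. -/
noncomputable def nodal (n : ℕ) (s : ℂ) : ℂ := ∏ i ∈ Finset.range n, (s - i)

/-- The zero-free Gamma factors of the kernel. -/
noncomputable def gammas (M K : ℕ) (ν νt : ℕ → ℕ) (n : ℕ) (s : ℂ) : ℂ :=
  (∏ j ∈ Finset.Icc 1 M, Complex.Gamma (s + (ν j : ℂ) + 1)) *
    ∏ k ∈ Finset.Icc 1 K, Complex.Gamma ((n : ℂ) - s + (νt k : ℂ))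

theorem Gamma_mul_Gamma_mul_sin (n : ℕ) {s : ℂ} (hs : ∀ m : ℤ, s ≠ m) :
    Complex.Gamma (s + 1) * Complex.Gamma (n - s) * Complex.sin (Real.pi * s) =
      (-1) ^ (n + 1) * Real.pi * nodal n s := by
  induction n with
  | zero =>
    have h := Complex.Gamma_mul_Gamma_one_sub (-s)
    have hsin : Complex.sin (Real.pi * s) ≠ 0 := by
      rw [Complex.sin_ne_zero_iff]
      intro k hk
      have hpi : (Real.pi : ℂ) ≠ 0 := by exact_mod_cast Real.pi_ne_zero
      apply hs k
      apply mul_left_cancel₀ hpi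
      rw [hk]; ring
    rw [show (1 - -s) = s + 1 by ring, mul_neg, Complex.sin_neg] at h
    simp only [Nat.cast_zero, zero_sub, nodal, Finset.range_zero, Finset.prod_empty]
    rw [mul_comm (Complex.Gamma (s + 1)), h]
    field_simp
    ring
  | succ n ih =>
    have hne : (n : ℂ) - s ≠ 0 := by
      intro h
      exact hs n (by push_cast; linear_combination -h)
    have e : Complex.Gamma ((n + 1 : ℕ) - s) = (n - s) * Complex.Gamma (n - s) := by
      rw [← Complex.Gamma_add_one _ hne]; congr 1; push_cast; ring
    rw [e, nodal, Finset.prod_range_succ, ← nodal, pow_succ]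
    linear_combination (n - s) * ih

theorem norm_nodal_mul_pi (n : ℕ) {s : ℂ} (hs : ∀ m : ℤ, s ≠ m) :
    ‖nodal n s‖ * Real.pi = ‖Complex.Gamma (s + 1)‖ * ‖Complex.Gamma (n - s)‖ *
      ‖Complex.sin (Real.pi * s)‖ := by
  have := congrArg norm (Gamma_mul_Gamma_mul_sin n hs)
  rw [norm_mul, norm_mul, norm_mul, norm_mul, norm_pow, norm_neg, norm_one, one_pow, one_mul,
    Complex.norm_real, Real.norm_of_nonneg Real.pi_pos.le] at this
  rw [this]; ring

theorem norm_sin_le_exp_abs_im (z : ℂ) : ‖Complex.sin z‖ ≤ Real.exp |z.im| := by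
  rw [Complex.sin, norm_div, norm_mul, Complex.norm_I, mul_one]
  have h1 : ‖Complex.exp (-z * Complex.I)‖ ≤ Real.exp |z.im| := by
    rw [Complex.norm_exp]; simp [le_abs_self]
  have h2 : ‖Complex.exp (z * Complex.I)‖ ≤ Real.exp |z.im| := by
    rw [Complex.norm_exp]; simp [neg_le_abs]
  have h3 := norm_sub_le (Complex.exp (-z * Complex.I)) (Complex.exp (z * Complex.I))
  rw [show ‖(2 : ℂ)‖ = 2 by simp]
  linarith

theorem exp_abs_im_div_four_le_norm_sin {z : ℂ} (h : 1 ≤ |z.im|) :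
    Real.exp |z.im| / 4 ≤ ‖Complex.sin z‖ := by
  rw [Complex.sin, norm_div, norm_mul, Complex.norm_I, mul_one]
  have h1 : ‖Complex.exp (-z * Complex.I)‖ = Real.exp z.im := by
    rw [Complex.norm_exp]; simp
  have h2 : ‖Complex.exp (z * Complex.I)‖ = Real.exp (-z.im) := by
    rw [Complex.norm_exp]; simp
  have h3 := abs_norm_sub_norm_le (Complex.exp (-z * Complex.I)) (Complex.exp (z * Complex.I))
  rw [h1, h2] at h3
  have key : Real.exp (-|z.im|) ≤ Real.exp |z.im| / 2 := by
    have h4 : Real.exp (-|z.im|) ≤ 1 := by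
      rw [Real.exp_le_one_iff]; linarith
    have := Real.add_one_le_exp |z.im|
    linarith
  have h5 : Real.exp |z.im| - Real.exp (-|z.im|) ≤ |Real.exp z.im - Real.exp (-z.im)| := by
    rcases le_total 0 z.im with h0 | h0
    · rw [abs_of_nonneg h0]; exact le_abs_self _
    · rw [abs_of_nonpos h0, neg_neg, abs_sub_comm]; exact le_abs_self _
  rw [show ‖(2 : ℂ)‖ = 2 by simp]
  linarith

theorem norm_nodal_mul_pi_le (n : ℕ) {s : ℂ} (h1 : -1 < s.re) (h2 : s.re < n) :
    ‖nodal n s‖ * Real.pi ≤ ‖Complex.Gamma (s + 1)‖ * ‖Complex.Gamma (n - s)‖ *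
      Real.exp (Real.pi * |s.im|) := by
  by_cases hs : ∀ m : ℤ, s ≠ m
  · rw [norm_nodal_mul_pi n hs]
    gcongr
    refine (norm_sin_le_exp_abs_im _).trans_eq ?_
    rw [Complex.im_ofReal_mul, abs_mul, abs_of_pos Real.pi_pos]
  · push Not at hs
    obtain ⟨m, rfl⟩ := hs
    simp only [Complex.intCast_re] at h1 h2
    have h3 : -1 < m := by exact_mod_cast h1
    have h4 : m < n := by exact_mod_cast h2
    have : nodal n (m : ℂ) = 0 := by
      apply Finset.prod_eq_zero (i := m.toNat)
      · simp; omega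
      · have : ((m.toNat : ℤ)) = m := Int.toNat_of_nonneg (by omega)
        have h5 : ((m.toNat : ℂ)) = m := by exact_mod_cast congrArg (Int.cast : ℤ → ℂ) this
        rw [h5, sub_self]
    rw [this]
    simp only [norm_zero, zero_mul]
    positivity

theorem lam_natCast_mul {n : ℕ} (hn : 0 < n) {z : ℂ} (hz : z ≠ 0) :
    lam (n * z) = n * lam z + n * Real.log n * z.re := by
  have hnR : (0 : ℝ) < n := by exact_mod_cast hn
  have : Complex.log (n * z) = Real.log n + Complex.log z := by
    rw [← Complex.log_ofReal_mul hnR hz]; simp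
  rw [lam, this, show ((n : ℂ) * z * (Real.log n + Complex.log z) - n * z) =
    ((n : ℝ) : ℂ) * (z * Complex.log z - z) + ((n * Real.log n : ℝ) : ℂ) * z by push_cast; ring,
    Complex.add_re, Complex.re_ofReal_mul, Complex.re_ofReal_mul, lam]

/-- Sum of the logarithms of the moduli of the Gamma factors after reflection. -/
noncomputable def logGammas (M K : ℕ) (ν νt : ℕ → ℕ) (n : ℕ) (s : ℂ) : ℝ :=
  ∑ j ∈ Finset.range (M + 1), Real.log ‖Complex.Gamma (s + (ν j : ℂ) + 1)‖ +
    (∑ k ∈ Finset.Icc 1 K, Real.log ‖Complex.Gamma ((n : ℂ) - s + (νt k : ℂ))‖ +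
      Real.log ‖Complex.Gamma (n - s)‖)

theorem exists_abs_logGammas_sub_le (M K : ℕ) (ν νt : ℕ → ℕ) : ∃ C α β : ℝ, ∀ (n : ℕ) (s : ℂ),
    -(1 / 2) ≤ s.re → 2 ≤ ‖s‖ → -(1 / 2) ≤ ((n : ℂ) - s).re → 2 ≤ ‖(n : ℂ) - s‖ →
    |logGammas M K ν νt n s - (α * Real.log ‖s‖ + β * Real.log ‖(n : ℂ) - s‖ +
      (M + 1) * lam s + (K + 1) * lam (n - s))| ≤ C := by
  choose C hC using log_norm_Gamma_add_natCast
  refine ⟨∑ j ∈ Finset.range (M + 1), C (ν j + 1) + (∑ k ∈ Finset.Icc 1 K, C (νt k) + C 0),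
    ∑ j ∈ Finset.range (M + 1), (((ν j + 1 : ℕ) : ℝ) - 1 / 2),
    ∑ k ∈ Finset.Icc 1 K, ((νt k : ℝ) - 1 / 2) + ((0 : ℕ) - 1 / 2), fun n s h1 h2 h3 h4 => ?_⟩
  have e : logGammas M K ν νt n s - (((∑ j ∈ Finset.range (M + 1), (((ν j + 1 : ℕ) : ℝ) - 1 / 2))) *
      Real.log ‖s‖ + (∑ k ∈ Finset.Icc 1 K, ((νt k : ℝ) - 1 / 2) + ((0 : ℕ) - 1 / 2)) *
      Real.log ‖(n : ℂ) - s‖ + (M + 1) * lam s + (K + 1) * lam (n - s)) =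
      ∑ j ∈ Finset.range (M + 1), (Real.log ‖Complex.Gamma (s + (ν j + 1 : ℕ))‖ -
        ((((ν j + 1 : ℕ) : ℝ) - 1 / 2) * Real.log ‖s‖ + lam s)) +
      (∑ k ∈ Finset.Icc 1 K, (Real.log ‖Complex.Gamma ((n : ℂ) - s + (νt k : ℕ))‖ -
        (((νt k : ℝ) - 1 / 2) * Real.log ‖(n : ℂ) - s‖ + lam (n - s))) +
      (Real.log ‖Complex.Gamma ((n : ℂ) - s + (0 : ℕ))‖ -
        (((0 : ℕ) - 1 / 2) * Real.log ‖(n : ℂ) - s‖ + lam (n - s)))) := by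
    rw [Finset.sum_sub_distrib (s := Finset.range (M + 1))
        (f := fun j => Real.log ‖Complex.Gamma (s + (ν j + 1 : ℕ))‖),
      Finset.sum_sub_distrib (s := Finset.Icc 1 K)
        (f := fun k => Real.log ‖Complex.Gamma ((n : ℂ) - s + (νt k : ℕ))‖), Finset.sum_add_distrib,
      Finset.sum_add_distrib, ← Finset.sum_mul, ← Finset.sum_mul]
    simp only [logGammas, Finset.sum_const, Finset.card_range, Nat.card_Icc, nsmul_eq_mul,
      Nat.cast_zero, add_zero, Nat.add_sub_cancel]
    push_cast
    simp only [← add_assoc]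
    ring
  rw [e]
  refine (abs_add_le _ _).trans (add_le_add ?_ ((abs_add_le _ _).trans (add_le_add ?_ ?_)))
  · exact (Finset.abs_sum_le_sum_abs _ _).trans (Finset.sum_le_sum fun j _ => hC _ s h1 h2)
  · exact (Finset.abs_sum_le_sum_abs _ _).trans (Finset.sum_le_sum fun j _ => hC _ _ h3 h4)
  · exact hC 0 _ h3 h4

/-- The product of Gamma factors `G(s)` whose ratio `G(s) / G(t)` appears in the kernel. -/
noncomputable def weight (M K : ℕ) (ν νt : ℕ → ℕ) (n : ℕ) (s : ℂ) : ℂ :=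
  nodal n s * gammas M K ν νt n s

/-- The phase function of the saddle point analysis. -/
noncomputable def phase (M K : ℕ) (x0 : ℝ) (z : ℂ) : ℝ :=
  (M + 1) * lam z + (K + 1) * lam (1 - z) + Real.pi * |z.im| - z.re * Real.log x0

theorem prod_range_succ_eq_mul_prod_Icc {R : Type*} [CommMonoid R] (f : ℕ → R) (M : ℕ) :
    ∏ j ∈ Finset.range (M + 1), f j = f 0 * ∏ j ∈ Finset.Icc 1 M, f j := by
  have : Finset.Icc 1 M = Finset.Ico (0 + 1) (M + 1) := by
    ext; simp only [Finset.mem_Icc, Finset.mem_Ico]; omega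
  rw [this, Finset.range_eq_Ico, Finset.prod_eq_prod_Ico_succ_bot (Nat.succ_pos M)]

theorem exp_logGammas {M K : ℕ} {ν νt : ℕ → ℕ} (hν0 : ν 0 = 0) {n : ℕ} {s : ℂ}
    (h1 : -1 < s.re) (h2 : s.re < n) :
    Real.exp (logGammas M K ν νt n s) =
      ‖Complex.Gamma (s + 1)‖ * ‖Complex.Gamma (n - s)‖ * ‖gammas M K ν νt n s‖ := by
  have p1 : ∀ j, 0 < ‖Complex.Gamma (s + (ν j : ℂ) + 1)‖ := by
    intro j
    have hj : (0 : ℝ) ≤ ν j := Nat.cast_nonneg _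
    exact norm_pos_iff.mpr (Complex.Gamma_ne_zero_of_re_pos (by simp; linarith))
  have p2 : ∀ k : ℕ, 0 < ‖Complex.Gamma ((n : ℂ) - s + (k : ℂ))‖ := by
    intro k
    have hj : (0 : ℝ) ≤ k := Nat.cast_nonneg _
    exact norm_pos_iff.mpr (Complex.Gamma_ne_zero_of_re_pos (by simp; linarith))
  have p3 := p2 0
  rw [Nat.cast_zero, add_zero] at p3
  rw [logGammas, Real.exp_add, Real.exp_add, Real.exp_sum, Real.exp_sum, Real.exp_log p3]
  rw [Finset.prod_congr rfl fun j _ => Real.exp_log (p1 j),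
    Finset.prod_congr rfl fun k _ => Real.exp_log (p2 (νt k)), prod_range_succ_eq_mul_prod_Icc,
    hν0, gammas, norm_mul, norm_prod, norm_prod]
  simp only [Nat.cast_zero, add_zero]
  ring

theorem norm_weight_mul_pi_le {M K : ℕ} {ν νt : ℕ → ℕ} (hν0 : ν 0 = 0) {n : ℕ} {s : ℂ}
    (h1 : -1 < s.re) (h2 : s.re < n) :
    ‖weight M K ν νt n s‖ * Real.pi ≤
      Real.exp (logGammas M K ν νt n s + Real.pi * |s.im|) := by
  rw [Real.exp_add, exp_logGammas hν0 h1 h2, weight, norm_mul]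
  have := mul_le_mul_of_nonneg_right (norm_nodal_mul_pi_le n h1 h2)
    (norm_nonneg (gammas M K ν νt n s))
  nlinarith

theorem exp_logGammas_le_norm_weight {M K : ℕ} {ν νt : ℕ → ℕ} (hν0 : ν 0 = 0) {n : ℕ} {s : ℂ}
    (h1 : -1 < s.re) (h2 : s.re < n) (h3 : 1 ≤ |s.im|) :
    Real.exp (logGammas M K ν νt n s + Real.pi * |s.im|) ≤
      4 * Real.pi * ‖weight M K ν νt n s‖ := by
  have hs : ∀ m : ℤ, s ≠ m := by
    rintro m rfl
    simp at h3
    linarith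
  rw [Real.exp_add, exp_logGammas hν0 h1 h2, weight, norm_mul]
  have e := norm_nodal_mul_pi n hs
  have him : |((Real.pi : ℂ) * s).im| = Real.pi * |s.im| := by
    rw [Complex.im_ofReal_mul, abs_mul, abs_of_pos Real.pi_pos]
  have hsin := exp_abs_im_div_four_le_norm_sin (z := Real.pi * s)
    (by rw [him]; nlinarith [Real.pi_gt_three])
  rw [him] at hsin
  have : 0 ≤ ‖Complex.Gamma (s + 1)‖ * ‖Complex.Gamma (n - s)‖ * ‖gammas M K ν νt n s‖ := by
    positivity
  calc _ ≤ ‖Complex.Gamma (s + 1)‖ * ‖Complex.Gamma (n - s)‖ * ‖gammas M K ν νt n s‖ *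
        (4 * ‖Complex.sin (Real.pi * s)‖) := by gcongr; linarith
    _ = 4 * ‖gammas M K ν νt n s‖ * (‖Complex.Gamma (s + 1)‖ * ‖Complex.Gamma (n - s)‖ *
      ‖Complex.sin (Real.pi * s)‖) := by ring
    _ = _ := by rw [← e]; ring

/-- Two-sided bounds for the weight in terms of the phase function, up to bounded factors. -/
theorem exists_norm_weight_bounds (M K : ℕ) (ν νt : ℕ → ℕ) (hν0 : ν 0 = 0) (x0 : ℝ) :
    ∃ C α β : ℝ, ∀ (n : ℕ) (z : ℂ), 0 < n → -(1 / 2) ≤ n * z.re → z.re < 1 →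
    2 ≤ n * ‖z‖ → 2 ≤ n * ‖1 - z‖ →
    ‖weight M K ν νt n (n * z)‖ ≤ Real.exp (C + α * Real.log ‖z‖ + β * Real.log ‖1 - z‖ +
      ((α + β) * Real.log n + (K + 1) * (n * Real.log n)) + n * phase M K x0 z +
      n * z.re * (((M : ℝ) - K) * Real.log n + Real.log x0)) ∧
    (1 ≤ n * |z.im| → Real.exp (-C + α * Real.log ‖z‖ + β * Real.log ‖1 - z‖ +
      ((α + β) * Real.log n + (K + 1) * (n * Real.log n)) + n * phase M K x0 z +
      n * z.re * (((M : ℝ) - K) * Real.log n + Real.log x0)) ≤ ‖weight M K ν νt n (n * z)‖) := by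
  obtain ⟨C, α, β, hC⟩ := exists_abs_logGammas_sub_le M K ν νt
  refine ⟨C + Real.log (4 * Real.pi), α, β, fun n z hn h1 h2 h3 h4 => ?_⟩
  have hnR : (0 : ℝ) < n := by exact_mod_cast hn
  have hz : z ≠ 0 := by rintro rfl; simp at h3; linarith
  have hz1 : 1 - z ≠ 0 := by intro h; rw [h] at h4; simp at h4; linarith
  have er : ((n : ℂ) * z).re = n * z.re := by simp
  have ei : ((n : ℂ) * z).im = n * z.im := by simp
  have es : (n : ℂ) - n * z = n * (1 - z) := by ring
  have er' : ((n : ℂ) * (1 - z)).re = n * (1 - z.re) := by simp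
  have hlt : n * z.re < n := by nlinarith
  have h := hC n (n * z) (by rw [er]; linarith) (by simpa using h3)
    (by rw [es, er']; nlinarith) (by rw [es]; simpa using h4)
  rw [es, lam_natCast_mul hn hz, lam_natCast_mul hn hz1, norm_mul, norm_mul, Complex.norm_natCast,
    Real.log_mul hnR.ne' (norm_ne_zero_iff.mpr hz),
    Real.log_mul hnR.ne' (norm_ne_zero_iff.mpr hz1), abs_le] at h
  have e : α * (Real.log n + Real.log ‖z‖) + β * (Real.log n + Real.log ‖1 - z‖) +
      (M + 1) * (n * lam z + n * Real.log n * z.re) +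
      (K + 1) * (n * lam (1 - z) + n * Real.log n * (1 - z).re) + Real.pi * (n * |z.im|) =
      α * Real.log ‖z‖ + β * Real.log ‖1 - z‖ +
      ((α + β) * Real.log n + (K + 1) * (n * Real.log n)) + n * phase M K x0 z +
      n * z.re * (((M : ℝ) - K) * Real.log n + Real.log x0) := by
    rw [phase, Complex.sub_re, Complex.one_re]; ring
  have him : |((n : ℂ) * z).im| = n * |z.im| := by rw [ei, abs_mul, abs_of_pos hnR]
  have hpi := Real.pi_gt_three
  constructor
  · have hu := norm_weight_mul_pi_le (M := M) (K := K) (νt := νt) hν0 (n := n) (s := n * z)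
      (by rw [er]; linarith) (by rw [er]; exact hlt)
    calc ‖weight M K ν νt n (n * z)‖ ≤ ‖weight M K ν νt n (n * z)‖ * Real.pi :=
          le_mul_of_one_le_right (norm_nonneg _) (by linarith)
      _ ≤ _ := hu
      _ ≤ _ := by
        apply Real.exp_le_exp.mpr
        have : 0 ≤ Real.log (4 * Real.pi) := Real.log_nonneg (by linarith)
        rw [him]
        linarith [h.2]
  · intro hi
    have hl := exp_logGammas_le_norm_weight (M := M) (K := K) (νt := νt) hν0 (n := n) (s := n * z)
      (by rw [er]; linarith) (by rw [er]; exact hlt) (by rw [him]; exact hi)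
    have h5 : Real.exp (logGammas M K ν νt n (n * z) + Real.pi * |((n : ℂ) * z).im| -
        Real.log (4 * Real.pi)) ≤ ‖weight M K ν νt n (n * z)‖ := by
      rw [Real.exp_sub, Real.exp_log (by positivity), div_le_iff₀' (by positivity)]
      exact hl
    refine le_trans (Real.exp_le_exp.mpr ?_) h5
    rw [him]
    linarith [h.1]

theorem norm_Gamma_sq_mul_norm_sin (τ : ℝ) :
    ‖Complex.Gamma (-(1 / 2) + τ * Complex.I + 1)‖ ^ 2 *
      ‖Complex.sin (Real.pi * (-(1 / 2) + τ * Complex.I))‖ = Real.pi := by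
  have hs : ∀ m : ℤ, (-(1 / 2) + τ * Complex.I : ℂ) ≠ m := by
    intro m h
    have h1 := congrArg Complex.re h
    simp at h1
    have h2 : (2 * m + 1 : ℝ) = 0 := by linarith
    have h3 : (2 * m + 1 : ℤ) = 0 := by exact_mod_cast h2
    omega
  have h := norm_nodal_mul_pi 0 hs
  rw [nodal, Finset.range_zero, Finset.prod_empty, norm_one, one_mul] at h
  have hc : ((0 : ℕ) : ℂ) - (-(1 / 2) + τ * Complex.I) =
      (starRingEnd ℂ) (-(1 / 2) + τ * Complex.I + 1) := by
    apply Complex.ext <;> simp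
    norm_num
  rw [hc, Complex.Gamma_conj, Complex.norm_conj] at h
  rw [sq]
  exact h.symm

theorem norm_weight_left_le {M K : ℕ} (hM : 1 ≤ M) (ν νt : ℕ → ℕ) {n : ℕ} (hn : 0 < n)
    {τ τ' : ℝ} (h : |τ| ≤ |τ'|) :
    ‖weight M K ν νt n (-(1 / 2) + τ' * Complex.I)‖ ≤
      (1 + 2 * |τ'|) ^ ν 1 * ‖weight M K ν νt n (-(1 / 2) + τ * Complex.I)‖ := by
  have hn1 : (1 : ℝ) ≤ n := by exact_mod_cast hn
  have hset : Finset.Icc 1 M = insert 1 (Finset.Icc 2 M) := by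
    ext; simp; omega
  have hrep : ∀ t : ℝ, ‖weight M K ν νt n (-(1 / 2) + t * Complex.I)‖ =
      (∏ i ∈ Finset.range (ν 1), ‖(((1 / 2 + i : ℝ)) : ℂ) + t * Complex.I‖) *
      (‖Complex.Gamma ((n + 1 / 2 : ℝ) + (-t : ℝ) * Complex.I)‖ *
      (∏ j ∈ Finset.Icc 2 M, ‖Complex.Gamma ((1 / 2 + ν j : ℝ) + t * Complex.I)‖) *
      ∏ k ∈ Finset.Icc 1 K, ‖Complex.Gamma ((n + 1 / 2 + νt k : ℝ) + (-t : ℝ) * Complex.I)‖) := by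
    intro t
    have hs : ∀ m : ℤ, (-(1 / 2) + t * Complex.I : ℂ) ≠ m := by
      intro m h
      have h1 := congrArg Complex.re h
      simp at h1
      have h2 : (2 * m + 1 : ℝ) = 0 := by linarith
      have h3 : (2 * m + 1 : ℤ) = 0 := by exact_mod_cast h2
      omega
    have hG : ∀ m : ℕ, Complex.Gamma (-(1 / 2) + t * Complex.I + (m : ℂ) + 1) =
        (∏ i ∈ Finset.range m, ((((1 / 2 + i : ℝ)) : ℂ) + t * Complex.I)) *
        Complex.Gamma (-(1 / 2) + t * Complex.I + 1) := by
      intro m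
      induction m with
      | zero => simp
      | succ m ih =>
        have hne : (-(1 / 2) + t * Complex.I + (m : ℂ) + 1) ≠ 0 := by
          intro h
          exact hs (-(m + 1)) (by push_cast; linear_combination h)
        rw [Finset.prod_range_succ]
        push_cast at ih ⊢
        rw [show (-(1 / 2) + t * Complex.I + ((m : ℂ) + 1) + 1) =
          (-(1 / 2) + t * Complex.I + (m : ℂ) + 1) + 1 by ring, Complex.Gamma_add_one _ hne, ih]
        ring
    have e1 := norm_nodal_mul_pi n hs
    have e2 := norm_Gamma_sq_mul_norm_sin t
    rw [weight, norm_mul, gammas, norm_mul, norm_prod, norm_prod, hset, Finset.prod_insert (by simp),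
      hG (ν 1), norm_mul, norm_prod]
    have a1 : ∀ j, (-(1 / 2) + t * Complex.I + (ν j : ℂ) + 1) =
        ((1 / 2 + ν j : ℝ) + t * Complex.I) := by intro j; push_cast; ring
    have a2 : ∀ k, ((n : ℂ) - (-(1 / 2) + t * Complex.I) + (νt k : ℂ)) =
        ((n + 1 / 2 + νt k : ℝ) + (-t : ℝ) * Complex.I) := by intro k; push_cast; ring
    have a3 : ((n : ℂ) - (-(1 / 2) + t * Complex.I)) =
        ((n + 1 / 2 : ℝ) + (-t : ℝ) * Complex.I) := by push_cast; ring
    simp only [a1, a2]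
    rw [a3] at e1
    set g := ‖Complex.Gamma (-(1 / 2) + t * Complex.I + 1)‖
    set A := ∏ i ∈ Finset.range (ν 1), ‖(((1 / 2 + i : ℝ)) : ℂ) + t * Complex.I‖
    set B := ∏ j ∈ Finset.Icc 2 M, ‖Complex.Gamma ((1 / 2 + ν j : ℝ) + t * Complex.I)‖
    set D := ∏ k ∈ Finset.Icc 1 K, ‖Complex.Gamma ((n + 1 / 2 + νt k : ℝ) + (-t : ℝ) * Complex.I)‖
    set F := ‖Complex.Gamma ((n + 1 / 2 : ℝ) + (-t : ℝ) * Complex.I)‖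
    set q := ‖Complex.sin (Real.pi * (-(1 / 2) + t * Complex.I))‖
    apply mul_right_cancel₀ Real.pi_ne_zero
    linear_combination (A * g * B * D) * e1 + (A * B * D * F) * e2
  have h' : |-τ| ≤ |-τ'| := by rwa [abs_neg, abs_neg]
  have hA : ∏ i ∈ Finset.range (ν 1), ‖(((1 / 2 + i : ℝ)) : ℂ) + τ' * Complex.I‖ ≤
      (1 + 2 * |τ'|) ^ ν 1 *
        ∏ i ∈ Finset.range (ν 1), ‖(((1 / 2 + i : ℝ)) : ℂ) + τ * Complex.I‖ := by
    have e : (1 + 2 * |τ'|) ^ ν 1 = ∏ _i ∈ Finset.range (ν 1), (1 + 2 * |τ'|) := by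
      rw [Finset.prod_const, Finset.card_range]
    rw [e, ← Finset.prod_mul_distrib]
    refine Finset.prod_le_prod (fun _ _ => norm_nonneg _) fun i _ => ?_
    have hi : (0 : ℝ) ≤ i := Nat.cast_nonneg i
    have h1 : ‖(((1 / 2 + i : ℝ)) : ℂ) + τ' * Complex.I‖ ≤ 1 / 2 + i + |τ'| := by
      refine (norm_add_le _ _).trans_eq ?_
      rw [Complex.norm_real, norm_mul, Complex.norm_I, mul_one, Complex.norm_real,
        Real.norm_of_nonneg (by positivity), Real.norm_eq_abs]
    have h2 : 1 / 2 + (i : ℝ) ≤ ‖(((1 / 2 + i : ℝ)) : ℂ) + τ * Complex.I‖ := by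
      refine le_trans ?_ ((le_abs_self _).trans (Complex.abs_re_le_norm _))
      simp
    have h3 := abs_nonneg τ'
    calc _ ≤ 1 / 2 + i + |τ'| := h1
      _ ≤ (1 + 2 * |τ'|) * (1 / 2 + i) := by nlinarith
      _ ≤ _ := by gcongr
  rw [hrep, hrep, ← mul_assoc ((1 + 2 * |τ'|) ^ ν 1)]
  refine mul_le_mul hA (mul_le_mul (mul_le_mul ?_ ?_ ?_ ?_) ?_ ?_ ?_) (by positivity)
    (by positivity)
  · exact norm_Gamma_le_of_abs_le (by linarith) h'
  · exact Finset.prod_le_prod (fun _ _ => norm_nonneg _) fun j _ =>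
      norm_Gamma_le_of_abs_le (by positivity) h
  · positivity
  · positivity
  · exact Finset.prod_le_prod (fun _ _ => norm_nonneg _) fun j _ =>
      norm_Gamma_le_of_abs_le (by positivity) h'
  · positivity
  · positivity

theorem norm_weight_reflect (M K : ℕ) (ν νt : ℕ → ℕ) (n : ℕ) (t : ℂ) :
    ‖weight M K ν νt n (n - 1 - t)‖ = ‖weight K M νt ν n t‖ := by
  have e1 : ‖nodal n (n - 1 - t)‖ = ‖nodal n t‖ := by
    rw [nodal, nodal, norm_prod, norm_prod, ← Finset.prod_range_reflect]
    apply Finset.prod_congr rfl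
    intro i hi
    have : i < n := Finset.mem_range.mp hi
    rw [Nat.cast_sub (by omega), Nat.cast_sub (by omega), ← norm_neg]
    congr 1
    push_cast
    ring
  rw [weight, weight, norm_mul, norm_mul, e1, gammas, gammas, mul_comm (∏ j ∈ Finset.Icc 1 M, _)]
  congr 4
  · ext k; congr 1; ring
  · ext k; congr 1; ring

theorem norm_weight_right_le {M K : ℕ} (hK : 1 ≤ K) (ν νt : ℕ → ℕ) {n : ℕ} (hn : 0 < n)
    {τ τ' : ℝ} (h : |τ| ≤ |τ'|) :
    ‖weight M K ν νt n (n - 1 / 2 + τ' * Complex.I)‖ ≤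
      (1 + 2 * |τ'|) ^ νt 1 * ‖weight M K ν νt n (n - 1 / 2 + τ * Complex.I)‖ := by
  have e : ∀ t : ℝ, ((n : ℂ) - 1 / 2 + t * Complex.I) =
      n - 1 - (-(1 / 2) + (-t : ℝ) * Complex.I) := by intro t; push_cast; ring
  rw [e, e, norm_weight_reflect, norm_weight_reflect]
  have := norm_weight_left_le (K := M) hK νt ν hn (τ := -τ) (τ' := -τ') (by rwa [abs_neg, abs_neg])
  rwa [abs_neg] at this

theorem norm_weight_conj (M K : ℕ) (ν νt : ℕ → ℕ) (n : ℕ) (s : ℂ) :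
    ‖weight M K ν νt n ((starRingEnd ℂ) s)‖ = ‖weight M K ν νt n s‖ := by
  rw [← Complex.norm_conj (weight M K ν νt n s)]
  congr 1
  simp only [weight, nodal, gammas, map_mul, map_prod, map_sub, map_natCast, ← Complex.Gamma_conj,
    map_add, map_one]

/-- The point `a + b i` is a saddle point of the phase function, described by the modulus and
the argument of the saddle point equation. -/
structure IsSaddle (M K : ℕ) (x0 a b : ℝ) : Prop where
  re_pos : 0 < a
  re_lt_one : a < 1
  im_pos : 0 < b
  modulus_eq : (M + 1) * Real.log ‖(a + b * Complex.I : ℂ)‖ -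
    (K + 1) * Real.log ‖1 - (a + b * Complex.I : ℂ)‖ = Real.log x0
  arg_eq : (M + 1) * Real.arctan (b / a) + (K + 1) * Real.arctan (b / (1 - a)) = Real.pi

theorem arg_eq_arctan {z : ℂ} (hz : 0 < z.re) : Complex.arg z = Real.arctan (z.im / z.re) := by
  have h := (abs_lt.mp (Complex.abs_arg_lt_pi_div_two_iff.mpr (Or.inl hz)))
  rw [← Complex.tan_arg, Real.arctan_tan h.1 h.2]

theorem hasDerivAt_lam_comp {f : ℝ → ℂ} {f' : ℂ} {t : ℝ} (hf : HasDerivAt f f' t)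
    (h : f t ∈ Complex.slitPlane) :
    HasDerivAt (fun t => lam (f t)) (f' * Complex.log (f t)).re t := by
  have h1 : HasDerivAt (fun z : ℂ => z * Complex.log z - z) (Complex.log (f t)) (f t) := by
    have := ((hasDerivAt_id (f t)).mul (Complex.hasDerivAt_log h)).sub (hasDerivAt_id (f t))
    refine this.congr_deriv ?_
    simp [mul_inv_cancel₀ (Complex.slitPlane_ne_zero h)]
  have h2 := h1.comp_of_eq t hf rfl
  have h3 := Complex.reCLM.hasFDerivAt.comp_hasDerivAt t h2
  refine h3.congr_deriv ?_
  simp [mul_comm]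

theorem hasDerivAt_phase_vertical (M K : ℕ) (x0 : ℝ) {a v : ℝ} (ha : 0 < a) (ha1 : a < 1)
    (hv : 0 < v) :
    HasDerivAt (fun v : ℝ => phase M K x0 (a + v * Complex.I))
      (Real.pi - (M + 1) * Real.arctan (v / a) - (K + 1) * Real.arctan (v / (1 - a))) v := by
  have h1 : HasDerivAt (fun v : ℝ => (a + v * Complex.I : ℂ)) Complex.I v := by
    simpa using ((Complex.ofRealCLM.hasDerivAt (x := v)).mul_const Complex.I).const_add (a : ℂ)
  have h2 : HasDerivAt (fun v : ℝ => (1 - (a + v * Complex.I) : ℂ)) (-Complex.I) v :=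
    h1.const_sub 1
  have l1 := hasDerivAt_lam_comp h1 (Or.inl (by simpa using ha))
  have l2 := hasDerivAt_lam_comp h2 (Or.inl (by simpa using ha1))
  have l3 : HasDerivAt (fun v : ℝ => Real.pi * |(a + v * Complex.I : ℂ).im| -
      (a + v * Complex.I : ℂ).re * Real.log x0) Real.pi v := by
    have : HasDerivAt (fun v : ℝ => Real.pi * v - a * Real.log x0) Real.pi v := by
      simpa using ((hasDerivAt_id v).const_mul Real.pi).sub_const (a * Real.log x0)
    refine this.congr_of_eventuallyEq ?_
    filter_upwards [lt_mem_nhds hv] with w hw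
    simp [abs_of_pos hw]
  have h := ((l1.const_mul ((M : ℝ) + 1)).add (l2.const_mul ((K : ℝ) + 1))).add l3
  refine (h.congr_deriv ?_).congr_of_eventuallyEq (Eventually.of_forall fun w => ?_)
  · have e1 := arg_eq_arctan (z := (a + v * Complex.I : ℂ)) (by simpa using ha)
    have e2 := arg_eq_arctan (z := (1 - (a + v * Complex.I) : ℂ)) (by simpa using ha1)
    simp [-neg_add_rev] at e1 e2 ⊢
    rw [Complex.log_im, Complex.log_im, e1, e2, neg_div, Real.arctan_neg]
    ring
  · simp only [phase, Pi.add_apply]; ring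

theorem phase_conj (M K : ℕ) (x0 : ℝ) (a v : ℝ) (ha : 0 < a) (ha1 : a < 1) :
    phase M K x0 (a + (-v : ℝ) * Complex.I) = phase M K x0 (a + v * Complex.I) := by
  have key : ∀ z : ℂ, 0 < z.re → lam ((starRingEnd ℂ) z) = lam z := by
    intro z hz
    have : Complex.arg z ≠ Real.pi := by
      intro h
      have := (Complex.abs_arg_lt_pi_div_two_iff.mpr (Or.inl hz))
      rw [h, abs_of_pos Real.pi_pos] at this
      linarith [Real.pi_pos]
    rw [lam, lam, Complex.log_conj _ this, ← map_mul, ← map_sub, Complex.conj_re]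
  have e1 : (a + (-v : ℝ) * Complex.I : ℂ) = (starRingEnd ℂ) (a + v * Complex.I) := by simp
  have e2 : (1 - (a + (-v : ℝ) * Complex.I : ℂ)) = (starRingEnd ℂ) (1 - (a + v * Complex.I)) := by
    simp
  rw [phase, phase, e2, e1, key _ (by simpa using ha), key _ (by simpa using ha1)]
  simp

theorem continuous_phase_vertical (M K : ℕ) (x0 : ℝ) {a : ℝ} (ha : 0 < a) (ha1 : a < 1) :
    Continuous fun v : ℝ => phase M K x0 (a + v * Complex.I) := by
  have h1 : Continuous fun v : ℝ => Complex.log (a + v * Complex.I) :=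
    Continuous.clog (by fun_prop) fun v => Or.inl (by simpa using ha)
  have h2 : Continuous fun v : ℝ => Complex.log (1 - (a + v * Complex.I)) :=
    Continuous.clog (by fun_prop) fun v => Or.inl (by simpa using ha1)
  have h3 : Continuous fun v : ℝ => (a + v * Complex.I : ℂ) := by fun_prop
  have h4 : Continuous fun v : ℝ => (1 - (a + v * Complex.I) : ℂ) := by fun_prop
  have l1 := Complex.continuous_re.comp ((h3.mul h1).sub h3)
  have l2 := Complex.continuous_re.comp ((h4.mul h2).sub h4)
  exact (((continuous_const.mul l1).add (continuous_const.mul l2)).add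
    (continuous_const.mul (Complex.continuous_im.comp h3).abs)).sub
    ((Complex.continuous_re.comp h3).mul continuous_const)

/-- Along the vertical line through the saddle point the phase is maximal exactly at the saddle
point and its conjugate, and it decays at least linearly. -/
theorem IsSaddle.vertical {M K : ℕ} {x0 a b : ℝ} (h : IsSaddle M K x0 a b) :
    (∀ v : ℝ, |v| ≠ b → phase M K x0 (a + v * Complex.I) < phase M K x0 (a + b * Complex.I)) ∧
    ∃ c C : ℝ, 0 < c ∧ ∀ v : ℝ,
      phase M K x0 (a + v * Complex.I) ≤ phase M K x0 (a + b * Complex.I) + C - c * |v| := by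
  obtain ⟨ha, ha1, hb, -, harg⟩ := h
  set q : ℝ → ℝ := fun v => phase M K x0 (a + v * Complex.I) with hq
  set d : ℝ → ℝ := fun v => Real.pi - (M + 1) * Real.arctan (v / a) -
    (K + 1) * Real.arctan (v / (1 - a)) with hd
  have hder : ∀ v, 0 < v → HasDerivAt q (d v) v := fun v hv =>
    hasDerivAt_phase_vertical M K x0 ha ha1 hv
  have hcont : Continuous q := continuous_phase_vertical M K x0 ha ha1
  have hdb : d b = 0 := by simp only [hd]; linarith
  have hanti : StrictAnti d := by
    intro v w hvw
    have h1 := Real.arctan_strictMono (div_lt_div_of_pos_right hvw ha)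
    have h2 := Real.arctan_strictMono (div_lt_div_of_pos_right hvw (sub_pos.mpr ha1))
    simp only [hd]
    have : (0 : ℝ) < M + 1 := by positivity
    have : (0 : ℝ) < K + 1 := by positivity
    nlinarith
  have habs : ∀ v, q |v| = q v := by
    intro v
    rcases abs_choice v with h | h
    · rw [h]
    · rw [h]; exact phase_conj M K x0 a v ha ha1
  have hmono : StrictMonoOn q (Icc 0 b) := by
    apply strictMonoOn_of_deriv_pos (convex_Icc _ _) hcont.continuousOn
    intro v hv
    rw [interior_Icc] at hv
    rw [(hder v hv.1).deriv, ← hdb]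
    exact hanti hv.2
  have hanti' : StrictAntiOn q (Ici b) := by
    apply strictAntiOn_of_deriv_neg (convex_Ici _) hcont.continuousOn
    intro v hv
    rw [interior_Ici] at hv
    rw [(hder v (hb.trans hv)).deriv, ← hdb]
    exact hanti hv
  have hlt : ∀ v : ℝ, |v| ≠ b → q v < q b := by
    intro v hv
    rw [← habs]
    rcases lt_or_gt_of_ne hv with h | h
    · exact hmono ⟨abs_nonneg v, h.le⟩ ⟨hb.le, le_rfl⟩ h
    · exact hanti' (le_refl b) h.le h
  refine ⟨hlt, -d (2 * b), -d (2 * b) * (2 * b), ?_, fun v => ?_⟩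
  · have := hanti (show b < 2 * b by linarith)
    linarith
  have hneg : d (2 * b) < 0 := by
    have := hanti (show b < 2 * b by linarith)
    linarith
  change q v ≤ q b + _ - _
  have hle : q v ≤ q b := by
    by_cases hv : |v| = b
    · rw [← habs, hv]
    · exact (hlt v hv).le
  rcases le_total |v| (2 * b) with hv | hv
  · nlinarith
  · have hderg : ∀ w ∈ Ioi (2 * b),
        HasDerivAt (fun w => q w - d (2 * b) * w) (d w - d (2 * b)) w := by
      intro w hw
      have hw' : 2 * b < w := hw
      have h := (hder w (by linarith)).sub ((hasDerivAt_id w).const_mul (d (2 * b)))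
      rwa [mul_one] at h
    have hg : AntitoneOn (fun w => q w - d (2 * b) * w) (Ici (2 * b)) := by
      apply antitoneOn_of_deriv_nonpos (convex_Ici _)
      · exact (hcont.sub (continuous_const.mul continuous_id)).continuousOn
      · intro w hw
        rw [interior_Ici] at hw
        exact (hderg w hw).differentiableAt.differentiableWithinAt
      · intro w hw
        rw [interior_Ici] at hw
        rw [(hderg w hw).deriv]
        have := hanti hw
        linarith
    have h1 := hg (self_mem_Ici) hv hv
    have h2 := hlt (2 * b) (by rw [abs_of_pos (by linarith)]; linarith)
    simp only at h1
    rw [habs] at h1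
    linarith

theorem hasDerivAt_phase_horizontal (M K : ℕ) (x0 : ℝ) {b u : ℝ} (hb : 0 < b) :
    HasDerivAt (fun u : ℝ => phase M K x0 (u + b * Complex.I))
      ((M + 1) * Real.log ‖(u + b * Complex.I : ℂ)‖ -
        (K + 1) * Real.log ‖1 - (u + b * Complex.I : ℂ)‖ - Real.log x0) u := by
  have h1 : HasDerivAt (fun u : ℝ => (u + b * Complex.I : ℂ)) 1 u := by
    simpa using (Complex.ofRealCLM.hasDerivAt (x := u)).add_const (b * Complex.I)
  have h2 : HasDerivAt (fun u : ℝ => (1 - (u + b * Complex.I) : ℂ)) (-1) u :=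
    h1.const_sub 1
  have l1 := hasDerivAt_lam_comp h1 (Or.inr (by simpa using hb.ne'))
  have l2 := hasDerivAt_lam_comp h2 (Or.inr (by simpa using hb.ne'))
  have l3 : HasDerivAt (fun u : ℝ => Real.pi * |(u + b * Complex.I : ℂ).im| -
      (u + b * Complex.I : ℂ).re * Real.log x0) (-Real.log x0) u := by
    have : HasDerivAt (fun u : ℝ => Real.pi * |b| - u * Real.log x0) (-Real.log x0) u := by
      simpa using ((hasDerivAt_id u).mul_const (Real.log x0)).const_sub (Real.pi * |b|)
    refine this.congr_of_eventuallyEq (Eventually.of_forall fun w => ?_)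
    simp
  have h := ((l1.const_mul ((M : ℝ) + 1)).add (l2.const_mul ((K : ℝ) + 1))).add l3
  refine (h.congr_deriv ?_).congr_of_eventuallyEq (Eventually.of_forall fun w => ?_)
  · rw [one_mul, neg_one_mul, Complex.neg_re, Complex.log_re, Complex.log_re]; ring
  · simp only [phase, Pi.add_apply]; ring

theorem log_norm_lt_log_norm {u w b : ℝ} (hb : 0 < b) (h : |u| < |w|) :
    Real.log ‖(u + b * Complex.I : ℂ)‖ < Real.log ‖(w + b * Complex.I : ℂ)‖ := by
  apply Real.log_lt_log
  · rw [norm_pos_iff]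
    intro h0
    have := congrArg Complex.im h0
    simp at this
    exact hb.ne' this
  · rw [Complex.norm_add_mul_I, Complex.norm_add_mul_I]
    apply Real.sqrt_lt_sqrt (by positivity)
    have := sq_lt_sq.mpr h
    linarith

theorem log_norm_one_sub (u b : ℝ) : Real.log ‖1 - (u + b * Complex.I : ℂ)‖ =
    Real.log ‖((1 - u : ℝ) + b * Complex.I : ℂ)‖ := by
  have : (1 - (u + b * Complex.I : ℂ)) = (starRingEnd ℂ) ((1 - u : ℝ) + b * Complex.I : ℂ) := by
    simp; ring
  rw [this, Complex.norm_conj]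

/-- Along the horizontal line through the saddle point the phase is minimal at the saddle point. -/
theorem IsSaddle.horizontal {M K : ℕ} {x0 a b : ℝ} (h : IsSaddle M K x0 a b) :
    (∀ u : ℝ, -a ≤ u → u ≤ 1 →
      phase M K x0 (a + b * Complex.I) ≤ phase M K x0 (u + b * Complex.I)) ∧
    ∃ ε : ℝ, 0 < ε ∧ ∀ u : ℝ, -a ≤ u → u ≤ 1 → (u ≤ 0 ∨ (1 + a) / 2 ≤ u) →
      phase M K x0 (a + b * Complex.I) + ε ≤ phase M K x0 (u + b * Complex.I) := by
  obtain ⟨ha, ha1, hb, hmod, -⟩ := h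
  set p : ℝ → ℝ := fun u => phase M K x0 (u + b * Complex.I) with hp
  have hder := fun u : ℝ => hasDerivAt_phase_horizontal M K x0 (b := b) (u := u) hb
  have hcont : Continuous p := continuous_iff_continuousAt.mpr fun u => (hder u).continuousAt
  have hM : (0 : ℝ) < M + 1 := by positivity
  have hK : (0 : ℝ) < K + 1 := by positivity
  have hanti : StrictAntiOn p (Icc (-a) a) := by
    apply strictAntiOn_of_deriv_neg (convex_Icc _ _) hcont.continuousOn
    intro u hu
    rw [interior_Icc] at hu
    rw [(hder u).deriv, ← hmod, log_norm_one_sub, log_norm_one_sub]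
    have h1 := log_norm_lt_log_norm (u := u) (w := a) hb
      (by rw [abs_of_pos ha, abs_lt]; exact hu)
    have h2 := log_norm_lt_log_norm (u := 1 - a) (w := 1 - u) hb
      (by rw [abs_of_pos (by linarith), abs_of_pos (by linarith [hu.2])]; linarith [hu.2])
    nlinarith
  have hmono : StrictMonoOn p (Icc a 1) := by
    apply strictMonoOn_of_deriv_pos (convex_Icc _ _) hcont.continuousOn
    intro u hu
    rw [interior_Icc] at hu
    rw [(hder u).deriv, ← hmod, log_norm_one_sub, log_norm_one_sub]
    have h1 := log_norm_lt_log_norm (u := a) (w := u) hb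
      (by rw [abs_of_pos ha, abs_of_pos (ha.trans hu.1)]; exact hu.1)
    have h2 := log_norm_lt_log_norm (u := 1 - u) (w := 1 - a) hb
      (by rw [abs_of_pos (by linarith [hu.2]), abs_of_pos (by linarith)]; linarith [hu.1])
    nlinarith
  have ma : a ∈ Icc (-a) a := ⟨by linarith, le_rfl⟩
  have ma' : a ∈ Icc a 1 := ⟨le_rfl, ha1.le⟩
  have m0 : (0 : ℝ) ∈ Icc (-a) a := ⟨by linarith, ha.le⟩
  have m1 : (1 + a) / 2 ∈ Icc a 1 := ⟨by linarith, by linarith⟩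
  refine ⟨fun u h1 h2 => ?_, min (p 0 - p a) (p ((1 + a) / 2) - p a), ?_, fun u h1 h2 h3 => ?_⟩
  · change p a ≤ p u
    rcases le_total u a with h | h
    · exact hanti.antitoneOn ⟨h1, h⟩ ma h
    · exact hmono.monotoneOn ma' ⟨h, h2⟩ h
  · have h1 := hanti m0 ma ha
    have h2 := hmono ma' m1 (by linarith)
    exact lt_min (by linarith) (by linarith)
  · change p a + _ ≤ p u
    rcases h3 with h3 | h3
    · have := hanti.antitoneOn ⟨h1, h3.trans ha.le⟩ m0 h3
      have := min_le_left (p 0 - p a) (p ((1 + a) / 2) - p a)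
      linarith
    · have := hmono.monotoneOn m1 ⟨by linarith, h2⟩ h3
      have := min_le_right (p 0 - p a) (p ((1 + a) / 2) - p a)
      linarith

theorem exists_isSaddle {M K : ℕ} (hM : 1 ≤ M) (hK : 1 ≤ K) {x0 : ℝ} (hx0 : 0 < x0) {φ : ℝ}
    (hφ : φ ∈ Set.Ioo (0 : ℝ) (Real.pi / ((M : ℝ) + 1)))
    (hpar : x0 =
      Real.sin (((M : ℝ) + 1) * φ / ((K : ℝ) + 1) + (K : ℝ) * Real.pi / ((K : ℝ) + 1)) ^ (M + 1) /
        (Real.sin φ ^ (K + 1) *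
          Real.sin (((M : ℝ) - (K : ℝ)) * φ / ((K : ℝ) + 1) +
            (K : ℝ) * Real.pi / ((K : ℝ) + 1)) ^ ((M : ℤ) - (K : ℤ)))) :
    ∃ a b : ℝ, IsSaddle M K x0 a b ∧ b = Real.pi * ρMK M K x0 φ * x0 ∧
      a = b * (Real.cos φ / Real.sin φ) := by
  have hMR : (1 : ℝ) ≤ M := by exact_mod_cast hM
  have hKR : (1 : ℝ) ≤ K := by exact_mod_cast hK
  have hK1 : (0 : ℝ) < K + 1 := by linarith
  have hM1 : (0 : ℝ) < M + 1 := by linarith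
  obtain ⟨hφ0, hφ1⟩ := hφ
  rw [lt_div_iff₀ hM1] at hφ1
  set ψ : ℝ := (Real.pi - (M + 1) * φ) / (K + 1) with hψ
  have hψeq : (M + 1) * φ + (K + 1) * ψ = Real.pi := by rw [hψ]; field_simp; ring
  have hψ0 : 0 < ψ := by rw [hψ]; apply div_pos _ hK1; linarith
  have hφ2 : φ < Real.pi / 2 := by nlinarith
  have hψ2 : ψ < Real.pi / 2 := by nlinarith
  have e1 : ((M : ℝ) + 1) * φ / ((K : ℝ) + 1) + (K : ℝ) * Real.pi / ((K : ℝ) + 1) =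
      Real.pi - ψ := by rw [hψ]; field_simp; ring
  have e2 : ((M : ℝ) - (K : ℝ)) * φ / ((K : ℝ) + 1) + (K : ℝ) * Real.pi / ((K : ℝ) + 1) =
      Real.pi - (φ + ψ) := by rw [hψ]; field_simp; ring
  rw [e1, e2, Real.sin_pi_sub, Real.sin_pi_sub] at hpar
  have sφ : 0 < Real.sin φ := Real.sin_pos_of_pos_of_lt_pi hφ0 (by linarith)
  have sψ : 0 < Real.sin ψ := Real.sin_pos_of_pos_of_lt_pi hψ0 (by linarith)
  have sφψ : 0 < Real.sin (φ + ψ) := Real.sin_pos_of_pos_of_lt_pi (by linarith) (by linarith)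
  have cφ : 0 < Real.cos φ := Real.cos_pos_of_mem_Ioo ⟨by linarith, hφ2⟩
  have cψ : 0 < Real.cos ψ := Real.cos_pos_of_mem_Ioo ⟨by linarith, hψ2⟩
  set r : ℝ := Real.sin ψ / Real.sin (φ + ψ) with hr
  set r' : ℝ := Real.sin φ / Real.sin (φ + ψ) with hr'
  have hr0 : 0 < r := by positivity
  have hr0' : 0 < r' := by positivity
  have hb : r * Real.sin φ = r' * Real.sin ψ := by rw [hr, hr']; ring
  have ha1 : 1 - r * Real.cos φ = r' * Real.cos ψ := by
    rw [hr, hr']; field_simp; rw [Real.sin_add]; ring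
  have n1 : ‖((r * Real.cos φ : ℝ) + (r * Real.sin φ : ℝ) * Complex.I : ℂ)‖ = r := by
    rw [Complex.norm_add_mul_I, show (r * Real.cos φ) ^ 2 + (r * Real.sin φ) ^ 2 = r ^ 2 by
      linear_combination r ^ 2 * Real.cos_sq_add_sin_sq φ, Real.sqrt_sq hr0.le]
  have n2 : ‖1 - ((r * Real.cos φ : ℝ) + (r * Real.sin φ : ℝ) * Complex.I : ℂ)‖ = r' := by
    have : (1 - ((r * Real.cos φ : ℝ) + (r * Real.sin φ : ℝ) * Complex.I : ℂ)) =
        ((r' * Real.cos ψ : ℝ) + (-(r' * Real.sin ψ) : ℝ) * Complex.I : ℂ) := by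
      rw [← ha1, ← hb]; push_cast; ring
    rw [this, Complex.norm_add_mul_I,
      show (r' * Real.cos ψ) ^ 2 + (-(r' * Real.sin ψ)) ^ 2 = r' ^ 2 by
      linear_combination r' ^ 2 * Real.cos_sq_add_sin_sq ψ, Real.sqrt_sq hr0'.le]
  refine ⟨r * Real.cos φ, r * Real.sin φ, ⟨by positivity, ?_, by positivity, ?_, ?_⟩, ?_, ?_⟩
  · have : 0 < r' * Real.cos ψ := by positivity
    linarith
  · rw [n1, n2]
    have hx : x0 = r ^ (M + 1) / r' ^ (K + 1) := by
      rw [hpar, hr, hr', zpow_sub₀ sφψ.ne', zpow_natCast, zpow_natCast,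
        div_pow, div_pow]
      field_simp
      ring
    rw [hx, Real.log_div (x := r ^ (M + 1)) (by positivity) (by positivity), Real.log_pow,
      Real.log_pow]
    push_cast
    ring
  · have t1 : r * Real.sin φ / (r * Real.cos φ) = Real.tan φ := by
      rw [Real.tan_eq_sin_div_cos]; field_simp
    have t2 : r * Real.sin φ / (1 - r * Real.cos φ) = Real.tan ψ := by
      rw [ha1, hb, Real.tan_eq_sin_div_cos]; field_simp
    rw [t1, t2, Real.arctan_tan (by linarith) hφ2, Real.arctan_tan (by linarith) hψ2, hψeq]
  · rw [ρMK, e1, e2, Real.sin_pi_sub, Real.sin_pi_sub, hr]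
    field_simp
  · field_simp

/-- The boundary of the rectangle `[a₁, a₂] × [b₁, b₂]`. -/
def rectBoundary (a₁ a₂ b₁ b₂ : ℝ) : Set ℂ :=
  {t | (t.re ∈ Icc a₁ a₂ ∧ (t.im = b₁ ∨ t.im = b₂)) ∨ (t.im ∈ Icc b₁ b₂ ∧ (t.re = a₁ ∨ t.re = a₂))}

/-- The counterclockwise contour integral over the boundary of a rectangle. -/
noncomputable def rectIntegral (f : ℂ → ℂ) (a₁ a₂ b₁ b₂ : ℝ) : ℂ :=
  (∫ x in a₁..a₂, f (x + b₁ * Complex.I)) - (∫ x in a₁..a₂, f (x + b₂ * Complex.I)) +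
    Complex.I * (∫ y in b₁..b₂, f (a₂ + y * Complex.I)) -
    Complex.I * ∫ y in b₁..b₂, f (a₁ + y * Complex.I)

section rect

variable {a₁ a₂ b₁ b₂ : ℝ}

theorem bottom_mem (h : b₁ ≤ b₂) {x : ℝ} (hx : x ∈ Icc a₁ a₂) :
    (x + b₁ * Complex.I : ℂ) ∈ rectBoundary a₁ a₂ b₁ b₂ := by simp_all [rectBoundary]

theorem top_mem (h : b₁ ≤ b₂) {x : ℝ} (hx : x ∈ Icc a₁ a₂) :
    (x + b₂ * Complex.I : ℂ) ∈ rectBoundary a₁ a₂ b₁ b₂ := by simp_all [rectBoundary]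

theorem right_mem (h : a₁ ≤ a₂) {y : ℝ} (hy : y ∈ Icc b₁ b₂) :
    (a₂ + y * Complex.I : ℂ) ∈ rectBoundary a₁ a₂ b₁ b₂ := by simp_all [rectBoundary]

theorem left_mem (h : a₁ ≤ a₂) {y : ℝ} (hy : y ∈ Icc b₁ b₂) :
    (a₁ + y * Complex.I : ℂ) ∈ rectBoundary a₁ a₂ b₁ b₂ := by simp_all [rectBoundary]

theorem rectIntegral_congr (ha : a₁ ≤ a₂) (hb : b₁ ≤ b₂) {f g : ℂ → ℂ}
    (h : EqOn f g (rectBoundary a₁ a₂ b₁ b₂)) :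
    rectIntegral f a₁ a₂ b₁ b₂ = rectIntegral g a₁ a₂ b₁ b₂ := by
  rw [rectIntegral, rectIntegral]
  rw [intervalIntegral.integral_congr (g := fun x : ℝ => g (x + b₁ * Complex.I))
      fun x hx => h (bottom_mem hb (by rwa [uIcc_of_le ha] at hx)),
    intervalIntegral.integral_congr (g := fun x : ℝ => g (x + b₂ * Complex.I))
      fun x hx => h (top_mem hb (by rwa [uIcc_of_le ha] at hx)),
    intervalIntegral.integral_congr (g := fun y : ℝ => g (a₂ + y * Complex.I))
      fun x hx => h (right_mem ha (by rwa [uIcc_of_le hb] at hx)),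
    intervalIntegral.integral_congr (g := fun y : ℝ => g (a₁ + y * Complex.I))
      fun x hx => h (left_mem ha (by rwa [uIcc_of_le hb] at hx))]

theorem intervalIntegrable_of_rectBoundary (ha : a₁ ≤ a₂) (hb : b₁ ≤ b₂) {f : ℂ → ℂ}
    (h : ContinuousOn f (rectBoundary a₁ a₂ b₁ b₂)) :
    IntervalIntegrable (fun x : ℝ => f (x + b₁ * Complex.I)) volume a₁ a₂ ∧
    IntervalIntegrable (fun x : ℝ => f (x + b₂ * Complex.I)) volume a₁ a₂ ∧
    IntervalIntegrable (fun y : ℝ => f (a₂ + y * Complex.I)) volume b₁ b₂ ∧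
    IntervalIntegrable (fun y : ℝ => f (a₁ + y * Complex.I)) volume b₁ b₂ := by
  refine ⟨?_, ?_, ?_, ?_⟩ <;> apply ContinuousOn.intervalIntegrable
  · rw [uIcc_of_le ha]
    exact h.comp (f := fun x : ℝ => (x + b₁ * Complex.I : ℂ)) (by fun_prop)
      fun x hx => bottom_mem hb hx
  · rw [uIcc_of_le ha]
    exact h.comp (f := fun x : ℝ => (x + b₂ * Complex.I : ℂ)) (by fun_prop)
      fun x hx => top_mem hb hx
  · rw [uIcc_of_le hb]
    exact h.comp (f := fun y : ℝ => (a₂ + y * Complex.I : ℂ)) (by fun_prop)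
      fun x hx => right_mem ha hx
  · rw [uIcc_of_le hb]
    exact h.comp (f := fun y : ℝ => (a₁ + y * Complex.I : ℂ)) (by fun_prop)
      fun x hx => left_mem ha hx

theorem rectIntegral_const_mul (c : ℂ) (f : ℂ → ℂ) :
    rectIntegral (fun t => c * f t) a₁ a₂ b₁ b₂ = c * rectIntegral f a₁ a₂ b₁ b₂ := by
  simp only [rectIntegral, intervalIntegral.integral_const_mul]; ring

theorem rectIntegral_sub (ha : a₁ ≤ a₂) (hb : b₁ ≤ b₂) {f g : ℂ → ℂ}
    (hf : ContinuousOn f (rectBoundary a₁ a₂ b₁ b₂))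
    (hg : ContinuousOn g (rectBoundary a₁ a₂ b₁ b₂)) :
    rectIntegral (fun t => f t - g t) a₁ a₂ b₁ b₂ =
      rectIntegral f a₁ a₂ b₁ b₂ - rectIntegral g a₁ a₂ b₁ b₂ := by
  obtain ⟨f1, f2, f3, f4⟩ := intervalIntegrable_of_rectBoundary ha hb hf
  obtain ⟨g1, g2, g3, g4⟩ := intervalIntegrable_of_rectBoundary ha hb hg
  unfold rectIntegral
  rw [intervalIntegral.integral_sub f1 g1, intervalIntegral.integral_sub f2 g2,
    intervalIntegral.integral_sub f3 g3, intervalIntegral.integral_sub f4 g4]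
  ring

theorem rectIntegral_sum (ha : a₁ ≤ a₂) (hb : b₁ ≤ b₂) {ι : Type*} (s : Finset ι) {f : ι → ℂ → ℂ}
    (hf : ∀ i ∈ s, ContinuousOn (f i) (rectBoundary a₁ a₂ b₁ b₂)) :
    rectIntegral (fun t => ∑ i ∈ s, f i t) a₁ a₂ b₁ b₂ =
      ∑ i ∈ s, rectIntegral (f i) a₁ a₂ b₁ b₂ := by
  have h := fun i hi => intervalIntegrable_of_rectBoundary ha hb (hf i hi)
  unfold rectIntegral
  rw [intervalIntegral.integral_finsetSum fun i hi => (h i hi).1,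
    intervalIntegral.integral_finsetSum fun i hi => (h i hi).2.1,
    intervalIntegral.integral_finsetSum fun i hi => (h i hi).2.2.1,
    intervalIntegral.integral_finsetSum fun i hi => (h i hi).2.2.2]
  simp only [Finset.mul_sum, Finset.sum_sub_distrib, Finset.sum_add_distrib]

theorem rectIntegral_eq_zero (ha : a₁ ≤ a₂) (hb : b₁ ≤ b₂) {f : ℂ → ℂ}
    (hf : DifferentiableOn ℂ f (Icc a₁ a₂ ×ℂ Icc b₁ b₂)) :
    rectIntegral f a₁ a₂ b₁ b₂ = 0 := by
  have := Complex.integral_boundary_rect_eq_zero_of_differentiableOn f ⟨a₁, b₁⟩ ⟨a₂, b₂⟩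
    (by simpa only [uIcc_of_le ha, uIcc_of_le hb] using hf)
  simpa [rectIntegral] using this

theorem log_neg_of_im_pos {z : ℂ} (h : 0 < z.im) :
    Complex.log (-z) = Complex.log z - Real.pi * Complex.I := by
  rw [Complex.log, Complex.log, norm_neg, Complex.arg_neg_eq_arg_sub_pi_of_im_pos h]
  push_cast; ring

theorem log_neg_of_im_neg {z : ℂ} (h : z.im < 0) :
    Complex.log (-z) = Complex.log z + Real.pi * Complex.I := by
  rw [Complex.log, Complex.log, norm_neg, Complex.arg_neg_eq_arg_add_pi_of_im_neg h]
  push_cast; ring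

theorem rectIntegral_sub_inv {w : ℂ} (h1 : a₁ < w.re) (h2 : w.re < a₂) (h3 : b₁ < w.im)
    (h4 : w.im < b₂) :
    rectIntegral (fun t => (t - w)⁻¹) a₁ a₂ b₁ b₂ = 2 * Real.pi * Complex.I := by
  have ha : a₁ ≤ a₂ := (h1.trans h2).le
  have hb : b₁ ≤ b₂ := (h3.trans h4).le
  have hcont : ContinuousOn (fun t : ℂ => (t - w)⁻¹) (rectBoundary a₁ a₂ b₁ b₂) := by
    refine ContinuousOn.inv₀ (by fun_prop) fun t ht h => ?_
    rw [sub_eq_zero] at h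
    subst h
    rcases ht with ⟨-, h | h⟩ | ⟨-, h | h⟩ <;> linarith
  obtain ⟨f1, f2, f3, f4⟩ := intervalIntegrable_of_rectBoundary ha hb hcont
  have hx : ∀ b x : ℝ, HasDerivAt (fun x : ℝ => (x + b * Complex.I - w : ℂ)) 1 x := fun b x => by
    simpa using ((Complex.ofRealCLM.hasDerivAt (x := x)).add_const (b * Complex.I)).sub_const w
  have hy : ∀ a y : ℝ, HasDerivAt (fun y : ℝ => (a + y * Complex.I - w : ℂ)) Complex.I y :=
    fun a y => by
      simpa using (((Complex.ofRealCLM.hasDerivAt (x := y)).mul_const Complex.I).const_add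
        (a : ℂ)).sub_const w
  have e1 : (∫ x in a₁..a₂, (x + b₁ * Complex.I - w : ℂ)⁻¹) =
      Complex.log (a₂ + b₁ * Complex.I - w) - Complex.log (a₁ + b₁ * Complex.I - w) := by
    refine intervalIntegral.integral_eq_sub_of_hasDerivAt
      (f := fun x : ℝ => Complex.log (x + b₁ * Complex.I - w)) (fun x _ => ?_) f1
    simpa using (hx b₁ x).clog_real (Or.inr (by simp; linarith))
  have e2 : (∫ x in a₁..a₂, (x + b₂ * Complex.I - w : ℂ)⁻¹) =
      Complex.log (a₂ + b₂ * Complex.I - w) - Complex.log (a₁ + b₂ * Complex.I - w) := by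
    refine intervalIntegral.integral_eq_sub_of_hasDerivAt
      (f := fun x : ℝ => Complex.log (x + b₂ * Complex.I - w)) (fun x _ => ?_) f2
    simpa using (hx b₂ x).clog_real (Or.inr (by simp; linarith))
  have e3 : (∫ y in b₁..b₂, Complex.I * (a₂ + y * Complex.I - w : ℂ)⁻¹) =
      Complex.log (a₂ + b₂ * Complex.I - w) - Complex.log (a₂ + b₁ * Complex.I - w) := by
    refine intervalIntegral.integral_eq_sub_of_hasDerivAt
      (f := fun y : ℝ => Complex.log (a₂ + y * Complex.I - w)) (fun y _ => ?_) (f3.const_mul _)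
    simpa [div_eq_mul_inv] using (hy a₂ y).clog_real (Or.inl (by simp; linarith))
  have e4 : (∫ y in b₁..b₂, Complex.I * (a₁ + y * Complex.I - w : ℂ)⁻¹) =
      Complex.log (-(a₁ + b₂ * Complex.I - w)) - Complex.log (-(a₁ + b₁ * Complex.I - w)) := by
    refine intervalIntegral.integral_eq_sub_of_hasDerivAt
      (f := fun y : ℝ => Complex.log (-(a₁ + y * Complex.I - w))) (fun y _ => ?_) (f4.const_mul _)
    have := (hy a₁ y).fun_neg.clog_real (Or.inl (by simp; linarith))
    rwa [neg_div_neg_eq, div_eq_mul_inv] at this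
  rw [intervalIntegral.integral_const_mul] at e3 e4
  rw [rectIntegral, e1, e2, e3, e4, log_neg_of_im_pos (by simp; linarith),
    log_neg_of_im_neg (by simp; linarith)]
  ring

/-- Cauchy's integral formula for a rectangle. -/
theorem rectIntegral_div_sub {w : ℂ} (h1 : a₁ < w.re) (h2 : w.re < a₂) (h3 : b₁ < w.im)
    (h4 : w.im < b₂) {F : ℂ → ℂ} (hF : Differentiable ℂ F) :
    rectIntegral (fun t => F t / (t - w)) a₁ a₂ b₁ b₂ = 2 * Real.pi * Complex.I * F w := by
  have ha : a₁ ≤ a₂ := (h1.trans h2).le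
  have hb : b₁ ≤ b₂ := (h3.trans h4).le
  have hw : ∀ t ∈ rectBoundary a₁ a₂ b₁ b₂, t - w ≠ 0 := by
    intro t ht h
    rw [sub_eq_zero] at h
    subst h
    rcases ht with ⟨-, h | h⟩ | ⟨-, h | h⟩ <;> linarith
  have hD : Differentiable ℂ (dslope F w) := by
    rw [← differentiableOn_univ, Complex.differentiableOn_dslope Filter.univ_mem]
    exact hF.differentiableOn
  have e : EqOn (fun t => F t / (t - w)) (fun t => F t / (t - w) - F w * (t - w)⁻¹ +
      F w * (t - w)⁻¹) (rectBoundary a₁ a₂ b₁ b₂) := fun t _ => by simp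
  have e2 : EqOn (fun t => dslope F w t) (fun t => F t / (t - w) - F w * (t - w)⁻¹)
      (rectBoundary a₁ a₂ b₁ b₂) := by
    intro t ht
    have := hw t ht
    simp only
    rw [dslope_of_ne F (sub_ne_zero.mp this), slope_def_field]
    field_simp
  have h := rectIntegral_eq_zero ha hb (hD.differentiableOn (s := Icc a₁ a₂ ×ℂ Icc b₁ b₂))
  rw [rectIntegral_congr ha hb e2, rectIntegral_sub ha hb, rectIntegral_const_mul,
    rectIntegral_sub_inv h1 h2 h3 h4] at h
  · linear_combination h
  · exact hF.continuous.continuousOn.div (by fun_prop) hw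
  · exact continuousOn_const.mul (ContinuousOn.inv₀ (by fun_prop) hw)

end rect

theorem nodal_eq_eval (n : ℕ) (s : ℂ) :
    nodal n s = (Lagrange.nodal (Finset.range n) (fun i : ℕ => (i : ℂ))).eval s := by
  rw [Lagrange.eval_nodal, nodal]

theorem nodal_ne_zero {n : ℕ} {s : ℂ} (hs : ∀ i : ℕ, i < n → s ≠ i) : nodal n s ≠ 0 :=
  Finset.prod_ne_zero_iff.mpr fun i hi => sub_ne_zero.mpr (hs i (Finset.mem_range.mp hi))

/-- The residue of `1 / nodal n` at the node `i`. -/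
noncomputable def nodeWeight (n i : ℕ) : ℂ :=
  Lagrange.nodalWeight (Finset.range n) (fun i : ℕ => (i : ℂ)) i

/-- The polynomial interpolating `F` at the nodes. -/
noncomputable def interp (n : ℕ) (F : ℂ → ℂ) : Polynomial ℂ :=
  Lagrange.interpolate (Finset.range n) (fun i : ℕ => (i : ℂ)) fun i => F i

theorem eval_interp {n : ℕ} (F : ℂ → ℂ) {s : ℂ} (hs : ∀ i : ℕ, i < n → s ≠ i) :
    (interp n F).eval s = nodal n s * ∑ i ∈ Finset.range n, nodeWeight n i * F i / (s - i) := by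
  rw [interp, Lagrange.eval_interpolate_not_at_node _ fun i hi => hs i (Finset.mem_range.mp hi),
    nodal_eq_eval]
  congr 1
  refine Finset.sum_congr rfl fun i _ => ?_
  rw [nodeWeight]; ring

theorem inv_nodal {n : ℕ} (hn : 0 < n) {s : ℂ} (hs : ∀ i : ℕ, i < n → s ≠ i) :
    (nodal n s)⁻¹ = ∑ i ∈ Finset.range n, nodeWeight n i / (s - i) := by
  have h := Lagrange.eval_interpolate_not_at_node (s := Finset.range n) (v := fun i : ℕ => (i : ℂ))
    (x := s) 1 fun i hi => hs i (Finset.mem_range.mp hi)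
  rw [Lagrange.interpolate_one (fun i _ j _ h => by exact_mod_cast h)
    (Finset.nonempty_range_iff.mpr hn.ne'), Polynomial.eval_one, ← nodal_eq_eval] at h
  refine inv_eq_of_mul_eq_one_right (h ▸ ?_)
  congr 1
  refine Finset.sum_congr rfl fun i _ => ?_
  rw [nodeWeight, Pi.one_apply]; ring

theorem circleIntegral_div_nodal {n : ℕ} (hn : 0 < n) {F : ℂ → ℂ} (hF : Differentiable ℂ F)
    {c : ℂ} {R : ℝ} (hR : 0 ≤ R) (hin : ∀ i : ℕ, i < n → (i : ℂ) ∈ Metric.ball c R) {s : ℂ}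
    (hs : s ∉ Metric.closedBall c R) :
    (∮ t in C(c, R), F t / (nodal n t * (s - t))) =
      2 * Real.pi * Complex.I * ∑ i ∈ Finset.range n, nodeWeight n i * F i / (s - i) := by
  have hne : ∀ t ∈ Metric.closedBall c R, s - t ≠ 0 := by
    intro t ht h
    rw [sub_eq_zero] at h
    exact hs (h ▸ ht)
  have hnode : ∀ t ∈ Metric.sphere c R, ∀ i : ℕ, i < n → t ≠ i := by
    rintro t ht i hi rfl
    have h1 := hin i hi
    rw [Metric.mem_ball] at h1
    rw [Metric.mem_sphere] at ht
    linarith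
  have e : EqOn (fun t => F t / (nodal n t * (s - t)))
      (fun t => ∑ i ∈ Finset.range n, nodeWeight n i * ((t - i)⁻¹ • (F t / (s - t))))
      (Metric.sphere c R) := by
    intro t ht
    simp only
    rw [div_mul_eq_div_div_swap, div_eq_mul_inv, inv_nodal hn (hnode t ht), Finset.mul_sum]
    refine Finset.sum_congr rfl fun i _ => ?_
    rw [smul_eq_mul]; ring
  have hG : DifferentiableOn ℂ (fun t => F t / (s - t)) (Metric.closedBall c R) :=
    hF.differentiableOn.div (by fun_prop) hne
  rw [circleIntegral.integral_congr hR e, circleIntegral.integral_fun_sum, Finset.mul_sum]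
  · refine Finset.sum_congr rfl fun i hi => ?_
    rw [circleIntegral.integral_const_mul,
      hG.circleIntegral_sub_inv_smul (hin i (Finset.mem_range.mp hi)), smul_eq_mul]
    ring
  · intro i hi
    apply ContinuousOn.circleIntegrable hR
    refine continuousOn_const.mul (ContinuousOn.fun_smul ?_
      (hG.continuousOn.mono Metric.sphere_subset_closedBall))
    exact ContinuousOn.inv₀ (by fun_prop) fun t ht =>
      sub_ne_zero.mpr (hnode t ht i (Finset.mem_range.mp hi))

theorem rectIntegral_div_nodal {n : ℕ} (hn : 0 < n) {F : ℂ → ℂ} (hF : Differentiable ℂ F)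
    {a₁ a₂ b₁ b₂ : ℝ} (ha₁ : a₁ < 0) (ha₂ : (n : ℝ) - 1 < a₂) (hb₁ : b₁ < 0) (hb₂ : 0 < b₂) {s : ℂ}
    (hsn : ∀ i : ℕ, i < n → s ≠ i) (h1 : a₁ < s.re) (h2 : s.re < a₂)
    (hsb : s.im ≠ b₁) (hsb' : s.im ≠ b₂) :
    rectIntegral (fun t => F t / (nodal n t * (t - s))) a₁ a₂ b₁ b₂ =
      2 * Real.pi * Complex.I * ((if s.im ∈ Ioo b₁ b₂ then F s / nodal n s else 0) -
        ∑ i ∈ Finset.range n, nodeWeight n i * F i / (s - i)) := by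
  have ha : a₁ ≤ a₂ := (h1.trans h2).le
  have hb : b₁ ≤ b₂ := (hb₁.trans hb₂).le
  have hir : ∀ i : ℕ, i < n → (i : ℝ) < a₂ := by
    intro i hi
    have : (i : ℝ) + 1 ≤ n := by exact_mod_cast hi
    linarith
  have hnode : ∀ t ∈ rectBoundary a₁ a₂ b₁ b₂, ∀ i : ℕ, i < n → t ≠ i := by
    rintro t ht i hi rfl
    have := hir i hi
    have h0 : (0 : ℝ) ≤ i := Nat.cast_nonneg i
    rcases ht with ⟨-, h | h⟩ | ⟨-, h | h⟩ <;> simp at h <;> linarith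
  have hs : ∀ t ∈ rectBoundary a₁ a₂ b₁ b₂, t - s ≠ 0 := by
    intro t ht h
    rw [sub_eq_zero] at h
    subst h
    rcases ht with ⟨-, h | h⟩ | ⟨-, h | h⟩
    · exact hsb h
    · exact hsb' h
    · linarith
    · linarith
  have e : EqOn (fun t => F t / (nodal n t * (t - s)))
      (fun t => ∑ i ∈ Finset.range n, nodeWeight n i / (s - i) * (F t / (t - s) - F t / (t - i)))
      (rectBoundary a₁ a₂ b₁ b₂) := by
    intro t ht
    simp only
    rw [div_mul_eq_div_div_swap, div_eq_mul_inv, inv_nodal hn (hnode t ht), Finset.mul_sum]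
    refine Finset.sum_congr rfl fun i hi => ?_
    have g1 := sub_ne_zero.mpr (hnode t ht i (Finset.mem_range.mp hi))
    have g2 := sub_ne_zero.mpr (hsn i (Finset.mem_range.mp hi))
    have g3 := hs t ht
    field_simp
    ring
  have c1 : ContinuousOn (fun t => F t / (t - s)) (rectBoundary a₁ a₂ b₁ b₂) :=
    hF.continuous.continuousOn.div (by fun_prop) hs
  have c2 : ∀ i < n, ContinuousOn (fun t => F t / (t - i)) (rectBoundary a₁ a₂ b₁ b₂) :=
    fun i hi => hF.continuous.continuousOn.div (by fun_prop)
      fun t ht => sub_ne_zero.mpr (hnode t ht i hi)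
  have hS : rectIntegral (fun t => F t / (t - s)) a₁ a₂ b₁ b₂ =
      2 * Real.pi * Complex.I * if s.im ∈ Ioo b₁ b₂ then F s else 0 := by
    split_ifs with h
    · exact rectIntegral_div_sub h1 h2 h.1 h.2 hF
    · rw [mul_zero]
      refine rectIntegral_eq_zero ha hb (hF.differentiableOn.div (by fun_prop) fun t ht h0 => h ?_)
      rw [sub_eq_zero] at h0
      subst h0
      exact ⟨lt_of_le_of_ne ht.2.1 hsb.symm, lt_of_le_of_ne ht.2.2 hsb'⟩
  rw [rectIntegral_congr ha hb e, rectIntegral_sum ha hb]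
  · have : ∀ i ∈ Finset.range n, rectIntegral (fun t => nodeWeight n i / (s - i) *
        (F t / (t - s) - F t / (t - i))) a₁ a₂ b₁ b₂ = 2 * Real.pi * Complex.I *
        (if s.im ∈ Ioo b₁ b₂ then F s else 0) * (nodeWeight n i / (s - i)) -
        2 * Real.pi * Complex.I * (nodeWeight n i * F i / (s - i)) := by
      intro i hi
      rw [Finset.mem_range] at hi
      rw [rectIntegral_const_mul, rectIntegral_sub ha hb c1 (c2 i hi), hS,
        rectIntegral_div_sub (w := i) (by simp; linarith [Nat.cast_nonneg (α := ℝ) i])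
          (by simpa using hir i hi) (by simpa using hb₁) (by simpa using hb₂) hF]
      ring
    rw [Finset.sum_congr rfl this, Finset.sum_sub_distrib, ← Finset.mul_sum, ← Finset.mul_sum,
      ← inv_nodal hn hsn]
    split_ifs <;> ring
  · intro i hi
    exact continuousOn_const.mul (c1.sub (c2 i (Finset.mem_range.mp hi)))

theorem Gamma_add_one_eq_nodal_mul (n : ℕ) {s : ℂ} (hs : ∀ m : ℤ, s ≠ m) :
    Complex.Gamma (s + 1) = nodal n s * Complex.Gamma (s - n + 1) := by
  induction n with
  | zero => simp [nodal]
  | succ n ih =>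
    have hne : s - (n + 1 : ℕ) + 1 ≠ 0 := by
      intro h
      apply hs n
      push_cast at h ⊢
      linear_combination h
    have h := Complex.Gamma_add_one _ hne
    rw [show s - ((n + 1 : ℕ) : ℂ) + 1 + 1 = s - n + 1 by push_cast; ring] at h
    rw [ih, h, nodal, nodal, Finset.prod_range_succ]
    push_cast
    ring

theorem Gamma_sub_natCast_add_one_ne_zero (n : ℕ) {s : ℂ} (hs : ∀ m : ℤ, s ≠ m) :
    Complex.Gamma (s - n + 1) ≠ 0 := by
  apply Complex.Gamma_ne_zero
  intro m h
  apply hs (n - 1 - m)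
  push_cast
  linear_combination h

/-- The entire function interpolated by the kernel. -/
noncomputable def numer (M K : ℕ) (ν νt : ℕ → ℕ) (n : ℕ) (x : ℝ) (t : ℂ) : ℂ :=
  Complex.exp (t * Real.log x) / gammas M K ν νt n t

theorem differentiable_numer (M K : ℕ) (ν νt : ℕ → ℕ) (n : ℕ) (x : ℝ) :
    Differentiable ℂ (numer M K ν νt n x) := by
  have h1 : ∀ j, Differentiable ℂ fun t : ℂ => (Complex.Gamma (t + (ν j : ℂ) + 1))⁻¹ := fun j =>
    Complex.differentiable_one_div_Gamma.comp (by fun_prop : Differentiable ℂ fun t : ℂ =>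
      t + (ν j : ℂ) + 1)
  have h2 : ∀ k, Differentiable ℂ fun t : ℂ => (Complex.Gamma ((n : ℂ) - t + (νt k : ℂ)))⁻¹ :=
    fun k => Complex.differentiable_one_div_Gamma.comp (by fun_prop : Differentiable ℂ fun t : ℂ =>
      (n : ℂ) - t + (νt k : ℂ))
  have e : numer M K ν νt n x = fun t => Complex.exp (t * Real.log x) *
      ((∏ j ∈ Finset.Icc 1 M, (Complex.Gamma (t + (ν j : ℂ) + 1))⁻¹) *
      ∏ k ∈ Finset.Icc 1 K, (Complex.Gamma ((n : ℂ) - t + (νt k : ℂ)))⁻¹) := by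
    ext t
    rw [numer, gammas, div_eq_mul_inv, mul_inv, Finset.prod_inv_distrib, Finset.prod_inv_distrib]
  rw [e]
  have h3 : Differentiable ℂ fun t : ℂ =>
      ∏ j ∈ Finset.Icc 1 M, (Complex.Gamma (t + (ν j : ℂ) + 1))⁻¹ :=
    Differentiable.fun_finsetProd fun j _ => h1 j
  have h4 : Differentiable ℂ fun t : ℂ =>
      ∏ k ∈ Finset.Icc 1 K, (Complex.Gamma ((n : ℂ) - t + (νt k : ℂ)))⁻¹ :=
    Differentiable.fun_finsetProd fun j _ => h2 j
  exact (by fun_prop : Differentiable ℂ fun t : ℂ => Complex.exp (t * Real.log x)).mul (h3.mul h4)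

theorem integrandMK_eq {M K : ℕ} {ν νt : ℕ → ℕ} (hν0 : ν 0 = 0) (n : ℕ) (x y : ℝ) {s t : ℂ}
    (hs : ∀ m : ℤ, s ≠ m) (ht : ∀ m : ℤ, t ≠ m) :
    integrandMK M K ν νt n x y s t = weight M K ν νt n s * Complex.exp (-(s + 1) * Real.log y) *
      (numer M K ν νt n x t / (nodal n t * (s - t))) := by
  have g1 := Gamma_sub_natCast_add_one_ne_zero n hs
  have g2 := Gamma_sub_natCast_add_one_ne_zero n ht
  rw [integrandMK, prod_range_succ_eq_mul_prod_Icc, hν0, Nat.cast_zero, add_zero, add_zero,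
    Gamma_add_one_eq_nodal_mul n hs, Gamma_add_one_eq_nodal_mul n ht, Finset.prod_div_distrib,
    Finset.prod_div_distrib, numer, weight, gammas, gammas]
  field_simp

/-- The integrand of the single contour integral representing the kernel. -/
noncomputable def lineIntegrand (M K : ℕ) (ν νt : ℕ → ℕ) (n : ℕ) (x y : ℝ) (s : ℂ) : ℂ :=
  gammas M K ν νt n s * (interp n (numer M K ν νt n x)).eval s *
    Complex.exp (-(s + 1) * Real.log y)

theorem sC_ne_intCast (σ : ℝ) (m : ℤ) : sC σ ≠ m := by
  intro h
  have h1 := congrArg Complex.re h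
  simp [sC] at h1
  have h2 : (2 * m + 1 : ℝ) = 0 := by linarith
  have h3 : (2 * m + 1 : ℤ) = 0 := by exact_mod_cast h2
  omega

theorem KnMK_eq_lineIntegral {M K : ℕ} {ν νt : ℕ → ℕ} (hν0 : ν 0 = 0) {n : ℕ} (hn : 0 < n)
    (x y : ℝ) :
    KnMK M K ν νt n x y =
      1 / (2 * Real.pi) * ∫ σ : ℝ, lineIntegrand M K ν νt n x y (sC σ) := by
  have hn1 : (1 : ℝ) ≤ n := by exact_mod_cast hn
  set c : ℂ := ((n : ℂ) - 1) / 2 with hc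
  set R : ℝ := (n : ℝ) / 2 - 1 / 8 with hR
  have hR0 : 0 < R := by rw [hR]; linarith
  have hcR : c = (((n : ℝ) - 1) / 2 : ℝ) := by rw [hc]; push_cast; ring
  have hin : ∀ i : ℕ, i < n → (i : ℂ) ∈ Metric.ball c R := by
    intro i hi
    have h1 : (i : ℝ) + 1 ≤ n := by exact_mod_cast hi
    have h0 : (0 : ℝ) ≤ i := Nat.cast_nonneg i
    rw [Metric.mem_ball, dist_eq_norm, hcR, show (i : ℂ) - (((n : ℝ) - 1) / 2 : ℝ) =
      ((i - ((n : ℝ) - 1) / 2 : ℝ) : ℂ) by push_cast; ring, Complex.norm_real, Real.norm_eq_abs,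
      abs_lt]
    constructor <;> linarith
  have hout : ∀ σ, sC σ ∉ Metric.closedBall c R := by
    intro σ h
    rw [Metric.mem_closedBall, dist_eq_norm] at h
    have h2 := (Complex.abs_re_le_norm (sC σ - c)).trans h
    rw [hcR] at h2
    simp [sC] at h2
    have := (abs_le.mp h2).1
    linarith
  have hsph : ∀ t ∈ Metric.sphere c R, ∀ m : ℤ, t ≠ m := by
    rintro t ht m rfl
    rw [Metric.mem_sphere, dist_eq_norm, hcR, show (m : ℂ) - (((n : ℝ) - 1) / 2 : ℝ) =
      ((m - ((n : ℝ) - 1) / 2 : ℝ) : ℂ) by push_cast; ring, Complex.norm_real,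
      Real.norm_eq_abs] at ht
    rcases abs_choice (m - ((n : ℝ) - 1) / 2) with h | h
    · rw [h] at ht
      have h2 : (8 * m - 8 * n + 5 : ℝ) = 0 := by linarith
      have h3 : (8 * m - 8 * n + 5 : ℤ) = 0 := by exact_mod_cast h2
      omega
    · rw [h] at ht
      have h2 : (8 * m + 3 : ℝ) = 0 := by linarith
      have h3 : (8 * m + 3 : ℤ) = 0 := by exact_mod_cast h2
      omega
  have inner : ∀ σ : ℝ, (∫ θ in (0 : ℝ)..(2 * Real.pi),
        (((n : ℂ) / 2 - 1/8) * Complex.I * Complex.exp (θ * Complex.I)) *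
          integrandMK M K ν νt n x y (sC σ) (tC n θ)) =
      2 * Real.pi * Complex.I * lineIntegrand M K ν νt n x y (sC σ) := by
    intro σ
    have e := circleIntegral_div_nodal hn (differentiable_numer M K ν νt n x) hR0.le hin (hout σ)
    have e2 := eval_interp (numer M K ν νt n x) (s := sC σ) (n := n)
      fun i _ => by exact_mod_cast sC_ne_intCast σ i
    have e3 : 2 * Real.pi * Complex.I * lineIntegrand M K ν νt n x y (sC σ) =
        weight M K ν νt n (sC σ) * Complex.exp (-(sC σ + 1) * Real.log y) *
        (∮ t in C(c, R), numer M K ν νt n x t / (nodal n t * (sC σ - t))) := by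
      rw [e, lineIntegrand, e2, weight]; ring
    rw [e3, circleIntegral, ← intervalIntegral.integral_const_mul]
    refine intervalIntegral.integral_congr fun θ _ => ?_
    have ht : tC n θ = circleMap c R θ := by
      rw [tC, circleMap, hc, hR]; push_cast; ring
    have e4 : circleMap 0 R θ = ((n : ℂ) / 2 - 1 / 8) * Complex.exp (θ * Complex.I) := by
      rw [circleMap, hR]; push_cast; ring
    rw [ht, integrandMK_eq hν0 n x y (sC_ne_intCast σ)
      (hsph _ (circleMap_mem_sphere c hR0.le θ)), deriv_circleMap, e4, smul_eq_mul]
    ring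
  rw [KnMK]
  simp only [inner]
  rw [← integral_const_mul, ← integral_const_mul]
  congr 1
  ext σ
  have hpi : (Real.pi : ℂ) ≠ 0 := by exact_mod_cast Real.pi_ne_zero
  have hI := Complex.I_ne_zero
  field_simp

/-- Polynomial growth in vertical strips. -/
def PolyGrowth (u₁ u₂ : ℝ) (f : ℂ → ℂ) : Prop :=
  ∃ (C : ℝ) (D : ℕ), 0 ≤ C ∧ ∀ s : ℂ, s.re ∈ Icc u₁ u₂ → ‖f s‖ ≤ C * (1 + |s.im|) ^ D

namespace PolyGrowth

variable {u₁ u₂ : ℝ}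

theorem of_bounded {f : ℂ → ℂ} {C : ℝ} (h : ∀ s : ℂ, s.re ∈ Icc u₁ u₂ → ‖f s‖ ≤ C) :
    PolyGrowth u₁ u₂ f :=
  ⟨max C 0, 0, le_max_right _ _, fun s hs => by simpa using Or.inl (h s hs)⟩

theorem mul {f g : ℂ → ℂ} (hf : PolyGrowth u₁ u₂ f) (hg : PolyGrowth u₁ u₂ g) :
    PolyGrowth u₁ u₂ fun s => f s * g s := by
  obtain ⟨C, D, hC, h⟩ := hf
  obtain ⟨C', D', hC', h'⟩ := hg
  refine ⟨C * C', D + D', by positivity, fun s hs => ?_⟩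
  rw [norm_mul, pow_add]
  calc _ ≤ (C * (1 + |s.im|) ^ D) * (C' * (1 + |s.im|) ^ D') :=
        mul_le_mul (h s hs) (h' s hs) (norm_nonneg _) (by positivity)
    _ = _ := by ring

theorem add {f g : ℂ → ℂ} (hf : PolyGrowth u₁ u₂ f) (hg : PolyGrowth u₁ u₂ g) :
    PolyGrowth u₁ u₂ fun s => f s + g s := by
  obtain ⟨C, D, hC, h⟩ := hf
  obtain ⟨C', D', hC', h'⟩ := hg
  refine ⟨C + C', max D D', by positivity, fun s hs => (norm_add_le _ _).trans ?_⟩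
  have h1 : (1 : ℝ) ≤ 1 + |s.im| := by linarith [abs_nonneg s.im]
  rw [add_mul]
  refine add_le_add ((h s hs).trans ?_) ((h' s hs).trans ?_)
  · gcongr
    exact le_max_left _ _
  · gcongr
    exact le_max_right _ _

theorem const (c : ℂ) : PolyGrowth u₁ u₂ fun _ => c :=
  of_bounded (C := ‖c‖) fun _ _ => le_rfl

theorem id : PolyGrowth u₁ u₂ fun s => s := by
  refine ⟨max 1 (max |u₁| |u₂|), 1, by positivity, fun s hs => ?_⟩
  have h1 : |s.re| ≤ max |u₁| |u₂| := abs_le_max_abs_abs hs.1 hs.2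
  have h2 := le_max_left 1 (max |u₁| |u₂|)
  have h3 := le_max_right 1 (max |u₁| |u₂|)
  have h4 := abs_nonneg s.im
  have h5 := Complex.norm_le_abs_re_add_abs_im s
  nlinarith

theorem prod {ι : Type*} {f : ι → ℂ → ℂ} {S : Finset ι} (h : ∀ i ∈ S, PolyGrowth u₁ u₂ (f i)) :
    PolyGrowth u₁ u₂ fun s => ∏ i ∈ S, f i s := by
  classical
  induction S using Finset.induction_on with
  | empty => simpa using const 1
  | insert i S hi ih =>
    simp only [Finset.prod_insert hi]
    exact (h i (Finset.mem_insert_self _ _)).mul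
      (ih fun j hj => h j (Finset.mem_insert_of_mem hj))

theorem polynomial (p : Polynomial ℂ) : PolyGrowth u₁ u₂ fun s => p.eval s := by
  induction p using Polynomial.induction_on' with
  | add p q hp hq => simpa using hp.add hq
  | monomial n c =>
    simp only [Polynomial.eval_monomial]
    have h := prod (S := Finset.range n) (u₁ := u₁) (u₂ := u₂) fun _ _ => id
    simp only [Finset.prod_const, Finset.card_range] at h
    exact (const c).mul h

theorem Gamma_comp {f : ℂ → ℂ} {l r : ℝ} (hl : 0 < l)
    (hf : ∀ s : ℂ, s.re ∈ Icc u₁ u₂ → (f s).re ∈ Icc l r) :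
    PolyGrowth u₁ u₂ fun s => Complex.Gamma (f s) := by
  have hc : ContinuousOn (fun x : ℝ => ‖Complex.Gamma x‖) (Icc l r) := by
    intro x hx
    refine ContinuousAt.continuousWithinAt ?_
    refine ContinuousAt.norm (ContinuousAt.comp (f := fun x : ℝ => (x : ℂ))
      (Complex.differentiableAt_Gamma _ fun m h => ?_).continuousAt
      Complex.continuous_ofReal.continuousAt)
    have : x = -(m : ℝ) := by exact_mod_cast h
    have := hx.1
    linarith [Nat.cast_nonneg (α := ℝ) m]
  obtain ⟨C, hC⟩ := (isCompact_Icc.image_of_continuousOn hc).bddAbove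
  refine of_bounded (C := C) fun s hs => ?_
  have h := norm_Gamma_le_of_abs_le (x := (f s).re) (τ := 0) (τ' := (f s).im)
    (hl.trans_le (hf s hs).1) (by simp)
  rw [Complex.re_add_im] at h
  refine h.trans (hC ⟨(f s).re, hf s hs, by simp⟩)

theorem exp_linear (c : ℝ) : PolyGrowth u₁ u₂ fun s => Complex.exp (s * c) := by
  refine of_bounded (C := Real.exp (max |u₁| |u₂| * |c|)) fun s hs => ?_
  rw [Complex.norm_exp, Complex.re_mul_ofReal]
  apply Real.exp_le_exp.mpr
  have h1 : |s.re| ≤ max |u₁| |u₂| := abs_le_max_abs_abs hs.1 hs.2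
  calc s.re * c ≤ |s.re * c| := le_abs_self _
    _ = |s.re| * |c| := abs_mul _ _
    _ ≤ _ := by gcongr

theorem Gamma_add_natCast_div {f : ℂ → ℂ} (hf : PolyGrowth u₁ u₂ f) (m : ℕ)
    (hne : ∀ s : ℂ, s.re ∈ Icc u₁ u₂ → ∀ i : ℕ, f s + i ≠ 0) :
    ∃ P : ℂ → ℂ, PolyGrowth u₁ u₂ P ∧ ∀ s : ℂ, s.re ∈ Icc u₁ u₂ →
      Complex.Gamma (f s + m) = P s * Complex.Gamma (f s) := by
  refine ⟨fun s => ∏ i ∈ Finset.range m, (f s + i), prod fun i _ => hf.add (const _), ?_⟩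
  intro s hs
  change Complex.Gamma (f s + m) = (∏ i ∈ Finset.range m, (f s + i)) * Complex.Gamma (f s)
  induction m with
  | zero => simp
  | succ m ih =>
    rw [Nat.cast_succ, ← add_assoc, Complex.Gamma_add_one _ (hne s hs m), ih,
      Finset.prod_range_succ]
    ring

end PolyGrowth

theorem exists_norm_lineIntegrand_le {M K : ℕ} (hM : 1 ≤ M) (hK : 1 ≤ K) (ν νt : ℕ → ℕ) (n : ℕ)
    (x y : ℝ) {u₁ u₂ : ℝ} (h1 : -1 < u₁) (h2 : u₂ < n) :
    ∃ C : ℝ, 0 ≤ C ∧ ∀ s : ℂ, s.re ∈ Icc u₁ u₂ → 1 ≤ |s.im| →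
      ‖lineIntegrand M K ν νt n x y s‖ ≤ C * Real.exp (-|s.im|) := by
  have lin1 : PolyGrowth u₁ u₂ fun s => s + 1 := PolyGrowth.id.add (PolyGrowth.const 1)
  have lin2 : PolyGrowth u₁ u₂ fun s => (n : ℂ) - s := by
    have := (PolyGrowth.const (u₁ := u₁) (u₂ := u₂) (n : ℂ)).add
      ((PolyGrowth.const (-1)).mul PolyGrowth.id)
    simpa [sub_eq_add_neg] using this
  have sM : Finset.Icc 1 M = insert 1 (Finset.Icc 2 M) := by
    ext; simp only [Finset.mem_insert, Finset.mem_Icc]; omega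
  have sK : Finset.Icc 1 K = insert 1 (Finset.Icc 2 K) := by
    ext; simp only [Finset.mem_insert, Finset.mem_Icc]; omega
  obtain ⟨P, hP, eP⟩ := lin1.Gamma_add_natCast_div (ν 1) fun s hs i h => by
    have := congrArg Complex.re h
    simp at this
    linarith [hs.1, Nat.cast_nonneg (α := ℝ) i]
  obtain ⟨P', hP', eP'⟩ := lin2.Gamma_add_natCast_div (νt 1) fun s hs i h => by
    have := congrArg Complex.re h
    simp at this
    linarith [hs.2, Nat.cast_nonneg (α := ℝ) i]
  have g1 : PolyGrowth u₁ u₂ fun s =>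
      ∏ j ∈ Finset.Icc 2 M, Complex.Gamma (s + (ν j : ℂ) + 1) :=
    PolyGrowth.prod fun j _ => PolyGrowth.Gamma_comp (l := u₁ + 1) (r := u₂ + ν j + 1)
      (by linarith) fun s hs => by
        have := Nat.cast_nonneg (α := ℝ) (ν j)
        simp
        constructor <;> linarith [hs.1, hs.2]
  have g2 : PolyGrowth u₁ u₂ fun s =>
      ∏ k ∈ Finset.Icc 2 K, Complex.Gamma ((n : ℂ) - s + (νt k : ℂ)) :=
    PolyGrowth.prod fun k _ => PolyGrowth.Gamma_comp (l := n - u₂) (r := n - u₁ + νt k)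
      (by linarith) fun s hs => by
        have := Nat.cast_nonneg (α := ℝ) (νt k)
        simp
        constructor <;> linarith [hs.1, hs.2]
  have hnod : PolyGrowth u₁ u₂ fun s => nodal n s :=
    PolyGrowth.prod fun i _ => by
      simpa [sub_eq_add_neg] using PolyGrowth.id.add (PolyGrowth.const (-(i : ℂ)))
  have hexp : PolyGrowth u₁ u₂ fun s => Complex.exp (-(s + 1) * Real.log y) := by
    have := (PolyGrowth.const (u₁ := u₁) (u₂ := u₂) (Complex.exp (-Real.log y))).mul
      (PolyGrowth.exp_linear (-Real.log y))
    refine (congrArg (PolyGrowth u₁ u₂) (funext fun s => ?_)).mp this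
    rw [← Complex.exp_add]
    congr 1
    push_cast
    ring
  obtain ⟨C, D, hC, hb⟩ := (((hP.mul hP').mul (g1.mul g2)).mul hnod).mul
    ((PolyGrowth.polynomial (interp n (numer M K ν νt n x))).mul hexp)
  refine ⟨4 * Real.pi * C * (D.factorial * Real.exp 1), by positivity, fun s hs him => ?_⟩
  have hsi : ∀ m : ℤ, s ≠ m := by
    rintro m rfl
    simp at him
    linarith
  have e := norm_nodal_mul_pi n hsi
  have hsin := exp_abs_im_div_four_le_norm_sin (z := Real.pi * s)
    (by rw [Complex.im_ofReal_mul, abs_mul, abs_of_pos Real.pi_pos]; nlinarith [Real.pi_gt_three])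
  rw [Complex.im_ofReal_mul, abs_mul, abs_of_pos Real.pi_pos] at hsin
  have hfac : ‖lineIntegrand M K ν νt n x y s‖ * ‖Complex.sin (Real.pi * s)‖ ≤
      Real.pi * (C * (1 + |s.im|) ^ D) := by
    refine le_trans (le_of_eq ?_) (mul_le_mul_of_nonneg_left (hb s hs) Real.pi_pos.le)
    rw [lineIntegrand, gammas, sM, sK, Finset.prod_insert (by simp), Finset.prod_insert (by simp),
      show s + (ν 1 : ℂ) + 1 = s + 1 + (ν 1 : ℂ) by ring, eP s hs, eP' s hs]
    simp only [norm_mul]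
    linear_combination (-‖P s‖ * ‖P' s‖ *
      ‖∏ j ∈ Finset.Icc 2 M, Complex.Gamma (s + (ν j : ℂ) + 1)‖ *
      ‖∏ k ∈ Finset.Icc 2 K, Complex.Gamma ((n : ℂ) - s + (νt k : ℂ))‖ *
      ‖(interp n (numer M K ν νt n x)).eval s‖ *
      ‖Complex.exp (-(s + 1) * Real.log y)‖) * e
  have hpow : (1 + |s.im|) ^ D ≤ D.factorial * Real.exp 1 * Real.exp |s.im| := by
    have := Real.pow_div_factorial_le_exp (1 + |s.im|) (by positivity) D
    rw [div_le_iff₀ (by positivity), Real.exp_add] at this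
    linarith
  have hpi : Real.exp |s.im| * Real.exp |s.im| ≤ Real.exp (Real.pi * |s.im|) := by
    rw [← Real.exp_add]
    apply Real.exp_le_exp.mpr
    nlinarith [Real.pi_gt_three]
  have hE := Real.exp_pos |s.im|
  rw [Real.exp_neg, ← div_eq_mul_inv, le_div_iff₀ hE]
  have hN := norm_nonneg (lineIntegrand M K ν νt n x y s)
  have k1 : ‖lineIntegrand M K ν νt n x y s‖ * (Real.exp |s.im| * Real.exp |s.im|) ≤
      4 * (Real.pi * (C * (D.factorial * Real.exp 1 * Real.exp |s.im|))) := by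
    calc _ ≤ ‖lineIntegrand M K ν νt n x y s‖ * (4 * ‖Complex.sin (Real.pi * s)‖) := by
          exact mul_le_mul_of_nonneg_left (by linarith) hN
      _ = 4 * (‖lineIntegrand M K ν νt n x y s‖ * ‖Complex.sin (Real.pi * s)‖) := by ring
      _ ≤ 4 * (Real.pi * (C * (1 + |s.im|) ^ D)) := by gcongr
      _ ≤ _ := by gcongr
  have k2 : (‖lineIntegrand M K ν νt n x y s‖ * Real.exp |s.im|) * Real.exp |s.im| ≤
      (4 * Real.pi * C * (D.factorial * Real.exp 1)) * Real.exp |s.im| := by linarith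
  exact le_of_mul_le_mul_right k2 hE

theorem integrable_exp_neg_mul_abs {c : ℝ} (hc : 0 < c) :
    Integrable fun x : ℝ => Real.exp (-(c * |x|)) := by
  rw [← integrableOn_univ, ← Iic_union_Ioi (a := (0 : ℝ)), integrableOn_union]
  constructor
  · refine (integrableOn_exp_mul_Iic hc 0).congr_fun (fun x hx => ?_) measurableSet_Iic
    simp only
    rw [abs_of_nonpos hx]
    ring_nf
  · refine (exp_neg_integrableOn_Ioi 0 hc).congr_fun (fun x hx => ?_) measurableSet_Ioi
    simp only
    rw [abs_of_pos hx]
    ring_nf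

theorem differentiableAt_lineIntegrand (M K : ℕ) (ν νt : ℕ → ℕ) (n : ℕ) (x y : ℝ) {s : ℂ}
    (h1 : -1 < s.re) (h2 : s.re < n) :
    DifferentiableAt ℂ (lineIntegrand M K ν νt n x y) s := by
  have g1 : ∀ j, DifferentiableAt ℂ (fun s : ℂ => Complex.Gamma (s + (ν j : ℂ) + 1)) s := by
    intro j
    refine DifferentiableAt.comp s (Complex.differentiableAt_Gamma _ fun m h => ?_)
      (by fun_prop : DifferentiableAt ℂ (fun s : ℂ => s + (ν j : ℂ) + 1) s)
    have := congrArg Complex.re h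
    simp at this
    linarith [Nat.cast_nonneg (α := ℝ) m, Nat.cast_nonneg (α := ℝ) (ν j)]
  have g2 : ∀ k, DifferentiableAt ℂ (fun s : ℂ => Complex.Gamma ((n : ℂ) - s + (νt k : ℂ))) s := by
    intro k
    refine DifferentiableAt.comp s (Complex.differentiableAt_Gamma _ fun m h => ?_)
      (by fun_prop : DifferentiableAt ℂ (fun s : ℂ => (n : ℂ) - s + (νt k : ℂ)) s)
    have := congrArg Complex.re h
    simp at this
    linarith [Nat.cast_nonneg (α := ℝ) m, Nat.cast_nonneg (α := ℝ) (νt k)]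
  have h3 : DifferentiableAt ℂ (gammas M K ν νt n) s :=
    (DifferentiableAt.fun_finsetProd fun j _ => g1 j).mul
      (DifferentiableAt.fun_finsetProd fun k _ => g2 k)
  exact (h3.mul (Polynomial.differentiableAt _)).mul (by fun_prop)

theorem continuous_lineIntegrand_vertical (M K : ℕ) (ν νt : ℕ → ℕ) (n : ℕ) (x y : ℝ) {u : ℝ}
    (h1 : -1 < u) (h2 : u < n) :
    Continuous fun σ : ℝ => lineIntegrand M K ν νt n x y (u + σ * Complex.I) := by
  rw [continuous_iff_continuousAt]
  intro σ
  exact ContinuousAt.comp (f := fun σ : ℝ => (u + σ * Complex.I : ℂ))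
    (differentiableAt_lineIntegrand M K ν νt n x y (by simpa using h1)
      (by simpa using h2)).continuousAt (by fun_prop)

theorem integrable_lineIntegrand {M K : ℕ} (hM : 1 ≤ M) (hK : 1 ≤ K) (ν νt : ℕ → ℕ) (n : ℕ)
    (x y : ℝ) {u : ℝ} (h1 : -1 < u) (h2 : u < n) :
    Integrable fun σ : ℝ => lineIntegrand M K ν νt n x y (u + σ * Complex.I) := by
  obtain ⟨C, hC, hb⟩ := exists_norm_lineIntegrand_le hM hK ν νt n x y h1 h2
  have hcont := continuous_lineIntegrand_vertical M K ν νt n x y h1 h2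
  obtain ⟨B, hB⟩ := (isCompact_Icc (a := (-1 : ℝ)) (b := 1)).exists_bound_of_continuousOn
    hcont.continuousOn
  refine ((integrable_exp_neg_mul_abs one_pos).const_mul (C + B * Real.exp 1)).mono'
    hcont.aestronglyMeasurable (Eventually.of_forall fun σ => ?_)
  have hB0 : 0 ≤ B := (norm_nonneg _).trans (hB 0 (by simp))
  rw [one_mul, add_mul]
  rcases le_total 1 |σ| with h | h
  · refine (hb _ (by simp) (by simpa using h)).trans ?_
    simp only [add_im, ofReal_im, mul_im, ofReal_re, I_im, mul_one, I_re, mul_zero, add_zero,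
      zero_add]
    have : 0 ≤ B * Real.exp 1 * Real.exp (-|σ|) := by positivity
    linarith
  · refine (hB σ (abs_le.mp h)).trans ?_
    have : 1 ≤ Real.exp 1 * Real.exp (-|σ|) := by
      rw [← Real.exp_add]
      exact Real.one_le_exp (by linarith)
    have h3 : 0 ≤ C * Real.exp (-|σ|) := by positivity
    nlinarith

theorem integral_lineIntegrand_shift {M K : ℕ} (hM : 1 ≤ M) (hK : 1 ≤ K) (ν νt : ℕ → ℕ) (n : ℕ)
    (x y : ℝ) {u₁ u₂ : ℝ} (h1 : -1 < u₁) (h : u₁ ≤ u₂) (h2 : u₂ < n) :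
    ∫ σ : ℝ, lineIntegrand M K ν νt n x y (u₁ + σ * Complex.I) =
      ∫ σ : ℝ, lineIntegrand M K ν νt n x y (u₂ + σ * Complex.I) := by
  obtain ⟨C, hC, hb⟩ := exists_norm_lineIntegrand_le hM hK ν νt n x y h1 h2
  set f := lineIntegrand M K ν νt n x y with hf
  have t1 := intervalIntegral_tendsto_integral
    (integrable_lineIntegrand hM hK ν νt n x y h1 (h.trans_lt h2))
    tendsto_neg_atTop_atBot (tendsto_id (α := ℝ) (x := atTop))
  have t2 := intervalIntegral_tendsto_integral
    (integrable_lineIntegrand hM hK ν νt n x y (h1.trans_le h) h2)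
    tendsto_neg_atTop_atBot (tendsto_id (α := ℝ) (x := atTop))
  have hexp : Tendsto (fun T : ℝ => C * Real.exp (-T) * |u₂ - u₁|) atTop (𝓝 0) := by
    have := ((Real.tendsto_exp_neg_atTop_nhds_zero).const_mul C).mul_const |u₂ - u₁|
    simpa using this
  have hbound : ∀ T T' : ℝ, 1 ≤ T → |T'| = T →
      ‖∫ u in u₁..u₂, f (u + T' * Complex.I)‖ ≤ C * Real.exp (-T) * |u₂ - u₁| := by
    intro T T' hT hT'
    refine intervalIntegral.norm_integral_le_of_norm_le_const fun u hu => ?_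
    rw [uIoc_of_le h] at hu
    have := hb (u + T' * Complex.I) (by simpa using ⟨hu.1.le, hu.2⟩) (by simpa [hT'] using hT)
    simpa [hT'] using this
  have t3 : Tendsto (fun T : ℝ => ∫ u in u₁..u₂, f (u + T * Complex.I)) atTop (𝓝 0) :=
    squeeze_zero_norm' ((eventually_ge_atTop 1).mono fun T hT =>
      hbound T T hT (abs_of_pos (by linarith))) hexp
  have t4 : Tendsto (fun T : ℝ => ∫ u in u₁..u₂, f (u + (-T : ℝ) * Complex.I)) atTop (𝓝 0) :=
    squeeze_zero_norm' ((eventually_ge_atTop 1).mono fun T hT =>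
      hbound T (-T) hT (by rw [abs_neg, abs_of_pos (by linarith)])) hexp
  have t5 := ((t4.sub t3).add (t2.const_mul Complex.I)).sub (t1.const_mul Complex.I)
  have t6 : Tendsto (fun T : ℝ => rectIntegral f u₁ u₂ (-T) T) atTop (𝓝 0) := by
    refine tendsto_const_nhds.congr' ((eventually_ge_atTop 0).mono fun T hT => ?_)
    refine (rectIntegral_eq_zero h (by linarith) fun s hs => ?_).symm
    exact (differentiableAt_lineIntegrand M K ν νt n x y (h1.trans_le hs.1.1)
      (hs.1.2.trans_lt h2)).differentiableWithinAt
  have := tendsto_nhds_unique t5 t6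
  have h0 : Complex.I * ((∫ σ : ℝ, f (u₂ + σ * Complex.I)) - ∫ σ : ℝ, f (u₁ + σ * Complex.I)) =
      0 := by
    linear_combination this
  rcases mul_eq_zero.mp h0 with h0 | h0
  · exact absurd h0 Complex.I_ne_zero
  · exact (sub_eq_zero.mp h0).symm

theorem gammas_ne_zero (M K : ℕ) (ν νt : ℕ → ℕ) (n : ℕ) {s : ℂ} (h1 : -1 < s.re)
    (h2 : s.re < n) : gammas M K ν νt n s ≠ 0 := by
  refine mul_ne_zero (Finset.prod_ne_zero_iff.mpr fun j _ => ?_)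
    (Finset.prod_ne_zero_iff.mpr fun k _ => ?_)
  · apply Complex.Gamma_ne_zero_of_re_pos
    have := Nat.cast_nonneg (α := ℝ) (ν j)
    simp
    linarith
  · apply Complex.Gamma_ne_zero_of_re_pos
    have := Nat.cast_nonneg (α := ℝ) (νt k)
    simp
    linarith

/-- The remainder left after collecting the residue at `t = s`. -/
noncomputable def remainder (M K : ℕ) (ν νt : ℕ → ℕ) (n : ℕ) (x y b : ℝ) (s : ℂ) : ℂ :=
  weight M K ν νt n s * Complex.exp (-(s + 1) * Real.log y) *
    rectIntegral (fun t => Complex.exp (t * Real.log x) / (weight M K ν νt n t * (t - s)))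
      (-(1 / 2)) (n - 1 / 2) (-b) b

/-- The residue at `t = s`. -/
noncomputable def residue (x y : ℝ) (s : ℂ) : ℂ :=
  Complex.exp (s * Real.log x) * Complex.exp (-(s + 1) * Real.log y)

theorem lineIntegrand_eq (M K : ℕ) (ν νt : ℕ → ℕ) {n : ℕ} (hn : 0 < n) (x y : ℝ) {b : ℝ}
    (hb : 0 < b) {s : ℂ} (h1 : -(1 / 2) < s.re) (h2 : s.re < n - 1 / 2) (h0 : s.im ≠ 0)
    (hsb : |s.im| ≠ b) :
    lineIntegrand M K ν νt n x y s = (if |s.im| < b then residue x y s else 0) -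
      1 / (2 * Real.pi * Complex.I) * remainder M K ν νt n x y b s := by
  have hsn : ∀ i : ℕ, i < n → s ≠ i := by
    rintro i - rfl
    simp at h0
  have hnod := nodal_ne_zero hsn
  have hg := gammas_ne_zero M K ν νt n (s := s) (by linarith) (by linarith)
  have hb1 : s.im ≠ b := fun h => hsb (by rw [h, abs_of_pos hb])
  have hb2 : s.im ≠ -b := fun h => hsb (by rw [h, abs_neg, abs_of_pos hb])
  have hr := rectIntegral_div_nodal hn (differentiable_numer M K ν νt n x) (a₁ := -(1 / 2))
    (a₂ := n - 1 / 2) (by norm_num) (by linarith) (neg_lt_zero.mpr hb) hb hsn h1 h2 hb2 hb1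
  have hcongr : (fun t => numer M K ν νt n x t / (nodal n t * (t - s))) =
      fun t => Complex.exp (t * Real.log x) / (weight M K ν νt n t * (t - s)) := by
    ext t
    rw [numer, weight, div_div]
    ring_nf
  rw [hcongr] at hr
  have hpi : (2 * Real.pi * Complex.I : ℂ) ≠ 0 := Complex.two_pi_I_ne_zero
  rw [remainder, hr, lineIntegrand, eval_interp _ hsn, residue, weight]
  simp only [mem_Ioo, ← abs_lt]
  generalize (∑ i ∈ Finset.range n, nodeWeight n i * numer M K ν νt n x i / (s - i)) = Q
  split_ifs
  · rw [numer]
    field_simp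
    ring
  · field_simp
    ring

theorem norm_KnMK_sub_le {M K : ℕ} (hM : 1 ≤ M) (hK : 1 ≤ K) {ν : ℕ → ℕ} (νt : ℕ → ℕ)
    (hν0 : ν 0 = 0) {n : ℕ} (hn : 0 < n) (x y : ℝ) {a b : ℝ} (hb : 0 < b) (h1 : 0 < a)
    (h2 : a < n - 1 / 2) {g : ℝ → ℝ} (hg : Integrable g)
    (hbound : ∀ σ : ℝ, σ ≠ 0 → |σ| ≠ b →
      ‖remainder M K ν νt n x y b (a + σ * Complex.I)‖ ≤ g σ) :
    ‖KnMK M K ν νt n x y - 1 / (2 * Real.pi) *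
      ∫ σ in -b..b, residue x y (a + σ * Complex.I)‖ ≤ ∫ σ, g σ := by
  have hres : Continuous fun σ : ℝ => residue x y (a + σ * Complex.I) := by
    unfold residue; fun_prop
  have e1 : ∫ σ in -b..b, residue x y (a + σ * Complex.I) =
      ∫ σ : ℝ, (Ioc (-b) b).indicator (fun σ : ℝ => residue x y (a + σ * Complex.I)) σ := by
    rw [intervalIntegral.integral_of_le (by linarith), integral_indicator measurableSet_Ioc]
  have hsC : ∀ σ : ℝ, sC σ = ((-(1 / 2) : ℝ) : ℂ) + σ * Complex.I := fun σ => by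
    rw [sC]; push_cast; ring
  have e2 := KnMK_eq_lineIntegral (M := M) (K := K) (νt := νt) hν0 hn x y
  simp only [hsC] at e2
  rw [integral_lineIntegrand_shift hM hK ν νt n x y (u₂ := a) (by norm_num) (by linarith)
    (by linarith)] at e2
  rw [e2, e1, ← mul_sub, ← integral_sub (integrable_lineIntegrand hM hK ν νt n x y
    (by linarith) (by linarith)) ((integrable_indicator_iff measurableSet_Ioc).mpr
      hres.integrableOn_Ioc), norm_mul]
  have hp : ‖(1 / (2 * Real.pi) : ℂ)‖ ≤ 1 := by
    rw [show (1 / (2 * Real.pi) : ℂ) = ((1 / (2 * Real.pi) : ℝ) : ℂ) by push_cast; ring,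
      Complex.norm_real, Real.norm_eq_abs, abs_of_pos (by positivity), div_le_one (by positivity)]
    linarith [Real.pi_gt_three]
  have hpI : ‖(1 / (2 * Real.pi * Complex.I) : ℂ)‖ ≤ 1 := by
    rw [← div_div, norm_div, Complex.norm_I, div_one]
    exact hp
  refine (mul_le_of_le_one_left (norm_nonneg _) hp).trans
    (norm_integral_le_of_norm_le hg ?_)
  have hae : ∀ᵐ σ : ℝ, σ ∉ ({0, b, -b} : Set ℝ) :=
    compl_mem_ae_iff.mpr ((Set.toFinite _).measure_zero _)
  filter_upwards [hae] with σ hσ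
  simp only [mem_insert_iff, mem_singleton_iff, not_or] at hσ
  have hσb : |σ| ≠ b := fun h => by
    rcases abs_choice σ with h' | h' <;> rw [h'] at h
    · exact hσ.2.1 h
    · exact hσ.2.2 (by linarith)
  rw [lineIntegrand_eq M K ν νt hn x y hb (by simp; linarith) (by simpa using h2)
    (by simpa using hσ.1) (by simpa using hσb)]
  have him : ((a : ℂ) + σ * Complex.I).im = σ := by simp
  rw [him]
  have hind : (Ioc (-b) b).indicator (fun σ : ℝ => residue x y (a + σ * Complex.I)) σ =
      if |σ| < b then residue x y (a + σ * Complex.I) else 0 := by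
    rw [indicator]
    congr 1
    rw [mem_Ioc, abs_lt]
    exact propext ⟨fun h => ⟨h.1, lt_of_le_of_ne h.2 hσ.2.1⟩, fun h => ⟨h.1, h.2.le⟩⟩
  rw [hind, sub_sub_cancel_left, norm_neg, norm_mul]
  exact (mul_le_of_le_one_left (norm_nonneg _) hpI).trans (hbound σ hσ.1 hσb)

theorem abs_mul_log_le (α : ℝ) {l r u : ℝ} (hl : 0 < l) (h1 : l ≤ r) (h2 : r ≤ u) :
    |α * Real.log r| ≤ |α| * (|Real.log l| + |Real.log u|) := by
  rw [abs_mul]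
  refine mul_le_mul_of_nonneg_left ?_ (abs_nonneg _)
  have k1 := Real.log_le_log hl h1
  have k2 := Real.log_le_log (hl.trans_le h1) h2
  rw [abs_le]
  constructor
  · linarith [neg_abs_le (Real.log l), abs_nonneg (Real.log u)]
  · linarith [le_abs_self (Real.log u), abs_nonneg (Real.log l)]

theorem eventually_pow_le_exp (c : ℝ) (k : ℕ) {ε : ℝ} (hc : 0 ≤ c) (hε : 0 < ε) :
    ∀ᶠ n : ℕ in atTop, (1 + c * n) ^ k ≤ Real.exp (n * ε) := by
  have h1 : Tendsto (fun n : ℕ => (n : ℝ) * ε) atTop atTop :=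
    tendsto_natCast_atTop_atTop.atTop_mul_const hε
  have h2 := ((Real.tendsto_pow_mul_exp_neg_atTop_nhds_zero k).comp h1).const_mul
    (((1 + c) / ε) ^ k)
  rw [mul_zero] at h2
  filter_upwards [h2.eventually_le_const one_pos, eventually_ge_atTop 1] with n hn hn1
  have hn1 : (1 : ℝ) ≤ n := by exact_mod_cast hn1
  simp only [Function.comp_apply] at hn
  rw [← mul_assoc, ← mul_pow, Real.exp_neg, ← div_eq_mul_inv, div_le_one (Real.exp_pos _)] at hn
  refine (pow_le_pow_left₀ (by positivity) ?_ k).trans hn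
  rw [div_mul_eq_mul_div, le_div_iff₀ hε]
  nlinarith

/-- The two-sided control of the weight on the contours of the saddle point analysis. -/
structure WeightBounds (M K : ℕ) (ν νt : ℕ → ℕ) (x0 a b : ℝ) (N : ℕ → ℝ) (C c : ℝ) (D n : ℕ) :
    Prop where
  vertical : ∀ v : ℝ, ‖weight M K ν νt n (n * (a + v * Complex.I))‖ ≤
    C * (1 + |v|) ^ D *
      Real.exp (-(n * (phase M K x0 (a + b * Complex.I) - phase M K x0 (a + v * Complex.I)))) *
      Real.exp (N n + n * a * (((M : ℝ) - K) * Real.log n + Real.log x0))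
  boundary : ∀ t ∈ rectBoundary (-(1 / 2)) (n - 1 / 2) (-(n * b)) (n * b),
    c * Real.exp (N n + t.re * (((M : ℝ) - K) * Real.log n + Real.log x0)) ≤
      ‖weight M K ν νt n t‖

theorem IsSaddle.exists_weightBounds {M K : ℕ} (hM : 1 ≤ M) (hK : 1 ≤ K) {ν : ℕ → ℕ}
    (νt : ℕ → ℕ) (hν0 : ν 0 = 0) {x0 a b : ℝ} (h : IsSaddle M K x0 a b) :
    ∃ (N : ℕ → ℝ) (C c : ℝ) (D : ℕ), 0 ≤ C ∧ 0 < c ∧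
      ∀ᶠ n : ℕ in atTop, WeightBounds M K ν νt x0 a b N C c D n := by
  obtain ⟨C, α, β, hC⟩ := exists_norm_weight_bounds M K ν νt hν0 x0
  obtain ⟨hor, ε, hε, hor'⟩ := h.horizontal
  obtain ⟨ha, ha1, hb, -, -⟩ := h
  set P := phase M K x0 (a + b * Complex.I) with hP
  set κ : ℝ := |α| * (|Real.log b| + |Real.log (2 + b)|) +
    |β| * (|Real.log b| + |Real.log (2 + b)|) with hκ
  set κ' : ℝ := |α| * |Real.log a| + |β| * |Real.log (1 - a)| with hκ'
  set D : ℕ := ⌈|α| + |β|⌉₊ with hD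
  refine ⟨fun n => (α + β) * Real.log n + (K + 1) * (n * Real.log n) + n * P,
    Real.exp (C + κ'), Real.exp (-C - κ), D, (Real.exp_pos _).le, Real.exp_pos _, ?_⟩
  have tn : Tendsto (fun n : ℕ => (n : ℝ)) atTop atTop := tendsto_natCast_atTop_atTop
  filter_upwards [eventually_gt_atTop 0, (tn.atTop_mul_const hb).eventually_ge_atTop 2,
    (tn.atTop_mul_const ha).eventually_ge_atTop 2,
    (tn.atTop_mul_const (sub_pos.mpr ha1)).eventually_ge_atTop 2,
    eventually_pow_le_exp (2 * b) (ν 1) (by positivity) hε,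
    eventually_pow_le_exp (2 * b) (νt 1) (by positivity) hε] with n hn nb na na1 hν hνt
  have hnR : (0 : ℝ) < n := by exact_mod_cast hn
  set ℓ := ((M : ℝ) - K) * Real.log n + Real.log x0 with hℓ
  have top : ∀ u : ℝ, -(1 / 2) ≤ n * u → n * u ≤ n - 1 / 2 →
      Real.exp (-C - κ) * Real.exp ((α + β) * Real.log n + (K + 1) * (n * Real.log n) + n * P +
        n * u * ℓ + n * (phase M K x0 (u + b * Complex.I) - P)) ≤
      ‖weight M K ν νt n (n * (u + b * Complex.I))‖ := by
    intro u h1 h2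
    have hu : -1 ≤ u := by
      by_contra! hu
      nlinarith
    have hu1 : u < 1 := by
      by_contra! hu
      nlinarith
    have e1 : b ≤ ‖(u + b * Complex.I : ℂ)‖ := by
      have := Complex.abs_im_le_norm (u + b * Complex.I : ℂ)
      simpa [abs_of_pos hb] using this
    have e2 : b ≤ ‖1 - (u + b * Complex.I : ℂ)‖ := by
      have := Complex.abs_im_le_norm (1 - (u + b * Complex.I : ℂ))
      simpa [abs_of_pos hb] using this
    have e3 : ‖(u + b * Complex.I : ℂ)‖ ≤ 2 + b := by
      have := Complex.norm_le_abs_re_add_abs_im (u + b * Complex.I : ℂ)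
      simp [abs_of_pos hb] at this
      linarith [abs_le.mpr ⟨hu, hu1.le⟩]
    have e4 : ‖1 - (u + b * Complex.I : ℂ)‖ ≤ 2 + b := by
      have := Complex.norm_le_abs_re_add_abs_im (1 - (u + b * Complex.I : ℂ))
      simp [abs_of_pos hb] at this
      have : |1 - u| ≤ 2 := abs_le.mpr ⟨by linarith, by linarith⟩
      linarith
    have := (hC n (u + b * Complex.I) hn (by simpa using h1) (by simpa using hu1)
      (by nlinarith) (by nlinarith)).2 (by
        have : ((u : ℂ) + b * Complex.I).im = b := by simp
        rw [this, abs_of_pos hb]; linarith)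
    refine le_trans ?_ this
    rw [← Real.exp_add]
    apply Real.exp_le_exp.mpr
    have k1 := (abs_le.mp (abs_mul_log_le α hb e1 e3)).1
    have k2 := (abs_le.mp (abs_mul_log_le β hb e2 e4)).1
    have k3 : ((u : ℂ) + b * Complex.I).re = u := by simp
    rw [k3, ← hℓ]
    linarith
  refine ⟨fun v => ?_, ?_⟩
  · have e1 : a ≤ ‖(a + v * Complex.I : ℂ)‖ := by
      have := Complex.abs_re_le_norm (a + v * Complex.I : ℂ)
      simpa [abs_of_pos ha] using this
    have e2 : 1 - a ≤ ‖1 - (a + v * Complex.I : ℂ)‖ := by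
      have := Complex.abs_re_le_norm (1 - (a + v * Complex.I : ℂ))
      simpa [abs_of_pos (sub_pos.mpr ha1)] using this
    have e3 : ‖(a + v * Complex.I : ℂ)‖ ≤ 1 + |v| := by
      have := Complex.norm_le_abs_re_add_abs_im (a + v * Complex.I : ℂ)
      simp [abs_of_pos ha] at this
      linarith
    have e4 : ‖1 - (a + v * Complex.I : ℂ)‖ ≤ 1 + |v| := by
      have := Complex.norm_le_abs_re_add_abs_im (1 - (a + v * Complex.I : ℂ))
      simp [abs_of_pos (sub_pos.mpr ha1)] at this
      linarith
    have hlog : 0 ≤ Real.log (1 + |v|) := Real.log_nonneg (by linarith [abs_nonneg v])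
    have := (hC n (a + v * Complex.I) hn (by simp; linarith) (by simpa using ha1)
      (by nlinarith) (by nlinarith)).1
    refine this.trans ?_
    have k1 := (abs_le.mp (abs_mul_log_le α ha e1 e3)).2
    have k2 := (abs_le.mp (abs_mul_log_le β (sub_pos.mpr ha1) e2 e4)).2
    rw [abs_of_nonneg hlog] at k1 k2
    have k3 : ((a : ℂ) + v * Complex.I).re = a := by simp
    have k4 : (|α| + |β|) * Real.log (1 + |v|) ≤ D * Real.log (1 + |v|) :=
      mul_le_mul_of_nonneg_right (Nat.le_ceil _) hlog
    rw [k3, ← hℓ, show (1 + |v|) ^ D = Real.exp (D * Real.log (1 + |v|)) by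
      rw [← Real.exp_log (show 0 < (1 + |v|) ^ D by positivity), Real.log_pow], ← Real.exp_add,
      ← Real.exp_add, ← Real.exp_add]
    apply Real.exp_le_exp.mpr
    linarith
  · have hhor : ∀ u : ℝ, -(1 / 2) ≤ u → u ≤ n - 1 / 2 → Real.exp (-C - κ) *
        Real.exp ((α + β) * Real.log n + (K + 1) * (n * Real.log n) + n * P + u * ℓ) ≤
        ‖weight M K ν νt n (u + (n * b : ℝ) * Complex.I)‖ := by
      intro u h1 h2
      have eu : (n : ℝ) * (u / n) = u := by field_simp
      have := top (u / n) (by rw [eu]; exact h1) (by rw [eu]; exact h2)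
      rw [eu] at this
      refine le_trans ?_ (this.trans (le_of_eq ?_))
      · refine mul_le_mul_of_nonneg_left (Real.exp_le_exp.mpr ?_) (Real.exp_pos _).le
        have h3 := hor (u / n) (by rw [le_div_iff₀ hnR]; linarith)
          (by rw [div_le_one hnR]; linarith)
        have : 0 ≤ n * (phase M K x0 ((u / n : ℝ) + b * Complex.I) - P) :=
          mul_nonneg hnR.le (by linarith)
        linarith
      · congr 2
        have : (n : ℂ) ≠ 0 := by exact_mod_cast hnR.ne'
        push_cast
        field_simp
    have corner : ∀ u : ℝ, -(1 / 2) ≤ u → u ≤ n - 1 / 2 → (u ≤ 0 ∨ n * ((1 + a) / 2) ≤ u) →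
        Real.exp (-C - κ) *
        Real.exp ((α + β) * Real.log n + (K + 1) * (n * Real.log n) + n * P + u * ℓ) *
        Real.exp (n * ε) ≤ ‖weight M K ν νt n (u + (n * b : ℝ) * Complex.I)‖ := by
      intro u h1 h2 h3
      have eu : (n : ℝ) * (u / n) = u := by field_simp
      have := top (u / n) (by rw [eu]; exact h1) (by rw [eu]; exact h2)
      rw [eu] at this
      refine le_trans ?_ (this.trans (le_of_eq ?_))
      · rw [mul_assoc, ← Real.exp_add]
        refine mul_le_mul_of_nonneg_left (Real.exp_le_exp.mpr ?_) (Real.exp_pos _).le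
        have h3 := hor' (u / n) (by rw [le_div_iff₀ hnR]; linarith)
          (by rw [div_le_one hnR]; linarith)
          (h3.imp (fun h => div_nonpos_of_nonpos_of_nonneg h hnR.le)
            fun h => by rw [le_div_iff₀ hnR]; linarith)
        have : n * ε ≤ n * (phase M K x0 ((u / n : ℝ) + b * Complex.I) - P) :=
          mul_le_mul_of_nonneg_left (by linarith) hnR.le
        linarith
      · congr 2
        have : (n : ℂ) ≠ 0 := by exact_mod_cast hnR.ne'
        push_cast
        field_simp
    rintro t (⟨ht, h1 | h1⟩ | ⟨ht, h1 | h1⟩)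
    · have := hhor t.re ht.1 ht.2
      rw [← norm_weight_conj] at this
      refine this.trans (le_of_eq ?_)
      congr 2
      apply Complex.ext <;> simp [h1]
    · refine (hhor t.re ht.1 ht.2).trans (le_of_eq ?_)
      congr 2
      apply Complex.ext <;> simp [h1]
    · have k1 := corner (-(1 / 2)) le_rfl (by nlinarith) (Or.inl (by norm_num))
      have k2 := norm_weight_left_le (K := K) hM ν νt hn (τ := t.im) (τ' := n * b)
        (by rw [abs_of_pos (mul_pos hnR hb)]; exact abs_le.mpr ht)
      rw [abs_of_pos (mul_pos hnR hb)] at k2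
      have et : (-(1 / 2) + t.im * Complex.I : ℂ) = t := by
        apply Complex.ext <;> simp [h1]
      rw [et] at k2
      have e0 : ((-(1 / 2) : ℝ) : ℂ) = -(1 / 2) := by push_cast; ring
      rw [e0] at k1
      have k3 := k1.trans k2
      have k4 : (1 + 2 * (n * b)) ^ ν 1 * ‖weight M K ν νt n t‖ ≤
          ‖weight M K ν νt n t‖ * Real.exp (n * ε) := by
        rw [mul_comm]
        refine mul_le_mul_of_nonneg_left ?_ (norm_nonneg _)
        rw [show (1 + 2 * (n * b)) = 1 + 2 * b * n by ring]
        exact hν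
      rw [h1]
      exact le_of_mul_le_mul_right (k3.trans k4) (Real.exp_pos _)
    · have k1 := corner (n - 1 / 2) (by nlinarith) le_rfl (Or.inr (by nlinarith))
      have k2 := norm_weight_right_le (M := M) hK ν νt hn (τ := t.im) (τ' := n * b)
        (by rw [abs_of_pos (mul_pos hnR hb)]; exact abs_le.mpr ht)
      rw [abs_of_pos (mul_pos hnR hb)] at k2
      have et : (n - 1 / 2 + t.im * Complex.I : ℂ) = t := by
        apply Complex.ext <;> simp [h1]
      rw [et] at k2
      have e0 : ((n - 1 / 2 : ℝ) : ℂ) = n - 1 / 2 := by push_cast; ring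
      rw [e0] at k1
      have k3 := k1.trans k2
      have k4 : (1 + 2 * (n * b)) ^ νt 1 * ‖weight M K ν νt n t‖ ≤
          ‖weight M K ν νt n t‖ * Real.exp (n * ε) := by
        rw [mul_comm]
        refine mul_le_mul_of_nonneg_left ?_ (norm_nonneg _)
        rw [show (1 + 2 * (n * b)) = 1 + 2 * b * n by ring]
        exact hνt
      rw [h1]
      exact le_of_mul_le_mul_right (k3.trans k4) (Real.exp_pos _)

/-- The function `|x|^(-1/2)`. -/
noncomputable def invSqrt (x : ℝ) : ℝ := (√|x|)⁻¹

theorem invSqrt_nonneg (x : ℝ) : 0 ≤ invSqrt x := by unfold invSqrt; positivity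

theorem invSqrt_mul (x y : ℝ) : invSqrt (x * y) = invSqrt x * invSqrt y := by
  rw [invSqrt, abs_mul, Real.sqrt_mul (abs_nonneg x), mul_inv, ← invSqrt, ← invSqrt]

theorem invSqrt_neg (x : ℝ) : invSqrt (-x) = invSqrt x := by rw [invSqrt, abs_neg, ← invSqrt]

theorem invSqrt_le_one {x : ℝ} (h : 1 ≤ |x|) : invSqrt x ≤ 1 :=
  inv_le_one_of_one_le₀ (Real.one_le_sqrt.mpr h)

theorem measurable_invSqrt : Measurable invSqrt := by
  unfold invSqrt
  fun_prop

theorem intervalIntegrable_invSqrt (p q : ℝ) : IntervalIntegrable invSqrt volume p q := by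
  have pos : ∀ q : ℝ, 0 ≤ q → IntervalIntegrable invSqrt volume 0 q := by
    intro q hq
    have h := intervalIntegral.intervalIntegrable_rpow' (a := 0) (b := q) (r := -(1 / 2))
      (by norm_num)
    refine h.congr fun x hx => ?_
    rw [uIoc_of_le hq] at hx
    rw [invSqrt, abs_of_pos hx.1, Real.sqrt_eq_rpow, Real.rpow_neg hx.1.le]
  have all : ∀ q : ℝ, IntervalIntegrable invSqrt volume 0 q := by
    intro q
    rcases le_total 0 q with hq | hq
    · exact pos q hq
    · have h := (IntervalIntegrable.iff_comp_neg).mp (pos (-q) (by linarith))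
      simp only [neg_neg, neg_zero, invSqrt_neg] at h
      exact h
  exact (all p).symm.trans (all q)

theorem intervalIntegrable_invSqrt_sub (c p q : ℝ) :
    IntervalIntegrable (fun x => invSqrt (x - c)) volume p q := by
  simpa using (intervalIntegrable_invSqrt (p - c) (q - c)).comp_sub_right c

theorem integral_invSqrt_sub_le {n : ℕ} (hn : 0 < n) (a : ℝ) :
    ∫ u in (-(1 / 2) : ℝ)..(n - 1 / 2), invSqrt (u - n * a) ≤
      √n * ∫ w in (-1 : ℝ)..1, invSqrt (w - a) := by
  have hnR : (1 : ℝ) ≤ n := by exact_mod_cast hn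
  have e : ∀ u : ℝ, invSqrt (u - n * a) = (√n)⁻¹ * invSqrt (u / n - a) := by
    intro u
    rw [show u - n * a = n * (u / n - a) by field_simp, invSqrt_mul]
    congr 1
    rw [invSqrt, abs_of_nonneg (by linarith)]
  simp only [e]
  rw [intervalIntegral.integral_const_mul,
    intervalIntegral.integral_comp_div (fun w => invSqrt (w - a)) (by positivity), smul_eq_mul,
    ← mul_assoc]
  have hs : (√n)⁻¹ * (n : ℝ) = √n := by
    rw [inv_mul_eq_div, Real.div_sqrt]
  rw [hs]
  refine mul_le_mul_of_nonneg_left ?_ (Real.sqrt_nonneg _)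
  refine intervalIntegral.integral_mono_interval ?_ ?_ ?_
    (Eventually.of_forall fun w => invSqrt_nonneg _) (intervalIntegrable_invSqrt_sub a _ _)
  · rw [le_div_iff₀ (by linarith)]; linarith
  · exact div_le_div_of_nonneg_right (by linarith) (by linarith)
  · rw [div_le_one (by linarith)]; linarith

theorem inv_norm_le_invSqrt_mul {z : ℂ} (h1 : z.re ≠ 0) (h2 : z.im ≠ 0) :
    ‖z‖⁻¹ ≤ invSqrt z.re * invSqrt z.im := by
  rw [invSqrt, invSqrt, ← mul_inv, ← Real.sqrt_mul (abs_nonneg _)]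
  have p1 := abs_pos.mpr h1
  have p2 := abs_pos.mpr h2
  apply inv_anti₀ (Real.sqrt_pos.mpr (mul_pos p1 p2))
  rw [Real.sqrt_le_left (norm_nonneg _), sq]
  exact mul_le_mul (Complex.abs_re_le_norm z) (Complex.abs_im_le_norm z) (abs_nonneg _)
    (norm_nonneg _)

theorem norm_rectIntegral_le {f : ℂ → ℂ} {n : ℕ} (hn : 0 < n) {a b v B : ℝ} (ha : 0 < a)
    (ha1 : a < 1) (hna : 1 ≤ n * (1 - a)) (hb : 0 < b) (hv : |v| ≠ b) (hB : 0 ≤ B)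
    (hf : ∀ t ∈ rectBoundary (-(1 / 2)) (n - 1 / 2) (-(n * b)) (n * b),
      ‖f t‖ ≤ B * ‖t - n * (a + v * Complex.I)‖⁻¹) :
    ‖rectIntegral f (-(1 / 2)) (n - 1 / 2) (-(n * b)) (n * b)‖ ≤
      B * (((∫ w in (-1 : ℝ)..1, invSqrt (w - a)) + 2 * b / a + 4 * b / (1 - a)) *
        (invSqrt (v - b) + invSqrt (v + b) + 1)) := by
  set Q := ∫ w in (-1 : ℝ)..1, invSqrt (w - a) with hQ
  have hQ0 : 0 ≤ Q := intervalIntegral.integral_nonneg (by norm_num) fun w _ => invSqrt_nonneg _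
  have hnR : (1 : ℝ) ≤ n := by exact_mod_cast hn
  have hn0 : (0 : ℝ) < n := by linarith
  have hnb : -(n * b) ≤ n * b := by nlinarith
  have hn2 : (-(1 / 2) : ℝ) ≤ n - 1 / 2 := by linarith
  have hor : ∀ w : ℝ, v - w ≠ 0 → (∀ u : ℝ, u ∈ Icc (-(1 / 2) : ℝ) (n - 1 / 2) →
      ‖f (u + (n * w : ℝ) * Complex.I)‖ ≤
        B * ‖u + (n * w : ℝ) * Complex.I - n * (a + v * Complex.I)‖⁻¹) →
      ‖∫ u in (-(1 / 2) : ℝ)..(n - 1 / 2), f (u + (n * w : ℝ) * Complex.I)‖ ≤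
        B * (Q * invSqrt (v - w)) := by
    intro w hw hfw
    have hae : ∀ᵐ u : ℝ, u ≠ n * a := compl_mem_ae_iff.mpr (measure_singleton (n * a))
    have step := intervalIntegral.norm_integral_le_of_norm_le (μ := volume)
      (f := fun u : ℝ => f (u + (n * w : ℝ) * Complex.I))
      (g := fun u => B * invSqrt (n * (w - v)) * invSqrt (u - n * a)) hn2 (by
        filter_upwards [hae] with u hu hmem
        refine (hfw u ⟨hmem.1.le, hmem.2⟩).trans ?_
        rw [mul_assoc]
        refine mul_le_mul_of_nonneg_left ?_ hB
        have hre : ((u : ℂ) + (n * w : ℝ) * Complex.I - n * (a + v * Complex.I)).re =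
          u - n * a := by simp
        have him : ((u : ℂ) + (n * w : ℝ) * Complex.I - n * (a + v * Complex.I)).im =
          n * (w - v) := by simp; ring
        have := inv_norm_le_invSqrt_mul
          (z := (u : ℂ) + (n * w : ℝ) * Complex.I - n * (a + v * Complex.I))
          (by rw [hre]; exact sub_ne_zero.mpr hu)
          (by rw [him]; exact mul_ne_zero hn0.ne' (by contrapose! hw; linarith))
        rw [hre, him, mul_comm (invSqrt _)] at this
        exact this) ((intervalIntegrable_invSqrt_sub _ _ _).const_mul _)
    refine step.trans ?_
    rw [intervalIntegral.integral_const_mul, mul_assoc]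
    refine mul_le_mul_of_nonneg_left ?_ hB
    refine (mul_le_mul_of_nonneg_left (integral_invSqrt_sub_le hn a) (invSqrt_nonneg _)).trans
      (le_of_eq ?_)
    rw [invSqrt_mul, ← hQ, ← invSqrt_neg (w - v), neg_sub,
      show invSqrt n = (√(n : ℝ))⁻¹ by rw [invSqrt, abs_of_pos hn0]]
    have : √(n : ℝ) ≠ 0 := (Real.sqrt_pos.mpr hn0).ne'
    field_simp
  have ver : ∀ u d : ℝ, 0 < d → d ≤ |u - n * a| → (∀ τ : ℝ, τ ∈ Icc (-(n * b)) (n * b) →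
      ‖f (u + τ * Complex.I)‖ ≤ B * ‖u + τ * Complex.I - n * (a + v * Complex.I)‖⁻¹) →
      ‖∫ τ in (-(n * b))..(n * b), f (u + τ * Complex.I)‖ ≤ B * (2 * (n * b) / d) := by
    intro u d hd hud hfu
    have := intervalIntegral.norm_integral_le_of_norm_le_const (a := -(n * b)) (b := n * b)
      (f := fun τ : ℝ => f (u + τ * Complex.I)) (C := B * d⁻¹) fun τ hτ => by
        rw [uIoc_of_le hnb] at hτ
        refine (hfu τ ⟨hτ.1.le, hτ.2⟩).trans (mul_le_mul_of_nonneg_left (inv_anti₀ hd ?_) hB)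
        refine hud.trans (le_trans (le_of_eq ?_) (Complex.abs_re_le_norm _))
        simp
    refine this.trans (le_of_eq ?_)
    rw [abs_of_nonneg (by linarith)]
    ring
  have b1 := hor (-b) (fun h => hv (by rw [show v = -b by linarith, abs_neg, abs_of_pos hb]))
    fun u hu => hf _ (by rw [mul_neg]; exact bottom_mem hnb hu)
  have b2 := hor b (fun h => hv (by rw [show v = b by linarith, abs_of_pos hb]))
    fun u hu => hf _ (top_mem hnb hu)
  have b3 := ver (n - 1 / 2) (n * (1 - a) / 2) (by linarith)
    (by rw [abs_of_nonneg (by linarith)]; linarith) fun τ hτ => hf _ (right_mem hn2 hτ)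
  have b4 := ver (-(1 / 2)) (n * a) (by positivity)
    (by rw [abs_of_neg (by nlinarith)]; linarith) fun τ hτ => hf _ (left_mem hn2 hτ)
  rw [mul_neg, sub_neg_eq_add] at b1
  have e3 : 2 * (n * b) / (n * (1 - a) / 2) = 4 * b / (1 - a) := by
    have : 1 - a ≠ 0 := by linarith
    field_simp
    ring
  have e4 : 2 * (n * b) / (n * a) = 2 * b / a := by field_simp
  rw [e3] at b3
  rw [e4] at b4
  have i1 := invSqrt_nonneg (v - b)
  have i2 := invSqrt_nonneg (v + b)
  have p1 : 0 ≤ 2 * b / a := by positivity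
  have p2 : 0 ≤ 4 * b / (1 - a) := div_nonneg (by linarith) (by linarith)
  rw [rectIntegral]
  refine (norm_sub_le _ _).trans ((add_le_add ((norm_add_le _ _).trans (add_le_add
    (norm_sub_le _ _) le_rfl)) le_rfl).trans ?_)
  rw [norm_mul, norm_mul, Complex.norm_I, one_mul, one_mul]
  refine (add_le_add (add_le_add (add_le_add b1 b2) b3) b4).trans ?_
  rw [← mul_add, ← mul_add, ← mul_add]
  refine mul_le_mul_of_nonneg_left ?_ hB
  nlinarith [mul_nonneg p1 i1, mul_nonneg p1 i2, mul_nonneg p2 i1, mul_nonneg p2 i2]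

theorem integrable_bounded_mul_invSqrt {w : ℝ → ℝ} (hw : Integrable w) {B : ℝ}
    (hB : ∀ v, |w v| ≤ B) (b : ℝ) : Integrable fun v => w v * invSqrt (v - b) := by
  have h1 : Integrable ((Ioc (b - 1) (b + 1)).indicator fun v => invSqrt (v - b)) := by
    rw [integrable_indicator_iff measurableSet_Ioc]
    have := intervalIntegrable_invSqrt_sub b (b - 1) (b + 1)
    rwa [intervalIntegrable_iff_integrableOn_Ioc_of_le (by linarith)] at this
  refine ((h1.const_mul B).add hw.abs).mono' (hw.aestronglyMeasurable.mul
    (measurable_invSqrt.comp (measurable_id.sub_const b)).aestronglyMeasurable)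
    (Eventually.of_forall fun v => ?_)
  have h0 := invSqrt_nonneg (v - b)
  rw [norm_mul, Real.norm_eq_abs, Real.norm_eq_abs, abs_of_nonneg h0]
  simp only [Pi.add_apply, indicator]
  split_ifs with h
  · have := mul_le_mul_of_nonneg_right (hB v) h0
    have := abs_nonneg (w v)
    linarith
  · have : 1 ≤ |v - b| := by
      rw [mem_Ioc, not_and_or, not_lt, not_le] at h
      rcases h with h | h
      · rw [abs_of_nonpos (by linarith)]; linarith
      · rw [abs_of_nonneg (by linarith)]; linarith
    have := mul_le_mul_of_nonneg_left (invSqrt_le_one this) (abs_nonneg (w v))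
    linarith

theorem exists_pow_mul_exp_le (D : ℕ) {c : ℝ} (hc : 0 < c) :
    ∃ A : ℝ, 0 ≤ A ∧ ∀ v : ℝ, (1 + |v|) ^ D * Real.exp (-(c * |v|)) ≤
      A * Real.exp (-(c / 2 * |v|)) := by
  refine ⟨D.factorial / (c / 2) ^ D * Real.exp (c / 2), by positivity, fun v => ?_⟩
  have h := Real.pow_div_factorial_le_exp (c / 2 * (1 + |v|)) (by positivity) D
  rw [mul_pow, div_le_iff₀ (by positivity), mul_comm, ← le_div_iff₀ (by positivity)] at h
  refine (mul_le_mul_of_nonneg_right h (Real.exp_pos _).le).trans (le_of_eq ?_)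
  rw [show Real.exp (c / 2 * (1 + |v|)) = Real.exp (c / 2) * Real.exp (c / 2 * |v|) by
      rw [← Real.exp_add]; ring_nf,
    show Real.exp (-(c * |v|)) = Real.exp (-(c / 2 * |v|)) * (Real.exp (c / 2 * |v|))⁻¹ by
      rw [← Real.exp_neg, ← Real.exp_add]; ring_nf]
  have := (Real.exp_pos (c / 2 * |v|)).ne'
  field_simp

/-- The majorant of the remainder on the vertical contour. -/
noncomputable def majorant (M K : ℕ) (x0 a b : ℝ) (D n : ℕ) (v : ℝ) : ℝ :=
  (1 + |v|) ^ D *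
    Real.exp (-(n * (phase M K x0 (a + b * Complex.I) - phase M K x0 (a + v * Complex.I)))) *
    (invSqrt (v - b) + invSqrt (v + b) + 1)

theorem IsSaddle.integrable_majorant {M K : ℕ} {x0 a b : ℝ} (h : IsSaddle M K x0 a b) (D : ℕ) :
    (∀ n : ℕ, 1 ≤ n → Integrable (majorant M K x0 a b D n)) ∧
      Tendsto (fun n : ℕ => ∫ v, majorant M K x0 a b D n v) atTop (𝓝 0) := by
  obtain ⟨hlt, c, C, hc, hC⟩ := h.vertical
  obtain ⟨ha, ha1, hb, -, -⟩ := h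
  have hcont := continuous_phase_vertical M K x0 ha ha1
  set P := phase M K x0 (a + b * Complex.I) with hP
  set q : ℝ → ℝ := fun v => phase M K x0 (a + v * Complex.I) with hq
  have hle : ∀ v, q v ≤ P := by
    intro v
    by_cases hv : |v| = b
    · rcases abs_choice v with h' | h' <;> rw [h'] at hv
      · rw [hq, hP, ← hv]
      · rw [hq, hP, ← hv, phase_conj M K x0 a v ha ha1]
    · exact (hlt v hv).le
  have hcoef : ∀ v, 0 ≤ invSqrt (v - b) + invSqrt (v + b) + 1 := fun v => by
    linarith [invSqrt_nonneg (v - b), invSqrt_nonneg (v + b)]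
  obtain ⟨A, hA, hAb⟩ := exists_pow_mul_exp_le D hc
  set w : ℝ → ℝ := fun v => Real.exp C * A * Real.exp (-(c / 2 * |v|)) with hw
  have hwi : Integrable w := (integrable_exp_neg_mul_abs (half_pos hc)).const_mul _
  have hwb : ∀ v, |w v| ≤ Real.exp C * A := by
    intro v
    rw [hw, abs_of_nonneg (by positivity)]
    refine mul_le_of_le_one_right (by positivity) (Real.exp_le_one_iff.mpr ?_)
    have := mul_nonneg (half_pos hc).le (abs_nonneg v)
    linarith
  have hdom : Integrable fun v => w v * (invSqrt (v - b) + invSqrt (v + b) + 1) := by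
    have h1 := integrable_bounded_mul_invSqrt hwi hwb b
    have h2 := integrable_bounded_mul_invSqrt hwi hwb (-b)
    refine ((h1.add h2).add hwi).congr (Eventually.of_forall fun v => ?_)
    simp only [Pi.add_apply, sub_neg_eq_add]
    ring
  have hmeas : ∀ n : ℕ, AEStronglyMeasurable (majorant M K x0 a b D n) := by
    intro n
    have m1 : Measurable fun v : ℝ => (1 + |v|) ^ D * Real.exp (-(n * (P - q v))) :=
      Continuous.measurable (by fun_prop)
    have m2 : Measurable fun v : ℝ => invSqrt (v - b) + invSqrt (v + b) + 1 :=
      ((measurable_invSqrt.comp (measurable_id.sub_const b)).add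
        (measurable_invSqrt.comp (measurable_id.add_const b))).add_const 1
    exact (m1.mul m2).aestronglyMeasurable
  have hbound : ∀ n : ℕ, 1 ≤ n → ∀ v, ‖majorant M K x0 a b D n v‖ ≤
      w v * (invSqrt (v - b) + invSqrt (v + b) + 1) := by
    intro n hn v
    have hn1 : (1 : ℝ) ≤ n := by exact_mod_cast hn
    have h0 := hcoef v
    rw [Real.norm_eq_abs, majorant, abs_of_nonneg (by positivity)]
    refine mul_le_mul_of_nonneg_right ?_ h0
    have h1 : Real.exp (-(n * (P - q v))) ≤ Real.exp C * Real.exp (-(c * |v|)) := by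
      rw [← Real.exp_add]
      apply Real.exp_le_exp.mpr
      have h2 := hC v
      have h3 : P - q v ≤ n * (P - q v) := le_mul_of_one_le_left (by linarith [hle v]) hn1
      change q v ≤ P + C - c * |v| at h2
      linarith
    calc (1 + |v|) ^ D * Real.exp (-(n * (P - q v)))
        ≤ (1 + |v|) ^ D * (Real.exp C * Real.exp (-(c * |v|))) := by gcongr
      _ = Real.exp C * ((1 + |v|) ^ D * Real.exp (-(c * |v|))) := by ring
      _ ≤ Real.exp C * (A * Real.exp (-(c / 2 * |v|))) := mul_le_mul_of_nonneg_left (hAb v) (Real.exp_pos C).le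
      _ = w v := by rw [hw]; ring
  refine ⟨fun n hn => hdom.mono' (hmeas n) (Eventually.of_forall (hbound n hn)), ?_⟩
  rw [← integral_zero ℝ ℝ (μ := volume)]
  refine tendsto_integral_filter_of_dominated_convergence _ (Eventually.of_forall hmeas)
    ((eventually_ge_atTop 1).mono fun n hn => Eventually.of_forall (hbound n hn)) hdom ?_
  have hae : ∀ᵐ v : ℝ, v ∉ ({b, -b} : Set ℝ) :=
    compl_mem_ae_iff.mpr ((Set.toFinite _).measure_zero _)
  filter_upwards [hae] with v hv
  simp only [mem_insert_iff, mem_singleton_iff, not_or] at hv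
  have hvb : |v| ≠ b := fun h => by
    rcases abs_choice v with h' | h' <;> rw [h'] at h
    · exact hv.1 h
    · exact hv.2 (by linarith)
  have t1 : Tendsto (fun n : ℕ => Real.exp (-(n * (P - q v)))) atTop (𝓝 0) :=
    Real.tendsto_exp_neg_atTop_nhds_zero.comp
      (tendsto_natCast_atTop_atTop.atTop_mul_const (sub_pos.mpr (hlt v hvb)))
  have := (t1.const_mul ((1 + |v|) ^ D)).mul_const (invSqrt (v - b) + invSqrt (v + b) + 1)
  rw [mul_zero, zero_mul] at this
  exact this

theorem WeightBounds.norm_remainder_le {M K : ℕ} {ν νt : ℕ → ℕ} {x0 a b : ℝ} {N : ℕ → ℝ}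
    {C c : ℝ} {D n : ℕ} (h : WeightBounds M K ν νt x0 a b N C c D n) (hC : 0 ≤ C) (hc : 0 < c)
    (hn : 0 < n) (ha : 0 < a) (ha1 : a < 1) (hb : 0 < b) (hna : 1 ≤ n * (1 - a)) {B x y : ℝ}
    (hB : 0 ≤ B)
    (hx : |Real.log x - (((M : ℝ) - K) * Real.log n + Real.log x0)| ≤ B / n)
    (hy : |Real.log y - (((M : ℝ) - K) * Real.log n + Real.log x0)| ≤ B / n) {v : ℝ}
    (hv : |v| ≠ b) :
    ‖remainder M K ν νt n x y (n * b) (n * (a + v * Complex.I))‖ ≤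
      Real.exp (-(((M : ℝ) - K) * Real.log n + Real.log x0)) * (C * c⁻¹ * Real.exp (3 * B) *
        ((∫ w in (-1 : ℝ)..1, invSqrt (w - a)) + 2 * b / a + 4 * b / (1 - a))) *
        majorant M K x0 a b D n v := by
  have hnR : (1 : ℝ) ≤ n := by exact_mod_cast hn
  have hn0 : (0 : ℝ) < n := by linarith
  set ℓ := ((M : ℝ) - K) * Real.log n + Real.log x0 with hℓ
  have hBn : 0 ≤ B / n := by positivity
  have hnB : n * (B / n) = B := by field_simp
  have e1 : ‖Complex.exp (-(n * (a + v * Complex.I) + 1) * Real.log y)‖ ≤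
      Real.exp (-((n * a + 1) * ℓ)) * Real.exp (2 * B) := by
    rw [Complex.norm_exp, Complex.re_mul_ofReal, ← Real.exp_add]
    apply Real.exp_le_exp.mpr
    have hre : (-((n : ℂ) * (a + v * Complex.I) + 1)).re = -(n * a + 1) := by simp
    rw [hre]
    have h1 := (abs_le.mp hy).1
    have h2 : (n * a + 1) * (ℓ - Real.log y) ≤ (n * a + 1) * (B / n) :=
      mul_le_mul_of_nonneg_left (by linarith) (by positivity)
    have h3 : n * a * (B / n) ≤ B := by
      calc n * a * (B / n) = a * (n * (B / n)) := by ring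
        _ = a * B := by rw [hnB]
        _ ≤ B := mul_le_of_le_one_left hB ha1.le
    have h4 : B / n ≤ B := div_le_self hB hnR
    linarith
  have e2 : ∀ t ∈ rectBoundary (-(1 / 2)) (n - 1 / 2) (-(n * b)) (n * b),
      ‖Complex.exp (t * Real.log x) / (weight M K ν νt n t *
        (t - n * (a + v * Complex.I)))‖ ≤
      (c⁻¹ * Real.exp B * Real.exp (-N n)) * ‖t - n * (a + v * Complex.I)‖⁻¹ := by
    intro t ht
    have hre : |t.re| ≤ n := by
      rcases ht with ⟨ht, -⟩ | ⟨-, ht | ht⟩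
      · exact abs_le.mpr ⟨by linarith [ht.1], by linarith [ht.2]⟩
      · rw [ht, abs_neg, abs_of_pos] <;> linarith
      · rw [ht, abs_of_pos] <;> linarith
    have hw := h.boundary t ht
    rw [← hℓ, Real.exp_add] at hw
    rw [← div_div, norm_div, div_eq_mul_inv _ ‖t - _‖]
    refine mul_le_mul_of_nonneg_right ?_ (inv_nonneg.mpr (norm_nonneg _))
    have hpos : 0 < c * (Real.exp (N n) * Real.exp (t.re * ℓ)) := by positivity
    rw [norm_div, div_le_iff₀ (hpos.trans_le hw), Complex.norm_exp, Complex.re_mul_ofReal]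
    have h1 : Real.exp (t.re * Real.log x) ≤ Real.exp B * Real.exp (t.re * ℓ) := by
      rw [← Real.exp_add]
      apply Real.exp_le_exp.mpr
      have : t.re * (Real.log x - ℓ) ≤ n * (B / n) := by
        refine (le_abs_self _).trans ?_
        rw [abs_mul]
        exact mul_le_mul hre hx (abs_nonneg _) hn0.le
      linarith
    refine h1.trans (le_trans (le_of_eq ?_) (mul_le_mul_of_nonneg_left hw (by positivity)))
    rw [Real.exp_neg]
    have := (Real.exp_pos (N n)).ne'
    field_simp
  have e3 := norm_rectIntegral_le hn ha ha1 hna hb hv (by positivity) e2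
  set Q := (∫ w in (-1 : ℝ)..1, invSqrt (w - a)) + 2 * b / a + 4 * b / (1 - a) with hQ
  rw [remainder, norm_mul, norm_mul]
  have hv' := h.vertical v
  rw [← hℓ] at hv'
  have hE0 : 0 ≤ Real.exp (-(n * (phase M K x0 (a + b * Complex.I) -
    phase M K x0 (a + v * Complex.I)))) := (Real.exp_pos _).le
  refine (mul_le_mul (mul_le_mul hv' e1 (norm_nonneg _) (by positivity)) e3 (norm_nonneg _)
    (by positivity)).trans (le_of_eq ?_)
  rw [majorant]
  have k1 : Real.exp (N n + n * a * ℓ) * Real.exp (-((n * a + 1) * ℓ)) * Real.exp (2 * B) *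
      (Real.exp B * Real.exp (-N n)) = Real.exp (-ℓ) * Real.exp (3 * B) := by
    rw [← Real.exp_add, ← Real.exp_add, ← Real.exp_add, ← Real.exp_add, ← Real.exp_add]
    ring_nf
  linear_combination (C * (1 + |v|) ^ D * Real.exp (-(n * (phase M K x0 (a + b * Complex.I) -
    phase M K x0 (a + v * Complex.I)))) * c⁻¹ * Q *
    (invSqrt (v - b) + invSqrt (v + b) + 1)) * k1

theorem IsSaddle.exists_norm_KnMK_sub_le {M K : ℕ} (hM : 1 ≤ M) (hK : 1 ≤ K) {ν : ℕ → ℕ}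
    (νt : ℕ → ℕ) (hν0 : ν 0 = 0) {x0 a b : ℝ} (h : IsSaddle M K x0 a b) {B : ℝ} (hB : 0 ≤ B) :
    ∃ E : ℕ → ℝ, Tendsto E atTop (𝓝 0) ∧ ∀ᶠ n : ℕ in atTop, ∀ x y : ℝ,
      |Real.log x - (((M : ℝ) - K) * Real.log n + Real.log x0)| ≤ B / n →
      |Real.log y - (((M : ℝ) - K) * Real.log n + Real.log x0)| ≤ B / n →
      ‖KnMK M K ν νt n x y - 1 / (2 * Real.pi) *
        ∫ σ in -(n * b)..(n * b), residue x y ((n * a : ℝ) + σ * Complex.I)‖ ≤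
      n * Real.exp (-(((M : ℝ) - K) * Real.log n + Real.log x0)) * E n := by
  obtain ⟨N, C, c, D, hC, hc, hW⟩ := h.exists_weightBounds hM hK νt hν0
  obtain ⟨hint, hlim⟩ := h.integrable_majorant D
  obtain ⟨ha, ha1, hb, -, -⟩ := h
  set A := C * c⁻¹ * Real.exp (3 * B) *
    ((∫ w in (-1 : ℝ)..1, invSqrt (w - a)) + 2 * b / a + 4 * b / (1 - a)) with hA
  refine ⟨fun n => A * ∫ v, majorant M K x0 a b D n v, by simpa using hlim.const_mul A, ?_⟩
  have tn : Tendsto (fun n : ℕ => (n : ℝ)) atTop atTop := tendsto_natCast_atTop_atTop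
  filter_upwards [hW, eventually_gt_atTop 0,
    (tn.atTop_mul_const (sub_pos.mpr ha1)).eventually_ge_atTop 1] with n hW hn hna x y hx hy
  have hnR : (0 : ℝ) < n := by exact_mod_cast hn
  set ℓ := ((M : ℝ) - K) * Real.log n + Real.log x0 with hℓ
  have hg : Integrable fun σ : ℝ => Real.exp (-ℓ) * A * majorant M K x0 a b D n (σ / n) :=
    ((hint n hn).comp_div hnR.ne').const_mul _
  refine (norm_KnMK_sub_le hM hK νt hν0 hn x y (mul_pos hnR hb) (mul_pos hnR ha) (by linarith) hg
    fun σ _ hσ => ?_).trans (le_of_eq ?_)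
  · have hv : |σ / n| ≠ b := by
      rw [abs_div, abs_of_pos hnR, Ne, div_eq_iff hnR.ne', mul_comm]
      exact hσ
    have := hW.norm_remainder_le hC hc hn ha ha1 hb hna hB hx hy hv
    rw [← hℓ, ← hA] at this
    convert this using 3
    have : (n : ℂ) ≠ 0 := by exact_mod_cast hnR.ne'
    push_cast
    field_simp
  · rw [integral_const_mul, Measure.integral_comp_div (fun v => majorant M K x0 a b D n v),
      smul_eq_mul, abs_of_pos hnR]
    ring

theorem integral_exp_mul_I_mul (T L : ℝ) :
    ∫ σ in -T..T, Complex.exp (((σ * L : ℝ) : ℂ) * Complex.I) = 2 * T * Real.sinc (T * L) := by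
  rcases eq_or_ne L 0 with rfl | hL
  · simp
    ring
  · rw [intervalIntegral.integral_comp_mul_right
      (fun t : ℝ => Complex.exp ((t : ℂ) * Complex.I)) hL, neg_mul, integral_exp_mul_I_eq_sinc]
    have : (L : ℂ) ≠ 0 := by exact_mod_cast hL
    rw [Complex.real_smul]
    push_cast
    field_simp

theorem integral_residue (x y A T : ℝ) :
    1 / (2 * Real.pi) * ∫ σ in -T..T, residue x y ((A : ℝ) + σ * Complex.I) =
      ((Real.exp (A * (Real.log x - Real.log y) - Real.log y) * (T / Real.pi) *
        Real.sinc (T * (Real.log x - Real.log y)) : ℝ) : ℂ) := by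
  set L := Real.log x - Real.log y with hL
  have h : ∀ σ : ℝ, residue x y ((A : ℝ) + σ * Complex.I) =
      (Real.exp (A * L - Real.log y) : ℂ) * Complex.exp (((σ * L : ℝ) : ℂ) * Complex.I) := by
    intro σ
    rw [residue, Complex.ofReal_exp, ← Complex.exp_add, ← Complex.exp_add, hL]
    congr 1
    push_cast
    ring
  simp_rw [h]
  rw [intervalIntegral.integral_const_mul, integral_exp_mul_I_mul]
  have : (Real.pi : ℂ) ≠ 0 := by exact_mod_cast Real.pi_ne_zero
  push_cast
  field_simp

theorem tendsto_mul_log_one_add_div {ι : Type*} {l : Filter ι} {N g : ι → ℝ} {g0 : ℝ}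
    (hN : Tendsto N l atTop) (hg : Tendsto g l (𝓝 g0)) :
    Tendsto (fun i => N i * Real.log (1 + g i / N i)) l (𝓝 g0) := by
  have hd : Tendsto (fun i => g i / N i) l (𝓝 0) := hg.div_atTop hN
  have hb : Tendsto (fun i => |g i| * |g i / N i| * 2) l (𝓝 0) := by
    simpa using (hg.abs.mul hd.abs).mul_const 2
  have hz : Tendsto (fun i => N i * Real.log (1 + g i / N i) - g i) l (𝓝 0) := by
    refine squeeze_zero_norm' ?_ hb
    filter_upwards [hN.eventually_ge_atTop 1,
      hd.abs.eventually_lt_const (show |(0 : ℝ)| < 1 / 2 by norm_num)] with i hi hi2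
    have hi0 : 0 < N i := by linarith
    have h := Real.abs_log_sub_add_sum_range_le (x := -(g i / N i))
      (by rw [abs_neg]; linarith) 1
    simp only [Finset.sum_range_one, zero_add, pow_one, Nat.cast_zero, div_one, sub_neg_eq_add,
      abs_neg] at h
    have e : N i * Real.log (1 + g i / N i) - g i =
        N i * (-(g i / N i) + Real.log (1 + g i / N i)) := by field_simp; ring
    rw [e, Real.norm_eq_abs, abs_mul, abs_of_pos hi0]
    have h2 : |g i / N i| ^ (1 + 1) / (1 - |g i / N i|) ≤ |g i / N i| ^ 2 * 2 := by
      rw [div_le_iff₀ (by linarith)]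
      nlinarith [sq_nonneg (g i / N i), sq_abs (g i / N i)]
    calc N i * |-(g i / N i) + Real.log (1 + g i / N i)| ≤ N i * (|g i / N i| ^ 2 * 2) :=
          mul_le_mul_of_nonneg_left (h.trans h2) hi0.le
      _ = |g i| * |g i / N i| * 2 := by
          rw [abs_div, abs_of_pos hi0]; field_simp
  simpa using hz.add hg

theorem log_scaled {m : ℤ} {n x0 ρ ξ : ℝ} (hn : 0 < n) (hx0 : 0 < x0) (hρ : 0 < ρ)
    (h : 0 < 1 + ξ / (ρ * x0) / n) :
    Real.log (n ^ m * (x0 + ξ / (n * ρ))) =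
      m * Real.log n + Real.log x0 + Real.log (1 + ξ / (ρ * x0) / n) := by
  have e : x0 + ξ / (n * ρ) = x0 * (1 + ξ / (ρ * x0) / n) := by field_simp
  rw [e, Real.log_mul (zpow_pos hn m).ne' (mul_pos hx0 h).ne', Real.log_mul hx0.ne' h.ne',
    Real.log_zpow]
  ring

theorem zpow_sub_one_eq_exp {m : ℤ} {n x0 : ℝ} (hn : 0 < n) (hx0 : 0 < x0) :
    n ^ (m - 1) = Real.exp (m * Real.log n + Real.log x0) / (n * x0) := by
  rw [Real.exp_add, Real.exp_log hx0, mul_comm (m : ℝ), Real.exp_mul, Real.exp_log hn,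
    Real.rpow_intCast, zpow_sub_one₀ hn.ne']
  field_simp

theorem ksin_eq_sinc (ξ η : ℝ) : Ksin ξ η = Real.sinc (Real.pi * (ξ - η)) := by
  rw [Ksin]
  split_ifs with h
  · simp [h]
  · rw [Real.sinc_of_ne_zero (mul_ne_zero Real.pi_ne_zero (sub_ne_zero.mpr h))]

theorem IsSaddle.tendsto_scaled_KnMK {M K : ℕ} (hM : 1 ≤ M) (hK : 1 ≤ K) {ν : ℕ → ℕ}
    (νt : ℕ → ℕ) (hν0 : ν 0 = 0) {x0 a b ρ c : ℝ} (hx0 : 0 < x0) (hρ : 0 < ρ)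
    (h : IsSaddle M K x0 a b) (hbρ : b = Real.pi * ρ * x0) (hab : a = b * c)
    {l : Filter (ℕ × (ℝ × ℝ))} {ξ₀ η₀ : ℝ} (hn : Tendsto Prod.fst l atTop)
    (hξ : Tendsto (fun q : ℕ × (ℝ × ℝ) => q.2.1) l (𝓝 ξ₀))
    (hη : Tendsto (fun q : ℕ × (ℝ × ℝ) => q.2.2) l (𝓝 η₀)) :
    Tendsto (fun q : ℕ × (ℝ × ℝ) =>
      ((Real.exp (-Real.pi * (q.2.1 - q.2.2) * c) *
          ((q.1 : ℝ) ^ ((M : ℤ) - (K : ℤ) - 1) / ρ) : ℝ) : ℂ) *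
        KnMK M K ν νt q.1
          ((q.1 : ℝ) ^ ((M : ℤ) - (K : ℤ)) * (x0 + q.2.1 / (q.1 * ρ)))
          ((q.1 : ℝ) ^ ((M : ℤ) - (K : ℤ)) * (x0 + q.2.2 / (q.1 * ρ))))
      l (𝓝 ((Ksin ξ₀ η₀ : ℝ) : ℂ)) := by
  have hN : Tendsto (fun q : ℕ × (ℝ × ℝ) => (q.1 : ℝ)) l atTop :=
    tendsto_natCast_atTop_atTop.comp hn
  have hu := tendsto_mul_log_one_add_div hN (hξ.div_const (ρ * x0))
  have hv := tendsto_mul_log_one_add_div hN (hη.div_const (ρ * x0))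
  set B := |ξ₀ / (ρ * x0)| + |η₀ / (ρ * x0)| + 1 with hB
  obtain ⟨E, hE, hK'⟩ := h.exists_norm_KnMK_sub_le hM hK νt hν0 (B := B) (by positivity)
  set u : ℕ × (ℝ × ℝ) → ℝ := fun q => Real.log (1 + q.2.1 / (ρ * x0) / q.1) with hu_def
  set v : ℕ × (ℝ × ℝ) → ℝ := fun q => Real.log (1 + q.2.2 / (ρ * x0) / q.1) with hv_def
  have hv0 : Tendsto v l (𝓝 0) := by
    have : Tendsto (fun q : ℕ × (ℝ × ℝ) => 1 + q.2.2 / (ρ * x0) / q.1) l (𝓝 1) := by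
      simpa using ((hη.div_const (ρ * x0)).div_atTop hN).const_add 1
    have h1 := (Real.continuousAt_log one_ne_zero).tendsto.comp this
    rwa [Real.log_one] at h1
  have hG : Tendsto (fun q : ℕ × (ℝ × ℝ) =>
      Real.exp (-Real.pi * (q.2.1 - q.2.2) * c) / (ρ * x0)) l
      (𝓝 (Real.exp (-Real.pi * (ξ₀ - η₀) * c) / (ρ * x0))) :=
    ((Real.continuous_exp.tendsto _).comp (((hξ.sub hη).const_mul _).mul_const _)).div_const _
  have hL : Tendsto (fun q : ℕ × (ℝ × ℝ) => q.1 * u q - q.1 * v q) l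
      (𝓝 (ξ₀ / (ρ * x0) - η₀ / (ρ * x0))) := hu.sub hv
  have hmain := (hG.mul ((Real.continuous_exp.tendsto _).comp
    ((hL.const_mul a).sub hv0))).mul
    (((Real.continuous_sinc.tendsto _).comp (hL.const_mul b)).const_mul (b / Real.pi))
  have hval : Real.exp (-Real.pi * (ξ₀ - η₀) * c) / (ρ * x0) *
      Real.exp (a * (ξ₀ / (ρ * x0) - η₀ / (ρ * x0)) - 0) *
      (b / Real.pi * Real.sinc (b * (ξ₀ / (ρ * x0) - η₀ / (ρ * x0)))) = Ksin ξ₀ η₀ := by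
    have e1 : b * (ξ₀ / (ρ * x0) - η₀ / (ρ * x0)) = Real.pi * (ξ₀ - η₀) := by
      rw [hbρ]; field_simp
    have e2 : a * (ξ₀ / (ρ * x0) - η₀ / (ρ * x0)) - 0 = Real.pi * (ξ₀ - η₀) * c := by
      rw [hab, ← e1]; ring
    have e3 : b / Real.pi = ρ * x0 := by rw [hbρ]; field_simp
    rw [e1, e2, e3, ksin_eq_sinc, show -Real.pi * (ξ₀ - η₀) * c = -(Real.pi * (ξ₀ - η₀) * c) by
      ring, Real.exp_neg]
    field_simp
  rw [hval] at hmain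
  have herr : Tendsto (fun q : ℕ × (ℝ × ℝ) =>
      Real.exp (-Real.pi * (q.2.1 - q.2.2) * c) / (ρ * x0) * E q.1) l (𝓝 0) := by
    simpa using hG.mul (hE.comp hn)
  have hmainC := (Complex.continuous_ofReal.tendsto _).comp hmain
  refine (tendsto_iff_of_dist (squeeze_zero' (Eventually.of_forall fun _ => dist_nonneg) ?_
    herr)).mpr hmainC
  have hpos : ∀ {f : ℕ × (ℝ × ℝ) → ℝ} {f₀ : ℝ}, Tendsto f l (𝓝 f₀) →
      ∀ᶠ q in l, 0 < 1 + f q / (ρ * x0) / q.1 := fun hf =>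
    (by simpa using ((hf.div_const (ρ * x0)).div_atTop hN).const_add 1 :
      Tendsto _ l (𝓝 (1 : ℝ))).eventually_const_lt one_pos
  filter_upwards [hn.eventually hK', hN.eventually_ge_atTop 1, hpos hξ, hpos hη,
    hu.abs.eventually_le_const (show |ξ₀ / (ρ * x0)| < B by
      have := abs_nonneg (η₀ / (ρ * x0)); linarith),
    hv.abs.eventually_le_const (show |η₀ / (ρ * x0)| < B by
      have := abs_nonneg (ξ₀ / (ρ * x0)); linarith)] with ⟨n, ξ, η⟩ hq hn1 hξp hηp huB hvB
  simp only [hu_def, hv_def] at hq hn1 hξp hηp huB hvB ⊢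
  have hn0 : (0 : ℝ) < n := by linarith
  have hcast : (((M : ℤ) - (K : ℤ) : ℤ) : ℝ) = (M : ℝ) - K := by push_cast; ring
  have lx := log_scaled (m := (M : ℤ) - K) hn0 hx0 hρ hξp
  have ly := log_scaled (m := (M : ℤ) - K) hn0 hx0 hρ hηp
  have hz := zpow_sub_one_eq_exp (m := (M : ℤ) - K) hn0 hx0
  rw [hcast] at lx ly hz
  set ℓ := ((M : ℝ) - K) * Real.log n + Real.log x0 with hℓ
  rw [abs_mul, abs_of_pos hn0] at huB hvB
  have hq' := hq _ _ (by rw [lx, add_sub_cancel_left, le_div_iff₀' hn0]; exact huB)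
    (by rw [ly, add_sub_cancel_left, le_div_iff₀' hn0]; exact hvB)
  rw [integral_residue, lx, ly] at hq'
  set u' := Real.log (1 + ξ / (ρ * x0) / n)
  set v' := Real.log (1 + η / (ρ * x0) / n)
  rw [hz, Complex.dist_eq]
  set g := Real.exp (-Real.pi * (ξ - η) * c) with hg
  set Kn := KnMK M K ν νt n ((n : ℝ) ^ ((M : ℤ) - (K : ℤ)) * (x0 + ξ / (n * ρ)))
          ((n : ℝ) ^ ((M : ℤ) - (K : ℤ)) * (x0 + η / (n * ρ)))
  have hg0 : 0 < g := Real.exp_pos _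
  have hP : 0 ≤ g * (Real.exp ℓ / (n * x0) / ρ) := by positivity
  have key : g / (ρ * x0) * Real.exp (a * (n * u' - n * v') - v') *
      (b / Real.pi * Real.sinc (b * (n * u' - n * v'))) =
      g * (Real.exp ℓ / (n * x0) / ρ) * (Real.exp (n * a * (ℓ + u' - (ℓ + v')) - (ℓ + v')) *
        (n * b / Real.pi) * Real.sinc (n * b * (ℓ + u' - (ℓ + v')))) := by
    rw [show n * b * (ℓ + u' - (ℓ + v')) = b * (n * u' - n * v') by ring,
      show n * a * (ℓ + u' - (ℓ + v')) - (ℓ + v') = a * (n * u' - n * v') - v' - ℓ by ring,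
      Real.exp_sub _ ℓ]
    have := Real.exp_pos ℓ
    field_simp
  simp only [Function.comp_apply]
  rw [key, Complex.ofReal_mul (g * (Real.exp ℓ / (n * x0) / ρ)), ← mul_sub, norm_mul,
    Complex.norm_real, Real.norm_eq_abs, abs_of_nonneg hP]
  calc _ ≤ g * (Real.exp ℓ / (n * x0) / ρ) * (n * Real.exp (-ℓ) * E n) :=
        mul_le_mul_of_nonneg_left hq' hP
    _ = g / (ρ * x0) * E n := by
        rw [Real.exp_neg]
        have := Real.exp_pos ℓ
        field_simp

end Ginibre

/-- Bulk universality for products of Ginibre matrices and their inverses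
(Theorem 4.1). -/
theorem bulk_universality_Ginibre_inverse
    (M K : ℕ) (hM : 1 ≤ M) (hK : 1 ≤ K)
    (ν νt : ℕ → ℕ) (hν0 : ν 0 = 0) (hνt0 : νt 0 = 0) (hνtK : νt K = 0)
    (x0 : ℝ) (hx0 : 0 < x0)
    (φ : ℝ) (hφ : φ ∈ Set.Ioo (0 : ℝ) (Real.pi / ((M : ℝ) + 1)))
    (hpar : x0 =
      Real.sin (((M : ℝ) + 1) * φ / ((K : ℝ) + 1) + (K : ℝ) * Real.pi / ((K : ℝ) + 1)) ^ (M + 1) /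
        (Real.sin φ ^ (K + 1) *
          Real.sin (((M : ℝ) - (K : ℝ)) * φ / ((K : ℝ) + 1) +
            (K : ℝ) * Real.pi / ((K : ℝ) + 1)) ^ ((M : ℤ) - (K : ℤ))))
    (S : Set (ℝ × ℝ)) (hS : IsCompact S) :
    TendstoUniformlyOn
      (fun (n : ℕ) (p : ℝ × ℝ) =>
        ((Real.exp (-Real.pi * (p.1 - p.2) * (Real.cos φ / Real.sin φ)) *
            ((n : ℝ) ^ ((M : ℤ) - (K : ℤ) - 1) / ρMK M K x0 φ) : ℝ) : ℂ) *
          KnMK M K ν νt n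
            ((n : ℝ) ^ ((M : ℤ) - (K : ℤ)) * (x0 + p.1 / (n * ρMK M K x0 φ)))
            ((n : ℝ) ^ ((M : ℤ) - (K : ℤ)) * (x0 + p.2 / (n * ρMK M K x0 φ))))
      (fun p => ((Ksin p.1 p.2 : ℝ) : ℂ)) atTop S := by
  obtain ⟨a, b, hsad, hbρ, hab⟩ := Ginibre.exists_isSaddle hM hK hx0 hφ hpar
  have hρ : 0 < ρMK M K x0 φ := by
    have hb := hsad.im_pos
    rw [hbρ, mul_assoc] at hb
    exact pos_of_mul_pos_left (pos_of_mul_pos_right hb Real.pi_pos.le) hx0.le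
  rw [← tendstoLocallyUniformlyOn_iff_tendstoUniformlyOn_of_compact hS,
    tendstoLocallyUniformlyOn_iff_forall_tendsto]
  rintro ⟨ξ₀, η₀⟩ -
  have hid : Tendsto (fun q : ℕ × (ℝ × ℝ) => q.2) 
      (atTop ×ˢ nhdsWithin (ξ₀, η₀) S) (nhds (ξ₀, η₀)) :=
    tendsto_snd.mono_right nhdsWithin_le_nhds
  have hlim := hsad.tendsto_scaled_KnMK hM hK νt hν0 hx0 hρ hbρ hab tendsto_fst
    ((continuous_fst.tendsto _).comp hid) ((continuous_snd.tendsto _).comp hid)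
  have hcont : Continuous fun p : ℝ × ℝ => ((Ksin p.1 p.2 : ℝ) : ℂ) := by
    simp_rw [Ginibre.ksin_eq_sinc]
    exact Complex.continuous_ofReal.comp (Real.continuous_sinc.comp (by fun_prop))
  exact (((hcont.tendsto _).comp hid).prodMk_nhds hlim).mono_right (nhds_le_uniformity _)
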